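/- arXiv:1108.1961 — 10 statements merged into one kernel-verified Lean document; each statement's English description precedes it below -/
import Mathlib

section
/- For any f₀ ∈ L²(ν), any 0 < q ≤ 1, any t > 0, and any integer 1 ≤ m ≤ M, there exists θ^m ∈ ℝ^M with ‖θ^m‖₀ ≤ m and ‖θ^m‖₁ ≤ t such that ‖f_{θ^m} − f₀‖²_{L²(ν)} − d²(f₀; F_q(t)) ≤ 2^{2/q − 1} t² m^{1 − 2/q}. -/
open MeasureTheory Finset

/-- One greedy step of Maurey's argument: some atom does at least as well as the average one. -/
lemma exists_norm_sq_add_smul_le {E ι : Type*} [NormedAddCommGroup E] [InnerProductSpace ℝ E]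
    [Fintype ι] (w : ι → ℝ) (hw : ∀ j, 0 ≤ w j) (hw1 : ∑ j, w j = 1) (v : ι → E) (L : ℝ)
    (hv : ∀ j, ‖v j‖ ≤ L) (c : ℝ) (r : E) :
    ∃ j, ‖r + c • (v j - ∑ i, w i • v i)‖ ^ 2 ≤ ‖r‖ ^ 2 + c ^ 2 * L ^ 2 := by
  set g := ∑ i, w i • v i with hg
  by_contra! h
  have expand : ∀ j, ‖r + c • (v j - g)‖ ^ 2 = ‖r‖ ^ 2 + 2 * c * (inner ℝ r (v j) - inner ℝ r g)
      + c ^ 2 * (‖v j‖ ^ 2 - 2 * inner ℝ g (v j) + ‖g‖ ^ 2) := by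
    intro j
    rw [norm_add_sq_real, norm_smul, mul_pow, norm_sub_sq_real, inner_smul_right, inner_sub_right,
      real_inner_comm (v j) g, Real.norm_eq_abs, sq_abs]
    ring
  have inner_mean : ∀ y : E, ∑ j, w j * inner ℝ y (v j) = inner ℝ y g := by
    intro y
    simp [hg, inner_sum, inner_smul_right]
  have hgg : inner ℝ g g = ‖g‖ ^ 2 := real_inner_self_eq_norm_sq g
  have mean : ∑ j, w j * ‖r + c • (v j - g)‖ ^ 2
      = ‖r‖ ^ 2 + c ^ 2 * (∑ j, w j * ‖v j‖ ^ 2 - ‖g‖ ^ 2) := by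
    have : ∀ j, w j * ‖r + c • (v j - g)‖ ^ 2 =
        w j * (‖r‖ ^ 2 - 2 * c * inner ℝ r g + c ^ 2 * ‖g‖ ^ 2) + 2 * c * (w j * inner ℝ r (v j))
        + c ^ 2 * (w j * ‖v j‖ ^ 2) - 2 * c ^ 2 * (w j * inner ℝ g (v j)) := by
      intro j; rw [expand]; ring
    simp_rw [this]
    rw [sum_sub_distrib, sum_add_distrib, sum_add_distrib, ← sum_mul, ← mul_sum, ← mul_sum,
      ← mul_sum, inner_mean, inner_mean, hw1, hgg]
    ring
  have bound : ∑ j, w j * ‖v j‖ ^ 2 ≤ L ^ 2 := by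
    calc ∑ j, w j * ‖v j‖ ^ 2 ≤ ∑ j, w j * L ^ 2 := by
          gcongr with j
          · exact hw j
          · exact hv j
      _ = L ^ 2 := by rw [← sum_mul, hw1, one_mul]
  have lower : ∑ j, w j * (‖r‖ ^ 2 + c ^ 2 * L ^ 2) < ∑ j, w j * ‖r + c • (v j - g)‖ ^ 2 := by
    obtain ⟨i, -, hi⟩ := exists_ne_zero_of_sum_ne_zero (by rw [hw1]; exact one_ne_zero)
    refine sum_lt_sum (fun j _ => mul_le_mul_of_nonneg_left (h j).le (hw j)) ⟨i, mem_univ i, ?_⟩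
    exact mul_lt_mul_of_pos_left (h i) (lt_of_le_of_ne (hw i) (Ne.symm hi))
  rw [← sum_mul, hw1, one_mul, mean] at lower
  nlinarith [mul_le_mul_of_nonneg_left bound (sq_nonneg c), mul_nonneg (sq_nonneg c) (sq_nonneg ‖g‖)]

/-- Maurey's empirical method: `n` draws, recorded by their multiplicities `k`. -/
lemma exists_multiplicity_norm_sq_le {E ι : Type*} [NormedAddCommGroup E] [InnerProductSpace ℝ E]
    [Fintype ι] (w : ι → ℝ) (hw : ∀ j, 0 ≤ w j) (hw1 : ∑ j, w j = 1) (v : ι → E) (L : ℝ)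
    (hv : ∀ j, ‖v j‖ ≤ L) (c : ℝ) (r : E) (n : ℕ) :
    ∃ k : ι → ℕ, ∑ j, k j = n ∧
      ‖r + c • (∑ j, (k j : ℝ) • v j - (n : ℝ) • ∑ i, w i • v i)‖ ^ 2
        ≤ ‖r‖ ^ 2 + n * (c ^ 2 * L ^ 2) := by
  classical
  induction n with
  | zero => exact ⟨0, by simp, by simp⟩
  | succ n ih =>
    obtain ⟨k, hk, hle⟩ := ih
    obtain ⟨j, hj⟩ := exists_norm_sq_add_smul_le w hw hw1 v L hv c
      (r + c • (∑ j, (k j : ℝ) • v j - (n : ℝ) • ∑ i, w i • v i))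
    refine ⟨k + Pi.single j 1, by simp [sum_add_distrib, hk], ?_⟩
    have hsum : ∑ i, (((k + Pi.single j 1 : ι → ℕ) i : ℕ) : ℝ) • v i = ∑ i, (k i : ℝ) • v i + v j := by
      simp [add_smul, sum_add_distrib, Pi.single_apply]
    rw [hsum]
    refine le_trans (le_of_eq ?_) (hj.trans ?_)
    · congr 2
      push_cast
      module
    · push_cast
      linarith

/-- Keep the coefficients in `A` and replace the others by a Maurey sample of size `n`. -/
lemma exists_sparse_norm_sq_le {E ι : Type*} [NormedAddCommGroup E] [InnerProductSpace ℝ E]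
    [Fintype ι] [DecidableEq ι] (f : ι → E) (hf : ∀ j, ‖f j‖ ≤ 1) (f₀ : E) (θ : ι → ℝ)
    (A : Finset ι) (n : ℕ) (hn : 1 ≤ n) :
    ∃ η : ι → ℝ, (univ.filter (fun j => η j ≠ 0)).card ≤ A.card + n ∧
      ∑ j, |η j| ≤ ∑ j, |θ j| ∧
      ‖∑ j, η j • f j - f₀‖ ^ 2 ≤ ‖∑ j, θ j • f j - f₀‖ ^ 2 + (∑ j ∈ Aᶜ, |θ j|) ^ 2 / n := by
  set L := ∑ j ∈ Aᶜ, |θ j| with hL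
  have hL0 : 0 ≤ L := sum_nonneg fun j _ => abs_nonneg _
  rcases hL0.eq_or_lt with h0 | hpos
  · refine ⟨θ, ?_, le_rfl, by rw [← h0]; simp⟩
    have hz := (sum_eq_zero_iff_of_nonneg (fun j _ => abs_nonneg (θ j))).1 (hL ▸ h0.symm)
    refine (card_le_card fun j hj => ?_).trans (Nat.le_add_right _ n)
    by_contra hjA
    exact (mem_filter.1 hj).2 (abs_eq_zero.1 (hz j (mem_compl.2 hjA)))
  have hn0 : (n : ℝ) ≠ 0 := by positivity
  let σ : ι → ℝ := fun j => SignType.sign (θ j)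
  have hσ : ∀ j, |σ j| ≤ 1 := by
    intro j
    rcases lt_trichotomy (θ j) 0 with h | h | h <;> simp [σ, h]
  have hσθ : ∀ j, |θ j| * σ j = θ j := fun j => abs_mul_sign (θ j)
  let w : ι → ℝ := fun j => if j ∈ A then 0 else |θ j| / L
  let v : ι → E := fun j => if j ∈ A then 0 else (L * σ j) • f j
  have hw : ∀ j, 0 ≤ w j := by intro j; dsimp only [w]; split_ifs <;> positivity
  have hw1 : ∑ j, w j = 1 := by
    rw [← sum_add_sum_compl A, sum_eq_zero (s := A) (fun j hj => if_pos hj), zero_add,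
      sum_congr rfl (fun j hj => if_neg (mem_compl.1 hj)), ← sum_div, ← hL, div_self hpos.ne']
  have hv : ∀ j, ‖v j‖ ≤ L := by
    intro j
    dsimp only [v]
    split_ifs
    · simpa using hL0
    · rw [norm_smul, Real.norm_eq_abs, abs_mul, abs_of_nonneg hL0, mul_assoc]
      exact mul_le_of_le_one_right hL0 (mul_le_one₀ (hσ j) (norm_nonneg _) (hf j))
  obtain ⟨k, hk, hle⟩ := exists_multiplicity_norm_sq_le w hw hw1 v L hv (1 / n)
    (∑ j, θ j • f j - f₀) n
  refine ⟨fun j => if j ∈ A then θ j else L / n * k j * σ j, ?_, ?_, ?_⟩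
  · have hsub : univ.filter (fun j => (if j ∈ A then θ j else L / n * k j * σ j) ≠ 0)
        ⊆ A ∪ univ.filter (fun j => k j ≠ 0) := by
      intro j hj
      by_cases hjA : j ∈ A
      · exact mem_union_left _ hjA
      · refine mem_union_right _ (mem_filter.2 ⟨mem_univ j, fun hkj => ?_⟩)
        exact (mem_filter.1 hj).2 (by simp [hjA, hkj])
    refine (card_le_card hsub).trans ((card_union_le _ _).trans (Nat.add_le_add_left ?_ _))
    rw [← hk, card_filter]
    exact sum_le_sum fun j _ => by split_ifs <;> omega
  · have hkn : ∑ j, (k j : ℝ) = n := by exact_mod_cast hk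
    rw [← sum_add_sum_compl A, ← sum_add_sum_compl A (fun j => |θ j|), ← hL]
    refine add_le_add (sum_le_sum fun j hj => by simp [hj]) ?_
    calc ∑ j ∈ Aᶜ, |if j ∈ A then θ j else L / n * k j * σ j|
        ≤ ∑ j ∈ Aᶜ, L / n * k j := by
          refine sum_le_sum fun j hj => ?_
          rw [if_neg (mem_compl.1 hj), abs_mul, abs_of_nonneg (by positivity)]
          exact mul_le_of_le_one_right (by positivity) (hσ j)
      _ ≤ ∑ j, L / n * k j :=
          sum_le_sum_of_subset_of_nonneg (subset_univ _) fun j _ _ => by positivity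
      _ = L := by rw [← mul_sum, hkn]; field_simp
  · have hmean : ∑ i, w i • v i = ∑ j ∈ Aᶜ, θ j • f j := by
      rw [← sum_add_sum_compl A, sum_eq_zero (s := A) (fun j hj => by simp [w, hj]), zero_add]
      refine sum_congr rfl fun j hj => ?_
      have hj' := mem_compl.1 hj
      simp only [w, v, if_neg hj', smul_smul]
      rw [← hσθ j, hσθ j]
      congr 1
      rw [← mul_assoc, div_mul_cancel₀ _ hpos.ne', hσθ]
    have hnew : ∑ j, (if j ∈ A then θ j else L / n * k j * σ j) • f j
        = ∑ j ∈ A, θ j • f j + (1 / n : ℝ) • ∑ j, (k j : ℝ) • v j := by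
      rw [← sum_add_sum_compl A, ← sum_add_sum_compl A (fun j => (k j : ℝ) • v j),
        sum_eq_zero (s := A) (f := fun j => (k j : ℝ) • v j) (fun j hj => by simp [v, hj]),
        zero_add, smul_sum]
      congr 1
      · exact sum_congr rfl fun j hj => by simp [hj]
      · refine sum_congr rfl fun j hj => ?_
        have hj' := mem_compl.1 hj
        simp only [v, if_neg hj', smul_smul]
        congr 1
        ring
    rw [hmean, ← sum_add_sum_compl A (fun j => θ j • f j)] at hle
    rw [hnew, ← sum_add_sum_compl A (fun j => θ j • f j)]
    refine le_trans (le_of_eq ?_) (hle.trans (le_of_eq ?_))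
    · congr 2
      rw [smul_sub, smul_smul, one_div_mul_cancel hn0, one_smul]
      abel
    · congr 1
      field_simp

lemma exists_card_eq_forall_le {ι : Type*} [Fintype ι] [DecidableEq ι] (u : ι → ℝ) (k : ℕ)
    (hk : k ≤ Fintype.card ι) :
    ∃ A : Finset ι, A.card = k ∧ ∀ i ∈ A, ∀ j ∉ A, u j ≤ u i := by
  induction k with
  | zero => exact ⟨∅, by simp⟩
  | succ k ih =>
    obtain ⟨A, hA, hle⟩ := ih (by omega)
    have hne : Aᶜ.Nonempty := by
      rw [← card_pos, card_compl]
      omega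
    obtain ⟨a, ha, hmax⟩ := exists_max_image Aᶜ u hne
    have ha' := mem_compl.1 ha
    refine ⟨insert a A, by rw [card_insert_of_notMem ha', hA], fun i hi j hj => ?_⟩
    rw [mem_insert, not_or] at hj
    rcases mem_insert.1 hi with rfl | hi
    · exact hmax j (mem_compl.2 hj.2)
    · exact hle i hi j hj.2

/-- A split `m = k + n` into kept and sampled coordinates, meeting the sharp constant. -/
lemma exists_split_bound (m : ℕ) (hm : 2 ≤ m) (β : ℝ) (hβ : 0 ≤ β) :
    ∃ k n : ℕ, 1 ≤ k ∧ 1 ≤ n ∧ k + n = m ∧ ∀ x y : ℝ, 0 ≤ x → 0 ≤ y → x + y ≤ 1 →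
      y ^ 2 * (x / k) ^ β / n ≤ 2 ^ (β + 1) * (m : ℝ) ^ (-(β + 1)) := by
  have hm0 : (0 : ℝ) < m := by positivity
  have reduce : ∀ k n : ℕ, 1 ≤ k → 1 ≤ n → ∀ x y : ℝ, 0 ≤ x →
      y ^ 2 * (x * (m / (2 * k))) ^ β * (m / (2 * n)) ≤ 1 →
      y ^ 2 * (x / k) ^ β / n ≤ 2 ^ (β + 1) * (m : ℝ) ^ (-(β + 1)) := by
    intro k n hk hn x y hx h
    have hk0 : (0 : ℝ) < k := by positivity
    have hn0 : (0 : ℝ) < n := by positivity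
    have hc : (2 : ℝ) ^ (β + 1) * (m : ℝ) ^ (-(β + 1)) = (2 / m) ^ β * (2 / m) := by
      rw [Real.rpow_neg hm0.le, ← div_eq_mul_inv, ← Real.div_rpow (by norm_num) hm0.le,
        Real.rpow_add_one (by positivity)]
    have hx' : x / k = x * (m / (2 * k)) * (2 / m) := by field_simp
    rw [hc, hx', Real.mul_rpow (by positivity) (by positivity)]
    calc y ^ 2 * ((x * (m / (2 * k))) ^ β * (2 / m : ℝ) ^ β) / n
        = y ^ 2 * (x * (m / (2 * k))) ^ β * (m / (2 * n)) * ((2 / m : ℝ) ^ β * (2 / m)) := by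
          field_simp
      _ ≤ (2 / m : ℝ) ^ β * (2 / m) := mul_le_of_le_one_left (by positivity) h
  rcases Nat.even_or_odd' m with ⟨l, rfl | rfl⟩
  · have hl : 1 ≤ l := by omega
    have hl0 : (0 : ℝ) < l := by positivity
    refine ⟨l, l, hl, hl, by ring, fun x y hx hy hxy => reduce l l hl hl x y hx ?_⟩
    have h1 : ((2 * l : ℕ) : ℝ) / (2 * l) = 1 := by push_cast; field_simp
    rw [h1, mul_one, mul_one]
    exact mul_le_one₀ (by nlinarith) (by positivity) (Real.rpow_le_one hx (by linarith) hβ)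
  · have hl : 1 ≤ l := by omega
    have hl1 : (1 : ℝ) ≤ l := by exact_mod_cast hl
    rcases le_total 1 β with hβ1 | hβ1
    · refine ⟨l + 1, l, by omega, hl, by ring,
        fun x y hx hy hxy => reduce (l + 1) l (by omega) hl x y hx ?_⟩
      have h1 : ((2 * l + 1 : ℕ) : ℝ) / (2 * (l + 1 : ℕ)) ≤ 1 := by
        rw [div_le_one (by positivity)]; push_cast; linarith
      have h2 : ((2 * l + 1 : ℕ) : ℝ) / (2 * l) ≤ 3 / 2 := by
        rw [div_le_iff₀ (by positivity)]; push_cast; linarith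
      have h3 : (x * (((2 * l + 1 : ℕ) : ℝ) / (2 * (l + 1 : ℕ)))) ^ β ≤ x := by
        have hz : x * (((2 * l + 1 : ℕ) : ℝ) / (2 * (l + 1 : ℕ))) ≤ x :=
          mul_le_of_le_one_right hx h1
        refine (Real.rpow_le_rpow_of_exponent_ge_of_imp (by positivity) (by linarith) hβ1
          (fun _ h => ?_)).trans ?_
        · linarith
        · simpa using hz
      calc _ ≤ y ^ 2 * x * (3 / 2) := by gcongr
        _ ≤ 1 := by nlinarith [sq_nonneg (x - y), mul_nonneg hx hy,
            mul_nonneg (mul_nonneg hx hy) hx]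
    · refine ⟨l, l + 1, hl, by omega, by ring,
        fun x y hx hy hxy => reduce l (l + 1) hl (by omega) x y hx ?_⟩
      have h1 : ((2 * l + 1 : ℕ) : ℝ) / (2 * (l + 1 : ℕ)) ≤ 1 := by
        rw [div_le_one (by positivity)]; push_cast; linarith
      have h2 : ((2 * l + 1 : ℕ) : ℝ) / (2 * l) ≤ 3 / 2 := by
        rw [div_le_iff₀ (by positivity)]; push_cast; linarith
      set z := x * (((2 * l + 1 : ℕ) : ℝ) / (2 * l)) with hz
      have hz0 : 0 ≤ z := by positivity
      have hz1 : z ≤ 3 / 2 * x := by nlinarith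
      refine mul_le_one₀ ?_ (by positivity) h1
      rcases le_total z 1 with h | h
      · exact mul_le_one₀ (by nlinarith) (by positivity) (Real.rpow_le_one hz0 h hβ)
      · have h3 : z ^ β ≤ z := by simpa using Real.rpow_le_rpow_of_exponent_le h hβ1
        calc y ^ 2 * z ^ β ≤ y ^ 2 * (3 / 2 * x) := by gcongr; exact h3.trans hz1
          _ ≤ 1 := by nlinarith [sq_nonneg (x - y), mul_nonneg hx hy,
            mul_nonneg (mul_nonneg hx hy) hx]

lemma abs_eq_rpow_mul_rpow {q : ℝ} (hq : 0 < q) (a : ℝ) :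
    |a| = |a| ^ q * (|a| ^ q) ^ (1 / q - 1) := by
  rcases eq_or_ne a 0 with rfl | ha
  · simp [Real.zero_rpow hq.ne']
  · have h : 0 < |a| := abs_pos.2 ha
    rw [← Real.rpow_mul h.le, ← Real.rpow_add h, mul_sub, mul_one_div_cancel hq.ne']
    simp

lemma sum_abs_le_of_rpow_le {ι : Type*} (B : Finset ι) (θ : ι → ℝ) {q b : ℝ} (hq0 : 0 < q)
    (hq1 : q ≤ 1) (hb : ∀ j ∈ B, |θ j| ^ q ≤ b) :
    ∑ j ∈ B, |θ j| ≤ (∑ j ∈ B, |θ j| ^ q) * b ^ (1 / q - 1) := by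
  have hp : 0 ≤ 1 / q - 1 := sub_nonneg.2 ((one_le_div hq0).2 hq1)
  rw [sum_mul]
  refine sum_le_sum fun j hj => ?_
  calc |θ j| = |θ j| ^ q * (|θ j| ^ q) ^ (1 / q - 1) := abs_eq_rpow_mul_rpow hq0 (θ j)
    _ ≤ |θ j| ^ q * b ^ (1 / q - 1) := by
      gcongr
      exact hb j hj

lemma mul_rpow_inv_sub_one {q t : ℝ} (hq : 0 < q) (ht : 0 < t) :
    t ^ q * (t ^ q) ^ (1 / q - 1) = t := by
  simpa [abs_of_pos ht] using (abs_eq_rpow_mul_rpow hq t).symm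

lemma sum_abs_le_of_sum_rpow_le {ι : Type*} [Fintype ι] (θ : ι → ℝ) {q t : ℝ} (hq0 : 0 < q)
    (hq1 : q ≤ 1) (ht : 0 < t) (h : ∑ j, |θ j| ^ q ≤ t ^ q) : ∑ j, |θ j| ≤ t := by
  have hle := sum_abs_le_of_rpow_le univ θ hq0 hq1 (b := t ^ q) fun j _ =>
    (single_le_sum (f := fun j => |θ j| ^ q) (fun i _ => by positivity) (mem_univ j)).trans h
  calc ∑ j, |θ j| ≤ (∑ j, |θ j| ^ q) * (t ^ q) ^ (1 / q - 1) := hle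
    _ ≤ t ^ q * (t ^ q) ^ (1 / q - 1) := by gcongr
    _ = t := mul_rpow_inv_sub_one hq0 ht

lemma exists_sparse_of_sum_rpow_le {E ι : Type*} [NormedAddCommGroup E] [InnerProductSpace ℝ E]
    [Fintype ι] [DecidableEq ι] (f : ι → E) (hf : ∀ j, ‖f j‖ ≤ 1) (f₀ : E) (θ : ι → ℝ)
    {q t : ℝ} (hq0 : 0 < q) (hq1 : q ≤ 1) (ht : 0 < t) (h : ∑ j, |θ j| ^ q ≤ t ^ q)
    (m : ℕ) (hm1 : 1 ≤ m) (hmM : m ≤ Fintype.card ι) :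
    ∃ η : ι → ℝ, (univ.filter (fun j => η j ≠ 0)).card ≤ m ∧ ∑ j, |η j| ≤ t ∧
      ‖∑ j, η j • f j - f₀‖ ^ 2 ≤ ‖∑ j, θ j • f j - f₀‖ ^ 2
        + (2 : ℝ) ^ (2 / q - 1) * t ^ 2 * (m : ℝ) ^ (1 - 2 / q) := by
  have hp : 0 ≤ 1 / q - 1 := sub_nonneg.2 ((one_le_div hq0).2 hq1)
  have hl1 := sum_abs_le_of_sum_rpow_le θ hq0 hq1 ht h
  suffices ∃ (A : Finset ι) (n : ℕ), 1 ≤ n ∧ A.card + n = m ∧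
      (∑ j ∈ Aᶜ, |θ j|) ^ 2 / n ≤ (2 : ℝ) ^ (2 / q - 1) * t ^ 2 * (m : ℝ) ^ (1 - 2 / q) by
    obtain ⟨A, n, hn, hA, hle⟩ := this
    obtain ⟨η, h1, h2, h3⟩ := exists_sparse_norm_sq_le f hf f₀ θ A n hn
    exact ⟨η, hA ▸ h1, h2.trans hl1, h3.trans (by linarith)⟩
  have he : 2 / q - 1 = 2 * (1 / q - 1) + 1 := by ring
  rcases hm1.eq_or_lt with rfl | hm2
  · refine ⟨∅, 1, le_rfl, by simp, ?_⟩
    have h2 : (1 : ℝ) ≤ 2 ^ (2 / q - 1) :=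
      Real.one_le_rpow (by norm_num) (by rw [he]; positivity)
    have hs : (∑ j, |θ j|) ^ 2 ≤ t ^ 2 := by gcongr
    simp only [compl_empty, Nat.cast_one, div_one, Real.one_rpow, mul_one]
    nlinarith [sq_nonneg t]
  obtain ⟨k, n, hk, hn, hkn, hbound⟩ :=
    exists_split_bound m hm2 (2 * (1 / q - 1)) (by positivity)
  obtain ⟨A, hA, htop⟩ := exists_card_eq_forall_le (fun j => |θ j| ^ q) k (by omega)
  refine ⟨A, n, hn, by omega, ?_⟩
  have hk0 : (0 : ℝ) < k := by positivity
  have hn0 : (0 : ℝ) < n := by positivity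
  set T := t ^ q with hT
  have hT0 : 0 < T := by positivity
  set S := ∑ j ∈ A, |θ j| ^ q with hS
  set s := ∑ j ∈ Aᶜ, |θ j| ^ q with hs
  have hS0 : 0 ≤ S := sum_nonneg fun j _ => by positivity
  have hs0 : 0 ≤ s := sum_nonneg fun j _ => by positivity
  have hSs : S + s ≤ T := by rw [hS, hs, sum_add_sum_compl]; exact h
  have htail : ∑ j ∈ Aᶜ, |θ j| ≤ s * (S / k) ^ (1 / q - 1) := by
    refine sum_abs_le_of_rpow_le Aᶜ θ hq0 hq1 fun j hj => ?_
    rw [le_div_iff₀ hk0, mul_comm, ← hA, ← nsmul_eq_mul]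
    exact card_nsmul_le_sum A _ _ fun i hi => htop i hi j (mem_compl.1 hj)
  have hb := hbound (S / T) (s / T) (by positivity) (by positivity)
    (by rw [← add_div]; exact (div_le_one hT0).2 hSs)
  have hsq : ∀ x : ℝ, 0 ≤ x → x ^ (2 * (1 / q - 1)) = (x ^ (1 / q - 1)) ^ 2 := by
    intro x hx
    rw [mul_comm, Real.rpow_mul hx, Real.rpow_two]
  have hscale : s * (S / k) ^ (1 / q - 1) = t * (s / T * (S / T / k) ^ (1 / q - 1)) := by
    have : S / k = T * (S / T / k) := by field_simp
    have ht' : T * T ^ (1 / q - 1) = t := mul_rpow_inv_sub_one hq0 ht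
    rw [this, Real.mul_rpow hT0.le (by positivity)]
    nth_rewrite 1 [← div_mul_cancel₀ s hT0.ne']
    rw [← ht']
    ring
  calc (∑ j ∈ Aᶜ, |θ j|) ^ 2 / n ≤ (s * (S / k) ^ (1 / q - 1)) ^ 2 / n := by
        gcongr
    _ = t ^ 2 * ((s / T) ^ 2 * (S / T / k) ^ (2 * (1 / q - 1)) / n) := by
        rw [hscale, hsq _ (by positivity)]
        ring
    _ ≤ t ^ 2 * (2 ^ (2 * (1 / q - 1) + 1) * (m : ℝ) ^ (-(2 * (1 / q - 1) + 1))) := by gcongr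
    _ = (2 : ℝ) ^ (2 / q - 1) * t ^ 2 * (m : ℝ) ^ (1 - 2 / q) := by
        rw [← he, neg_sub]
        ring

lemma isCompact_sum_rpow_le {ι : Type*} [Fintype ι] {q t : ℝ} (hq0 : 0 < q) (hq1 : q ≤ 1)
    (ht : 0 < t) : IsCompact {θ : ι → ℝ | ∑ j, |θ j| ^ q ≤ t ^ q} := by
  refine (isCompact_closedBall (0 : ι → ℝ) t).of_isClosed_subset ?_ fun θ hθ => ?_
  · refine isClosed_le (continuous_finsetSum _ fun j _ => ?_) continuous_const
    exact (continuous_apply j).abs.rpow_const fun _ => Or.inr hq0.le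
  · rw [mem_closedBall_zero_iff, pi_norm_le_iff_of_nonneg ht.le]
    intro j
    exact (single_le_sum (f := fun j => |θ j|) (fun i _ => abs_nonneg _) (mem_univ j)).trans
      (sum_abs_le_of_sum_rpow_le θ hq0 hq1 ht hθ)

/-- **Sparse approximation in ℓ_q-hulls** (Theorem 1(ii) of Wang, Paterlini, Gao, Yang).
Given a dictionary `f 1, ..., f M` in `L²(ν)` with norms at most 1, for any target `f₀`,
any `0 < q ≤ 1`, `t > 0` and `1 ≤ m ≤ M`, there exists a coefficient vector `θ` with at most
`m` nonzero entries and `ℓ₁`-norm at most `t` such that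
`‖f_θ - f₀‖² - d²(f₀; F_q(t)) ≤ 2^(2/q-1) t² m^(1-2/q)`. -/
theorem stmt_0
    {α : Type*} [MeasurableSpace α] (ν : Measure α) [SigmaFinite ν]
    (M : ℕ) (hM : 1 ≤ M) (f : Fin M → Lp ℝ 2 ν) (hf : ∀ j, ‖f j‖ ≤ 1)
    (f₀ : Lp ℝ 2 ν) (q t : ℝ) (hq0 : 0 < q) (hq1 : q ≤ 1) (ht : 0 < t)
    (m : ℕ) (hm1 : 1 ≤ m) (hmM : m ≤ M) :
    ∃ θ : Fin M → ℝ,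
      (Finset.univ.filter (fun j => θ j ≠ 0)).card ≤ m ∧
      (∑ j, |θ j|) ≤ t ∧
      ‖(∑ j, θ j • f j) - f₀‖ ^ 2
          - sInf {r : ℝ | ∃ θ' : Fin M → ℝ,
              (∑ j, |θ' j| ^ q) ^ (1 / q) ≤ t ∧ r = ‖(∑ j, θ' j • f j) - f₀‖ ^ 2}
        ≤ (2 : ℝ) ^ (2 / q - 1) * t ^ 2 * (m : ℝ) ^ (1 - 2 / q) := by
  have hiff : ∀ θ : Fin M → ℝ,
      (∑ j, |θ j| ^ q) ^ (1 / q) ≤ t ↔ ∑ j, |θ j| ^ q ≤ t ^ q := by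
    intro θ
    rw [one_div]
    exact Real.rpow_inv_le_iff_of_pos (sum_nonneg fun j _ => by positivity) ht.le hq0
  obtain ⟨θ, hθ, hmin⟩ := (isCompact_sum_rpow_le (ι := Fin M) hq0 hq1 ht).exists_isMinOn
    ⟨0, by simp only [Set.mem_ofPred_eq, Pi.zero_apply, abs_zero, Real.zero_rpow hq0.ne',
      sum_const_zero]; positivity⟩
    (f := fun θ => ‖(∑ j, θ j • f j) - f₀‖ ^ 2) (by fun_prop)
  obtain ⟨η, h1, h2, h3⟩ := exists_sparse_of_sum_rpow_le f hf f₀ θ hq0 hq1 ht hθ m hm1 (by simpa)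
  refine ⟨η, h1, h2, ?_⟩
  have hinf : ‖(∑ j, θ j • f j) - f₀‖ ^ 2 ≤ sInf {r : ℝ | ∃ θ' : Fin M → ℝ,
      (∑ j, |θ' j| ^ q) ^ (1 / q) ≤ t ∧ r = ‖(∑ j, θ' j • f j) - f₀‖ ^ 2} := by
    refine le_csInf ⟨_, θ, (hiff θ).2 hθ, rfl⟩ ?_
    rintro r ⟨θ', hθ', rfl⟩
    exact hmin ((hiff θ').1 hθ')
  linarith
end

section
/- For every 0 < q ≤ 1 there exists a constant c_q > 0 depending only on q such that for every dictionary as above, every t > 0, and every ε with t M^{1/2 − 1/q} < ε < t, there exist functions e₁,...,e_N ∈ F_q(t) forming an ε-net of F_q(t) in the L²(ν) distance (i.e., for every f ∈ F_q(t) there is some j with ‖f − e_j‖_{L²(ν)} ≤ ε), such that each e_j can be written as e_j = f_θ for some θ with at most 5(t ε^{−1})^{2q/(2−q)} + 1 nonzero coordinates, and log N ≤ c_q (t ε^{−1})^{2q/(2−q)} log(1 + M^{1/q − 1/2} t^{−1} ε). -/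
open MeasureTheory Finset

/-- A quadratic with nonpositive leading coefficient attains its minimum over a segment at an
endpoint. -/
theorem concave_quadratic_endpoint {A B C l x h : ℝ} (hA : A ≤ 0) (hl : l ≤ x) (hh : x ≤ h) :
    A * l ^ 2 + B * l + C ≤ A * x ^ 2 + B * x + C ∨
      A * h ^ 2 + B * h + C ≤ A * x ^ 2 + B * x + C := by
  by_contra! hcon
  obtain ⟨h1, h2⟩ := hcon
  have e1 : 0 < (x - l) * -(A * (x + l) + B) := by nlinarith
  have e2 : 0 < (h - x) * (A * (h + x) + B) := by nlinarith
  have f1 : 0 < -(A * (x + l) + B) := pos_of_mul_pos_right e1 (by linarith)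
  have f2 : 0 < A * (h + x) + B := pos_of_mul_pos_right e2 (by linarith)
  nlinarith [mul_nonneg (neg_nonneg.2 hA) (by linarith : 0 ≤ h - l)]

theorem ConcaveOn.add_le_add_of_mem_Icc {s : Set ℝ} {φ : ℝ → ℝ} (hφ : ConcaveOn ℝ s φ)
    {l h x y : ℝ} (hl : l ∈ s) (hh : h ∈ s) (hlx : l ≤ x) (hxh : x ≤ h) (hsum : l + h = x + y) :
    φ l + φ h ≤ φ x + φ y := by
  rcases eq_or_lt_of_le (hlx.trans hxh) with e | hlt
  · have hx : x = l := by linarith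
    have hy : y = h := by linarith
    rw [hx, hy]
  have hd : 0 < h - l := by linarith
  have ha : 0 ≤ (h - x) / (h - l) := div_nonneg (by linarith) hd.le
  have hb : 0 ≤ (x - l) / (h - l) := div_nonneg (by linarith) hd.le
  have hab : (h - x) / (h - l) + (x - l) / (h - l) = 1 := by field_simp; ring
  have hx := hφ.2 hl hh ha hb hab
  have hy := hφ.2 hl hh hb ha (by linarith)
  simp only [smul_eq_mul] at hx hy
  have ex : (h - x) / (h - l) * l + (x - l) / (h - l) * h = x := by field_simp; ring
  have ey : (x - l) / (h - l) * l + (h - x) / (h - l) * h = y := by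
    have : y = l + h - x := by linarith
    rw [this]; field_simp; ring
  rw [ex] at hx
  rw [ey] at hy
  have : φ l + φ h = ((h - x) / (h - l) + (x - l) / (h - l)) * (φ l + φ h) := by
    rw [hab, one_mul]
  nlinarith

theorem Fintype.sum_eq_sum_add_of_eq_off_pair {ι X E : Type*} [Fintype ι] [DecidableEq ι]
    [AddCommGroup E] (F : ι → X → E) {v w : ι → X} {i j : ι} (hij : i ≠ j)
    (h : ∀ k, k ≠ i → k ≠ j → w k = v k) :
    ∑ k, F k (w k) = ∑ k, F k (v k) + ((F i (w i) - F i (v i)) + (F j (w j) - F j (v j))) := by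
  have := Fintype.sum_eq_add (f := fun k => F k (w k) - F k (v k)) i j hij
    (fun k hk => by simp [h k hk.1 hk.2])
  rw [Finset.sum_sub_distrib] at this
  rw [← this]; abel

theorem norm_sub_sq_le_four {H : Type*} [SeminormedAddCommGroup H] {x y : H}
    (hx : ‖x‖ ≤ 1) (hy : ‖y‖ ≤ 1) : ‖x - y‖ ^ 2 ≤ 4 := by
  have := norm_sub_le x y
  nlinarith [norm_nonneg (x - y)]

section Rounding

variable {H ι : Type*} [NormedAddCommGroup H] [InnerProductSpace ℝ H]

/-- Shifting mass between two coordinates in `(0, τ)` until one of them reaches `0` or `τ`, without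
increasing either the `q`-sum or the error corrected by twice the truncated square sum. -/
theorem exists_pair_shift [Fintype ι] {q τ : ℝ} (hq0 : 0 < q) (hq1 : q ≤ 1)
    (f : ι → H) (hf : ∀ j, ‖f j‖ ≤ 1) (u : H) (v : ι → ℝ) (hv : ∀ j, 0 ≤ v j) {i j : ι}
    (hij : i ≠ j) (hi : 0 < v i ∧ v i < τ) (hj : 0 < v j ∧ v j < τ) :
    ∃ w : ι → ℝ, (∀ k, 0 ≤ w k) ∧
      #{k | 0 < w k ∧ w k < τ} < #{k | 0 < v k ∧ v k < τ} ∧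
      ∑ k, w k ^ q ≤ ∑ k, v k ^ q ∧
      ‖∑ k, w k • f k - u‖ ^ 2 - 2 * ∑ k, min (w k) τ ^ 2 ≤
        ‖∑ k, v k • f k - u‖ ^ 2 - 2 * ∑ k, min (v k) τ ^ 2 := by
  classical
  have key : ∀ l h : ℝ, 0 ≤ l → 0 ≤ h → l ≤ τ → h ≤ τ → l + h = v i + v j →
      (l ≤ v i ∧ v i ≤ h ∨ h ≤ v i ∧ v i ≤ l) →
      (¬ (0 < l ∧ l < τ) ∨ ¬ (0 < h ∧ h < τ)) →
      ‖(∑ k, v k • f k - u) + (l - v i) • (f i - f j)‖ ^ 2 - 2 * (l ^ 2 + h ^ 2) ≤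
        ‖∑ k, v k • f k - u‖ ^ 2 - 2 * (v i ^ 2 + v j ^ 2) →
      ∃ w : ι → ℝ, (∀ k, 0 ≤ w k) ∧
      #{k | 0 < w k ∧ w k < τ} < #{k | 0 < v k ∧ v k < τ} ∧
      ∑ k, w k ^ q ≤ ∑ k, v k ^ q ∧
      ‖∑ k, w k • f k - u‖ ^ 2 - 2 * ∑ k, min (w k) τ ^ 2 ≤
        ‖∑ k, v k • f k - u‖ ^ 2 - 2 * ∑ k, min (v k) τ ^ 2 := by
    intro l h hl hh hlτ hhτ hsum hmid hfrac hpot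
    let w : ι → ℝ := Function.update (Function.update v i l) j h
    have wj : w j = h := by simp [w]
    have wi : w i = l := by simp [w, hij]
    have wk : ∀ k, k ≠ i → k ≠ j → w k = v k := fun k h1 h2 => by simp [w, h1, h2]
    refine ⟨w, ?_, ?_, ?_, ?_⟩
    · intro k
      by_cases h2 : k = j
      · rw [h2, wj]; exact hh
      by_cases h1 : k = i
      · rw [h1, wi]; exact hl
      rw [wk k h1 h2]; exact hv k
    · apply Finset.card_lt_card
      rw [Finset.ssubset_iff_of_subset]
      · rcases hfrac with h0 | h0
        · exact ⟨i, by simpa using hi, by simpa [wi] using h0⟩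
        · exact ⟨j, by simpa using hj, by simpa [wj] using h0⟩
      · intro k hk
        by_cases h2 : k = j
        · subst h2; simpa using hj
        by_cases h1 : k = i
        · subst h1; simpa using hi
        simpa [wk k h1 h2] using hk
    · rw [Fintype.sum_eq_sum_add_of_eq_off_pair (fun _ x => x ^ q) hij wk, wi, wj]
      have hc := Real.concaveOn_rpow hq0.le hq1
      have : l ^ q + h ^ q ≤ v i ^ q + v j ^ q := by
        rcases hmid with hm | hm
        · exact hc.add_le_add_of_mem_Icc (Set.mem_Ici.2 hl) (Set.mem_Ici.2 hh) hm.1 hm.2 hsum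
        · rw [add_comm (l ^ q)]
          exact hc.add_le_add_of_mem_Icc (Set.mem_Ici.2 hh) (Set.mem_Ici.2 hl) hm.1 hm.2
            (by linarith)
      linarith
    · rw [Fintype.sum_eq_sum_add_of_eq_off_pair (fun _ x => min x τ ^ 2) hij wk,
        Fintype.sum_eq_sum_add_of_eq_off_pair (fun k x => x • f k) hij wk, wi, wj,
        min_eq_left hlτ, min_eq_left hhτ, min_eq_left hi.2.le, min_eq_left hj.2.le]
      have : ∑ k, v k • f k + (l • f i - v i • f i + (h • f j - v j • f j)) - u =
          (∑ k, v k • f k - u) + (l - v i) • (f i - f j) := by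
        have : h = v i + v j - l := by linarith
        rw [this]; module
      rw [this]; linarith
  set a := ∑ k, v k • f k - u
  set d := f i - f j
  set s := v i + v j with hs
  obtain ⟨lo, hi', hsum, hlo0, hloi, hihi, hτ, hex⟩ : ∃ lo hi' : ℝ, lo + hi' = s ∧ 0 ≤ lo ∧
      lo ≤ v i ∧ v i ≤ hi' ∧ hi' ≤ τ ∧ (lo = 0 ∨ hi' = τ) := by
    rcases le_total s τ with h | h
    · exact ⟨0, s, by ring, le_rfl, hi.1.le, by linarith, h, Or.inl rfl⟩
    · exact ⟨s - τ, τ, by ring, by linarith, by linarith, hi.2.le, le_rfl, Or.inr rfl⟩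
  have hpoly : ∀ x, ‖a + (x - v i) • d‖ ^ 2 - 2 * (x ^ 2 + (s - x) ^ 2) =
      (‖d‖ ^ 2 - 4) * x ^ 2 + (2 * inner ℝ a d - 2 * v i * ‖d‖ ^ 2 + 4 * s) * x +
        (‖a‖ ^ 2 - 2 * v i * inner ℝ a d + v i ^ 2 * ‖d‖ ^ 2 - 2 * s ^ 2) := by
    intro x
    rw [norm_add_sq_real, inner_smul_right, norm_smul, mul_pow, Real.norm_eq_abs, sq_abs]
    ring
  have hA : ‖d‖ ^ 2 - 4 ≤ 0 := by linarith [norm_sub_sq_le_four (hf i) (hf j)]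
  have hvi : ‖a‖ ^ 2 - 2 * (v i ^ 2 + v j ^ 2) =
      ‖a + (v i - v i) • d‖ ^ 2 - 2 * (v i ^ 2 + (s - v i) ^ 2) := by simp [hs]
  rcases concave_quadratic_endpoint
    (B := 2 * inner ℝ a d - 2 * v i * ‖d‖ ^ 2 + 4 * s)
    (C := ‖a‖ ^ 2 - 2 * v i * inner ℝ a d + v i ^ 2 * ‖d‖ ^ 2 - 2 * s ^ 2) hA hloi hihi with h | h
  · rw [← hpoly, ← hpoly, ← hvi, show s - lo = hi' by linarith] at h
    refine key lo hi' hlo0 (by linarith) (by linarith) hτ hsum (Or.inl ⟨hloi, hihi⟩) ?_ h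
    rcases hex with e | e
    · left; simp [e]
    · right; simp [e]
  · rw [← hpoly, ← hpoly, ← hvi, show s - hi' = lo by linarith] at h
    refine key hi' lo (by linarith) hlo0 hτ (by linarith) (by linarith) (Or.inr ⟨hloi, hihi⟩) ?_ h
    rcases hex with e | e
    · right; simp [e]
    · left; simp [e]

theorem exists_rounding_card_le_one [Fintype ι] {q τ : ℝ} (hq0 : 0 < q) (hq1 : q ≤ 1)
    (f : ι → H) (hf : ∀ j, ‖f j‖ ≤ 1) (u : H) (v : ι → ℝ) (hv : ∀ j, 0 ≤ v j) :
    ∃ w : ι → ℝ, (∀ k, 0 ≤ w k) ∧ #{k | 0 < w k ∧ w k < τ} ≤ 1 ∧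
      ∑ k, w k ^ q ≤ ∑ k, v k ^ q ∧
      ‖∑ k, w k • f k - u‖ ^ 2 - 2 * ∑ k, min (w k) τ ^ 2 ≤
        ‖∑ k, v k • f k - u‖ ^ 2 - 2 * ∑ k, min (v k) τ ^ 2 := by
  induction hn : #{k | 0 < v k ∧ v k < τ} using Nat.strong_induction_on generalizing v with
  | _ n ih =>
    by_cases h1 : n ≤ 1
    · exact ⟨v, hv, hn ▸ h1, le_rfl, le_rfl⟩
    obtain ⟨i, hi, j, hj, hij⟩ := Finset.one_lt_card.1 (by omega : 1 < #{k | 0 < v k ∧ v k < τ})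
    obtain ⟨w, hw0, hwc, hws, hwp⟩ := exists_pair_shift hq0 hq1 f hf u v hv hij
      (by simpa using hi) (by simpa using hj)
    obtain ⟨z, hz0, hzc, hzs, hzp⟩ := ih _ (hn ▸ hwc) w hw0 rfl
    exact ⟨z, hz0, hzc, hzs.trans hws, hzp.trans hwp⟩

theorem min_le_rpow_mul_rpow {q τ x : ℝ} (hq0 : 0 < q) (hq1 : q ≤ 1) (hτ : 0 < τ) (hx : 0 ≤ x) :
    min x τ ≤ τ ^ (1 - q) * x ^ q := by
  have hm : 0 ≤ min x τ := le_min hx hτ.le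
  calc min x τ = min x τ ^ (1 - q) * min x τ ^ q := by
        rw [← Real.rpow_add_of_nonneg hm (by linarith) hq0.le]; simp
    _ ≤ τ ^ (1 - q) * x ^ q := by
        exact mul_le_mul (Real.rpow_le_rpow hm (min_le_right _ _) (by linarith))
          (Real.rpow_le_rpow hm (min_le_left _ _) hq0.le) (Real.rpow_nonneg hm _)
          (Real.rpow_nonneg hτ.le _)

theorem mul_min_le_rpow_mul_rpow {q τ x : ℝ} (hq0 : 0 < q) (hq1 : q ≤ 1) (hτ : 0 < τ)
    (hx : 0 ≤ x) : τ * min x τ ≤ τ ^ (2 - q) * x ^ q := by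
  have h := mul_le_mul_of_nonneg_left (min_le_rpow_mul_rpow hq0 hq1 hτ hx) hτ.le
  rwa [← mul_assoc, ← Real.rpow_one_add' hτ.le (by linarith),
    show 1 + (1 - q) = 2 - q by ring] at h

/-- Sparse approximation inside the `ℓ_q`-ball. -/
theorem exists_sparse_approx_of_nonneg [Fintype ι] {q τ : ℝ} (hq0 : 0 < q) (hq1 : q ≤ 1)
    (hτ : 0 < τ)
    (f : ι → H) (hf : ∀ j, ‖f j‖ ≤ 1) (v : ι → ℝ) (hv : ∀ j, 0 ≤ v j) :
    ∃ w : ι → ℝ, (∀ k, 0 ≤ w k) ∧ (#{k | w k ≠ 0} : ℝ) ≤ (∑ k, v k ^ q) / τ ^ q + 1 ∧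
      ∑ k, w k ^ q ≤ ∑ k, v k ^ q ∧
      ‖∑ k, v k • f k - ∑ k, w k • f k‖ ^ 2 ≤ 2 * (τ ^ (2 - q) * ∑ k, v k ^ q) := by
  classical
  obtain ⟨w, hw0, hwc, hws, hwp⟩ :=
    exists_rounding_card_le_one (τ := τ) hq0 hq1 f hf (∑ k, v k • f k) v hv
  refine ⟨w, hw0, ?_, hws, ?_⟩
  · have hsub : ({k | w k ≠ 0} : Finset ι) ⊆
        ({k | 0 < w k ∧ w k < τ} : Finset ι) ∪ ({k | τ ≤ w k} : Finset ι) := by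
      intro k hk
      have hk' : w k ≠ 0 := by simpa using hk
      have := lt_of_le_of_ne (hw0 k) hk'.symm
      by_cases h : w k < τ
      · simp [h, this]
      · simp [not_lt.1 h]
    have hcard : #{k | w k ≠ 0} ≤ 1 + #{k | τ ≤ w k} :=
      (Finset.card_le_card hsub).trans ((Finset.card_union_le _ _).trans (by omega))
    have hbig : (#{k | τ ≤ w k} : ℝ) * τ ^ q ≤ ∑ k, v k ^ q := by
      calc (#{k | τ ≤ w k} : ℝ) * τ ^ q = ∑ k with τ ≤ w k, τ ^ q := by simp
        _ ≤ ∑ k with τ ≤ w k, w k ^ q := Finset.sum_le_sum fun k hk => by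
            have : τ ≤ w k := by simpa using hk
            gcongr
        _ ≤ ∑ k, w k ^ q := Finset.sum_le_sum_of_subset_of_nonneg (Finset.filter_subset _ _)
            fun k _ _ => Real.rpow_nonneg (hw0 k) q
        _ ≤ _ := hws
    have : (#{k | w k ≠ 0} : ℝ) ≤ 1 + #{k | τ ≤ w k} := by exact_mod_cast hcard
    have := (le_div_iff₀ (Real.rpow_pos_of_pos hτ q)).2 hbig
    linarith
  · have h1 : ∑ k, min (w k) τ ^ 2 ≤ τ ^ (2 - q) * ∑ k, w k ^ q := by
      rw [Finset.mul_sum]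
      refine Finset.sum_le_sum fun k _ => (le_trans ?_
        (mul_min_le_rpow_mul_rpow hq0 hq1 hτ (hw0 k)))
      have : 0 ≤ min (w k) τ := le_min (hw0 k) hτ.le
      nlinarith [min_le_right (w k) τ]
    have h2 : 0 ≤ ∑ k, min (v k) τ ^ 2 := Finset.sum_nonneg fun _ _ => sq_nonneg _
    have h3 : τ ^ (2 - q) * ∑ k, w k ^ q ≤ τ ^ (2 - q) * ∑ k, v k ^ q := by gcongr
    rw [sub_self, norm_zero] at hwp
    rw [norm_sub_rev]
    linarith

theorem norm_sign_smul_le_one {x : H} (hx : ‖x‖ ≤ 1) (s : ℝ) :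
    ‖((SignType.sign s : SignType) : ℝ) • x‖ ≤ 1 := by
  rcases lt_trichotomy s 0 with h | h | h
  · simpa [h] using hx
  · simp [h]
  · simpa [h] using hx

theorem abs_sign_mul_le {w : ℝ} (hw : 0 ≤ w) (s : ℝ) :
    |w * ((SignType.sign s : SignType) : ℝ)| ≤ w := by
  rcases lt_trichotomy s 0 with h | h | h
  · simp [h, abs_of_nonneg hw]
  · simp [h, hw]
  · simp [h, abs_of_nonneg hw]

theorem exists_sparse_approx [Fintype ι] {q τ : ℝ} (hq0 : 0 < q) (hq1 : q ≤ 1) (hτ : 0 < τ)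
    (f : ι → H) (hf : ∀ j, ‖f j‖ ≤ 1) (θ : ι → ℝ) :
    ∃ ψ : ι → ℝ, (#{k | ψ k ≠ 0} : ℝ) ≤ (∑ k, |θ k| ^ q) / τ ^ q + 1 ∧
      ∑ k, |ψ k| ^ q ≤ ∑ k, |θ k| ^ q ∧
      ‖∑ k, θ k • f k - ∑ k, ψ k • f k‖ ^ 2 ≤ 2 * (τ ^ (2 - q) * ∑ k, |θ k| ^ q) := by
  obtain ⟨w, hw0, hwc, hws, hwp⟩ := exists_sparse_approx_of_nonneg hq0 hq1 hτ
    (fun k => (SignType.sign (θ k) : ℝ) • f k) (fun k => norm_sign_smul_le_one (hf k) _)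
    (fun k => |θ k|) (fun k => abs_nonneg _)
  refine ⟨fun k => w k * (SignType.sign (θ k) : ℝ), ?_, ?_, ?_⟩
  · refine le_trans ?_ hwc
    exact_mod_cast Finset.card_le_card
      (Finset.monotone_filter_right _ fun k _ h => left_ne_zero_of_mul h)
  · refine le_trans ?_ hws
    gcongr with k
    exact abs_sign_mul_le (hw0 k) _
  · simpa only [smul_smul, abs_mul_sign] using hwp

/-- One step of lattice rounding: some neighbour `τ n` of `x` does not increase the error by more
than the accounting of the `q`-th powers allows. -/
theorem exists_lattice_step {q τ x : ℝ} (hq0 : 0 < q) (hq1 : q ≤ 1) (hτ : 0 < τ) (hx : 0 ≤ x)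
    (a g : H) (hg : ‖g‖ ≤ 1) :
    ∃ n : ℕ, ‖a + (τ * n - x) • g‖ ^ 2 + τ ^ (2 - q) * (τ * n) ^ q ≤
      ‖a‖ ^ 2 + 2 * (τ ^ (2 - q) * x ^ q) := by
  set L := τ ^ (2 - q)
  have hL : 0 < L := Real.rpow_pos_of_pos hτ _
  set k := ⌊x / τ⌋₊
  have hk1 : τ * k ≤ x := by
    have := Nat.floor_le (div_nonneg hx hτ.le)
    rw [le_div_iff₀ hτ] at this; linarith
  have hk2 : x ≤ τ * (k + 1) := by
    have := (Nat.lt_floor_add_one (x / τ)).le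
    rw [div_le_iff₀ hτ] at this; linarith
  have hk0 : 0 ≤ τ * (k : ℝ) := by positivity
  set p := x - τ * k with hp
  have hp0 : 0 ≤ p := by linarith
  have hr0 : 0 ≤ τ - p := by linarith
  have hconc : (τ - p) / τ * (τ * (k : ℝ)) ^ q + p / τ * (τ * ((k + 1 : ℕ) : ℝ)) ^ q ≤ x ^ q := by
    have h := (Real.concaveOn_rpow hq0.le hq1).2 (Set.mem_Ici.2 hk0)
      (Set.mem_Ici.2 (by positivity : 0 ≤ τ * ((k + 1 : ℕ) : ℝ)))
      (div_nonneg hr0 hτ.le) (div_nonneg hp0 hτ.le) (by field_simp; ring)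
    simp only [smul_eq_mul] at h
    rwa [show (τ - p) / τ * (τ * (k : ℝ)) + p / τ * (τ * ((k + 1 : ℕ) : ℝ)) = x by
      push_cast; field_simp; rw [hp]; ring] at h
  have hpr : p * (τ - p) ≤ L * x ^ q := by
    refine le_trans ?_ (mul_min_le_rpow_mul_rpow hq0 hq1 hτ hx)
    rw [mul_comm]
    exact mul_le_mul (by linarith) (le_min (by linarith) (by linarith)) hp0 hτ.le
  have hg2 : ‖g‖ ^ 2 ≤ 1 := pow_le_one₀ (norm_nonneg _) hg
  have hexp : ∀ y : ℝ, ‖a + y • g‖ ^ 2 = ‖a‖ ^ 2 + 2 * y * inner ℝ a g + y ^ 2 * ‖g‖ ^ 2 := by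
    intro y
    rw [norm_add_sq_real, inner_smul_right, norm_smul, mul_pow, Real.norm_eq_abs, sq_abs]
    ring
  by_contra! hcon
  have h0 := hcon k
  have h1 := hcon (k + 1)
  rw [hexp] at h0 h1
  set A := (τ * (k : ℝ)) ^ q
  set B := (τ * ((k + 1 : ℕ) : ℝ)) ^ q
  rw [show τ * (k : ℝ) - x = -p by rw [hp]; ring] at h0
  rw [show τ * ((k + 1 : ℕ) : ℝ) - x = τ - p by rw [hp]; push_cast; ring] at h1
  have hc : (τ - p) * A + p * B ≤ τ * x ^ q := by
    have := mul_le_mul_of_nonneg_left hconc hτ.le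
    have e : τ * ((τ - p) / τ * A + p / τ * B) = (τ - p) * A + p * B := by field_simp
    linarith
  have m0 := mul_le_mul_of_nonneg_left h0.le hr0
  have m1 := mul_le_mul_of_nonneg_left h1.le hp0
  have hstrict : (τ - p) * (‖a‖ ^ 2 + 2 * (L * x ^ q)) + p * (‖a‖ ^ 2 + 2 * (L * x ^ q)) <
      (τ - p) * (‖a‖ ^ 2 + 2 * -p * inner ℝ a g + (-p) ^ 2 * ‖g‖ ^ 2 + L * A) +
        p * (‖a‖ ^ 2 + 2 * (τ - p) * inner ℝ a g + (τ - p) ^ 2 * ‖g‖ ^ 2 + L * B) := by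
    rcases eq_or_lt_of_le hp0 with e | hpos
    · have := mul_lt_mul_of_pos_left h0 (by linarith : 0 < τ - p)
      linarith
    · have := mul_lt_mul_of_pos_left h1 hpos
      linarith
  have hLc := mul_le_mul_of_nonneg_left hc hL.le
  have hq1' : τ * (p * (τ - p) * ‖g‖ ^ 2) ≤ τ * (L * x ^ q) := by
    refine mul_le_mul_of_nonneg_left (le_trans ?_ hpr) hτ.le
    exact mul_le_of_le_one_right (mul_nonneg hp0 hr0) hg2
  nlinarith

theorem exists_lattice_approx_of_nonneg {q τ : ℝ} (hq0 : 0 < q) (hq1 : q ≤ 1) (hτ : 0 < τ)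
    (f : ι → H) (hf : ∀ j, ‖f j‖ ≤ 1) (v : ι → ℝ) (hv : ∀ j, 0 ≤ v j) (s : Finset ι) :
    ∃ n : ι → ℕ, ‖∑ k ∈ s, (τ * n k - v k) • f k‖ ^ 2 + τ ^ (2 - q) * ∑ k ∈ s, (τ * n k) ^ q ≤
      2 * (τ ^ (2 - q) * ∑ k ∈ s, v k ^ q) := by
  classical
  induction s using Finset.induction_on with
  | empty => exact ⟨0, by simp⟩
  | insert i s his ih =>
    obtain ⟨n, hn⟩ := ih
    obtain ⟨m, hm⟩ := exists_lattice_step hq0 hq1 hτ (hv i) (∑ k ∈ s, (τ * n k - v k) • f k)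
      (f i) (hf i)
    refine ⟨Function.update n i m, ?_⟩
    have hne : ∀ k ∈ s, Function.update n i m k = n k := fun k hk =>
      Function.update_of_ne (ne_of_mem_of_not_mem hk his) _ _
    rw [Finset.sum_insert his, Finset.sum_insert his, Finset.sum_insert his,
      Function.update_self,
      Finset.sum_congr rfl fun k hk => by rw [hne k hk],
      Finset.sum_congr (g := fun k => (τ * (n k : ℝ)) ^ q) rfl fun k hk => by rw [hne k hk],
      add_comm ((τ * (m : ℝ) - v i) • f i)]
    linarith

theorem exists_lattice_approx [Fintype ι] {q τ : ℝ} (hq0 : 0 < q) (hq1 : q ≤ 1) (hτ : 0 < τ)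
    (f : ι → H) (hf : ∀ j, ‖f j‖ ≤ 1) (θ : ι → ℝ) :
    ∃ n : ι → ℤ, ∑ k, |(n k : ℝ)| ^ q ≤ 2 * (∑ k, |θ k| ^ q) / τ ^ q ∧
      ‖∑ k, θ k • f k - ∑ k, (τ * n k) • f k‖ ^ 2 ≤ 2 * (τ ^ (2 - q) * ∑ k, |θ k| ^ q) := by
  obtain ⟨n, hn⟩ := exists_lattice_approx_of_nonneg hq0 hq1 hτ
    (fun k => (SignType.sign (θ k) : ℝ) • f k) (fun k => norm_sign_smul_le_one (hf k) _)
    (fun k => |θ k|) (fun k => abs_nonneg _) Finset.univ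
  have hL : 0 < τ ^ (2 - q) := Real.rpow_pos_of_pos hτ _
  have hτq : 0 < τ ^ q := Real.rpow_pos_of_pos hτ _
  have hcast : ∀ k, ((n k * (SignType.sign (θ k) : ℤ) : ℤ) : ℝ) =
      n k * (SignType.sign (θ k) : ℝ) := by
    intro k
    push_cast
    rfl
  refine ⟨fun k => n k * (SignType.sign (θ k) : ℤ), ?_, ?_⟩
  · rw [le_div_iff₀ hτq, Finset.sum_mul]
    have h1 : ∑ k, |((n k * (SignType.sign (θ k) : ℤ) : ℤ) : ℝ)| ^ q * τ ^ q ≤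
        ∑ k, (τ * n k) ^ q := by
      refine Finset.sum_le_sum fun k _ => ?_
      rw [hcast, mul_comm, Real.mul_rpow hτ.le (Nat.cast_nonneg _)]
      gcongr
      exact abs_sign_mul_le (Nat.cast_nonneg _) _
    refine h1.trans (le_of_mul_le_mul_left ?_ hL)
    nlinarith [sq_nonneg ‖∑ k, (τ * n k - |θ k|) • (SignType.sign (θ k) : ℝ) • f k‖]
  · have h2 : 0 ≤ τ ^ (2 - q) * ∑ k, (τ * (n k : ℝ)) ^ q := by positivity
    rw [norm_sub_rev, ← Finset.sum_sub_distrib]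
    refine le_trans (le_of_eq ?_) (by linarith : ‖∑ k, (τ * n k - |θ k|) •
      (SignType.sign (θ k) : ℝ) • f k‖ ^ 2 ≤ _)
    congr 3 with k
    rw [hcast, smul_smul, ← sub_smul, sub_mul, abs_mul_sign, mul_assoc]

end Rounding

theorem summable_exp_neg_abs_rpow {q : ℝ} (hq0 : 0 < q) :
    Summable fun k : ℤ => Real.exp (-|(k : ℝ)| ^ q) := by
  have hnat : Summable fun n : ℕ => Real.exp (-(n : ℝ) ^ q) := by
    have h := (isLittleO_exp_neg_mul_rpow_atTop one_pos (-2 / q)).comp_tendsto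
      ((tendsto_rpow_atTop hq0).comp tendsto_natCast_atTop_atTop)
    refine summable_of_isBigO_nat (g := fun n : ℕ => (n : ℝ) ^ (-2 : ℝ))
      (Real.summable_nat_rpow.2 (by norm_num)) ?_
    refine h.isBigO.congr (fun n => by simp) (fun n => ?_)
    simp only [Function.comp_apply]
    rw [← Real.rpow_mul (Nat.cast_nonneg n)]
    congr 1; field_simp
  refine Summable.of_nat_of_neg ?_ ?_ <;> simpa using hnat

/-- Exponential-moment count of the integer points in an `ℓ_q`-ball. -/
theorem card_intPoints_le {ι : Type*} [Fintype ι] {q B l : ℝ} (hq0 : 0 < q) (hl : 1 ≤ l)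
    (s : Finset (ι → ℤ)) (hs : ∀ k ∈ s, ∑ j, |(k j : ℝ)| ^ q ≤ B) :
    (#s : ℝ) ≤ Real.exp (l * B + (∑' k : ℤ, Real.exp (-|(k : ℝ)| ^ q)) *
      (Fintype.card ι * Real.exp (-(l - 1)))) := by
  classical
  set C := ∑' k : ℤ, Real.exp (-|(k : ℝ)| ^ q) with hC
  set D : Finset ℤ := s.biUnion fun k => Finset.univ.image k
  have hsD : s ⊆ Fintype.piFinset fun _ => D := by
    intro k hk
    rw [Fintype.mem_piFinset]
    exact fun j => Finset.mem_biUnion.2 ⟨k, hk, Finset.mem_image_of_mem _ (Finset.mem_univ j)⟩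
  have hone : ∑ k ∈ D, Real.exp (-(l * |(k : ℝ)| ^ q)) ≤ 1 + C * Real.exp (-(l - 1)) := by
    have hterm : ∀ k : ℤ, Real.exp (-(l * |(k : ℝ)| ^ q)) ≤
        (if k = 0 then 1 else 0) + Real.exp (-|(k : ℝ)| ^ q) * Real.exp (-(l - 1)) := by
      intro k
      by_cases hk : k = 0
      · simp only [hk, Int.cast_zero, abs_zero, Real.zero_rpow hq0.ne']
        simp [Real.exp_nonneg]
      · have h1 : (1 : ℝ) ≤ |(k : ℝ)| := by exact_mod_cast Int.one_le_abs hk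
        have h2 : 1 ≤ |(k : ℝ)| ^ q := Real.one_le_rpow h1 hq0.le
        rw [if_neg hk, zero_add, ← Real.exp_add]
        apply Real.exp_le_exp.2
        nlinarith
    calc _ ≤ ∑ k ∈ D, ((if k = 0 then (1 : ℝ) else 0) +
          Real.exp (-|(k : ℝ)| ^ q) * Real.exp (-(l - 1))) := Finset.sum_le_sum fun k _ => hterm k
      _ ≤ 1 + C * Real.exp (-(l - 1)) := by
        rw [Finset.sum_add_distrib, ← Finset.sum_mul]
        gcongr
        · rw [Finset.sum_ite_eq']; split_ifs <;> norm_num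
        · exact (summable_exp_neg_abs_rpow hq0).sum_le_tsum _ fun _ _ => (Real.exp_pos _).le
  calc (#s : ℝ) = ∑ k ∈ s, (1 : ℝ) := by simp
    _ ≤ ∑ k ∈ s, Real.exp (l * B) * ∏ j, Real.exp (-(l * |(k j : ℝ)| ^ q)) := by
        refine Finset.sum_le_sum fun k hk => ?_
        rw [← Real.exp_sum, ← Real.exp_add, Finset.sum_neg_distrib, ← Finset.mul_sum]
        apply Real.one_le_exp
        nlinarith [hs k hk]
    _ = Real.exp (l * B) * ∑ k ∈ s, ∏ j, Real.exp (-(l * |(k j : ℝ)| ^ q)) := by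
        rw [Finset.mul_sum]
    _ ≤ Real.exp (l * B) * ∑ k ∈ Fintype.piFinset fun _ : ι => D,
          ∏ j, Real.exp (-(l * |(k j : ℝ)| ^ q)) := by
        gcongr
    _ = Real.exp (l * B) * (∑ k ∈ D, Real.exp (-(l * |(k : ℝ)| ^ q))) ^ Fintype.card ι := by
        rw [← Finset.prod_univ_sum (fun _ : ι => D)
          (fun _ (k : ℤ) => Real.exp (-(l * |(k : ℝ)| ^ q)))]
        simp
    _ ≤ Real.exp (l * B) * Real.exp (C * Real.exp (-(l - 1))) ^ Fintype.card ι := by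
        gcongr
        refine hone.trans ?_
        rw [add_comm]
        exact Real.add_one_le_exp _
    _ = _ := by
        rw [← Real.exp_nat_mul, ← Real.exp_add]
        ring_nf

theorem finite_intPoints {ι : Type*} [Fintype ι] {q : ℝ} (hq0 : 0 < q) (B : ℝ) :
    {k : ι → ℤ | ∑ j, |(k j : ℝ)| ^ q ≤ B}.Finite := by
  classical
  obtain ⟨L, hL⟩ := exists_nat_ge (B ^ (1 / q))
  refine (Set.finite_Icc (fun _ : ι => -(L : ℤ)) (fun _ => (L : ℤ))).subset fun k hk => ?_
  have hk' : ∀ j, |k j| ≤ (L : ℤ) := by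
    intro j
    have h1 : |(k j : ℝ)| ^ q ≤ B :=
      (Finset.single_le_sum (f := fun j => |(k j : ℝ)| ^ q)
        (fun i _ => Real.rpow_nonneg (abs_nonneg _) q) (Finset.mem_univ j)).trans hk
    have h2 := Real.rpow_le_rpow (Real.rpow_nonneg (abs_nonneg _) q) h1
      (one_div_nonneg.2 hq0.le)
    rw [← Real.rpow_mul (abs_nonneg _), mul_one_div_cancel hq0.ne', Real.rpow_one] at h2
    exact_mod_cast h2.trans hL
  exact ⟨fun j => (abs_le.1 (hk' j)).1, fun j => (abs_le.1 (hk' j)).2⟩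

/-- A subset `A` of a covered set that is itself dense in it contains an equally small net. -/
theorem exists_internal_net {E κ : Type*} [SeminormedAddCommGroup E] (F A : Set E) (s : Finset κ)
    (p : κ → E) {r r' : ℝ} (hAF : A ⊆ F) (hFA : ∀ x ∈ F, ∃ a ∈ A, ‖x - a‖ ≤ r)
    (hFp : ∀ x ∈ F, ∃ k ∈ s, ‖x - p k‖ ≤ r') :
    ∃ (N : ℕ) (e : Fin N → E), N ≤ #s ∧ (∀ i, e i ∈ A) ∧
      ∀ x ∈ F, ∃ i, ‖x - e i‖ ≤ r + 2 * r' := by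
  classical
  set s' := s.filter fun k => ∃ a ∈ A, ‖a - p k‖ ≤ r'
  have h : ∀ k : s', ∃ a ∈ A, ‖a - p k‖ ≤ r' := fun k => (Finset.mem_filter.1 k.2).2
  choose a haA ha using h
  refine ⟨#s', fun i => a (s'.equivFin.symm i), Finset.card_filter_le _ _, fun i => haA _, ?_⟩
  intro x hx
  obtain ⟨y, hyA, hy⟩ := hFA x hx
  obtain ⟨k, hk, hyk⟩ := hFp y (hAF hyA)
  let k' : s' := ⟨k, Finset.mem_filter.2 ⟨hk, y, hyA, hyk⟩⟩
  refine ⟨s'.equivFin k', ?_⟩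
  simp only [Equiv.symm_apply_apply]
  have h1 := ha k'
  have h2 := norm_sub_le_norm_sub_add_norm_sub x y (a k')
  have h3 := norm_sub_le_norm_sub_add_norm_sub y (p k) (a k')
  rw [norm_sub_rev (p k)] at h3
  linarith

theorem log_one_add_le_two_mul_log {x a : ℝ} (hx : 1 ≤ x) (ha : 1 / 2 ≤ a) :
    Real.log (1 + x) ≤ 2 * Real.log (1 + x ^ a) := by
  have h0 : 0 ≤ x := by linarith
  have h1 : x ≤ (x ^ a) ^ 2 := by
    rw [← Real.rpow_natCast, ← Real.rpow_mul h0]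
    exact Real.self_le_rpow_of_one_le hx (by push_cast; linarith)
  have h2 : 0 ≤ x ^ a := Real.rpow_nonneg h0 a
  calc Real.log (1 + x) ≤ Real.log ((1 + x ^ a) ^ 2) :=
        Real.log_le_log (by linarith) (by nlinarith)
    _ = 2 * Real.log (1 + x ^ a) := by rw [Real.log_pow]; norm_num

theorem entropy_arith {C K x a M b L : ℝ} (hC : 0 ≤ C) (hK : 0 < K) (hb : 1 ≤ b) (hM : M = x * K)
    (hx : 1 ≤ x) (ha : 1 / 2 ≤ a) (hL : L = 1 + Real.log (1 + M / (b * K))) :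
    L * (b * K) + C * (M * Real.exp (-(L - 1))) ≤
      b * (2 * C + 4) * K * Real.log (1 + x ^ a) := by
  have hbK : 0 < b * K := by positivity
  have hM0 : 0 < M := by rw [hM]; positivity
  have hpos : 0 < 1 + M / (b * K) := by positivity
  have h1 : M * Real.exp (-(L - 1)) ≤ b * K := by
    rw [hL, add_sub_cancel_left, Real.exp_neg, Real.exp_log hpos, ← div_eq_mul_inv,
      div_le_iff₀ hpos]
    have : b * K * (1 + M / (b * K)) = b * K + M := by field_simp
    linarith
  have hlog := log_one_add_le_two_mul_log hx ha
  have h2 : Real.log (1 + M / (b * K)) ≤ 2 * Real.log (1 + x ^ a) := by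
    refine le_trans (Real.log_le_log hpos ?_) hlog
    gcongr
    rw [div_le_iff₀ hbK, hM]
    nlinarith [mul_pos (by linarith : 0 < x) hK]
  have h3 : 1 ≤ 2 * Real.log (1 + x ^ a) := by
    have : Real.log 2 ≤ Real.log (1 + x ^ a) :=
      Real.log_le_log two_pos (by linarith [Real.one_le_rpow hx (by linarith : 0 ≤ a)])
    linarith [Real.log_two_gt_d9]
  have h4 := mul_le_mul_of_nonneg_left h1 hC
  have h5 : L ≤ 4 * Real.log (1 + x ^ a) := by linarith
  have h6 := mul_le_mul_of_nonneg_right h5 hbK.le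
  have h7 := mul_le_mul_of_nonneg_left h3 (mul_nonneg hC hbK.le)
  linarith

/-- The `ℓ_q`-hull of `f`, described through `q`-th powers. -/
def lqHull {H ι : Type*} [AddCommGroup H] [Module ℝ H] [Fintype ι] (f : ι → H) (q t : ℝ) : Set H :=
  {x | ∃ θ : ι → ℝ, ∑ j, |θ j| ^ q ≤ t ^ q ∧ x = ∑ j, θ j • f j}

/-- The elements of the `ℓ_q`-hull with a representation in the hull supported on at most `m`
coordinates. -/
def sparseLqHull {H ι : Type*} [AddCommGroup H] [Module ℝ H] [Fintype ι] (f : ι → H)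
    (q t m : ℝ) : Set H :=
  {x | ∃ θ : ι → ℝ, ∑ j, |θ j| ^ q ≤ t ^ q ∧ (#{j | θ j ≠ 0} : ℝ) ≤ m ∧ x = ∑ j, θ j • f j}

section Scale

variable {q t ε c K : ℝ}

theorem threshold_rpow (hq0 : 0 < q) (ht : 0 < t) (hc : 0 < c) (hK : 0 < K) :
    t ^ q / (c * t * K ^ (-1 / q)) ^ q = K / c ^ q := by
  have hKq := Real.rpow_pos_of_pos hK (-1 / q)
  rw [Real.mul_rpow (by positivity) hKq.le, Real.mul_rpow hc.le ht.le, ← Real.rpow_mul hK.le,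
    div_mul_cancel₀ _ hq0.ne', Real.rpow_neg_one]
  have := Real.rpow_pos_of_pos ht q
  have := Real.rpow_pos_of_pos hc q
  field_simp

theorem threshold_rpow_mul (hq0 : 0 < q) (hq1 : q ≤ 1) (ht : 0 < t) (hε : 0 < ε) (hc : 0 < c)
    (hKdef : K = (t * ε⁻¹) ^ (2 * q / (2 - q))) :
    (c * t * K ^ (-1 / q)) ^ (2 - q) * t ^ q = c ^ (2 - q) * ε ^ 2 := by
  have h2q : 0 < 2 - q := by linarith
  have hr : 0 < t * ε⁻¹ := by positivity
  have hK : 0 < K := hKdef ▸ Real.rpow_pos_of_pos hr _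
  have hKq := Real.rpow_pos_of_pos hK (-1 / q)
  have e : (K ^ (-1 / q)) ^ (2 - q) = ((t * ε⁻¹) ^ 2)⁻¹ := by
    rw [hKdef, ← Real.rpow_mul hr.le, ← Real.rpow_mul hr.le,
      show 2 * q / (2 - q) * (-1 / q) * (2 - q) = -2 by field_simp, Real.rpow_neg hr.le]
    norm_cast
  have e2 : t ^ (2 - q) * t ^ q = t ^ 2 := by
    rw [← Real.rpow_add ht, sub_add_cancel]; norm_cast
  rw [Real.mul_rpow (by positivity) hKq.le, Real.mul_rpow hc.le ht.le, e]
  calc c ^ (2 - q) * t ^ (2 - q) * ((t * ε⁻¹) ^ 2)⁻¹ * t ^ q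
      = c ^ (2 - q) * (t ^ (2 - q) * t ^ q) * ((t * ε⁻¹) ^ 2)⁻¹ := by ring
    _ = _ := by rw [e2]; field_simp

end Scale

section Hull

variable {H ι : Type*} [NormedAddCommGroup H] [InnerProductSpace ℝ H] [Fintype ι]
  {q t ε K : ℝ} {f : ι → H}

theorem exists_mem_sparseLqHull (hq0 : 0 < q) (hq1 : q ≤ 1) (ht : 0 < t) (hε : 0 < ε)
    (hKdef : K = (t * ε⁻¹) ^ (2 * q / (2 - q))) (hf : ∀ j, ‖f j‖ ≤ 1) {x : H}
    (hx : x ∈ lqHull f q t) : ∃ a ∈ sparseLqHull f q t (5 * K + 1), ‖x - a‖ ≤ 3 / 4 * ε := by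
  obtain ⟨θ, hθ, rfl⟩ := hx
  have hK : 0 < K := hKdef ▸ Real.rpow_pos_of_pos (by positivity) _
  set c : ℝ := 5 ^ (-1 / q)
  have hc : 0 < c := Real.rpow_pos_of_pos (by norm_num) _
  have hcq : c ^ q = 1 / 5 := by
    rw [← Real.rpow_mul (by norm_num), div_mul_cancel₀ _ hq0.ne', Real.rpow_neg_one]; norm_num
  have hc1 : c ≤ 1 := Real.rpow_le_one_of_one_le_of_nonpos (by norm_num)
    (div_nonpos_of_nonpos_of_nonneg (by norm_num) hq0.le)
  have hc2 : c ^ (2 - q) ≤ 1 / 5 := hcq ▸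
    Real.rpow_le_rpow_of_exponent_ge hc hc1 (by linarith)
  have hτ : 0 < c * t * K ^ (-1 / q) := by positivity
  obtain ⟨ψ, hcard, hψ, herr⟩ := exists_sparse_approx hq0 hq1 hτ f hf θ
  refine ⟨_, ⟨ψ, hψ.trans hθ, ?_, rfl⟩, ?_⟩
  · refine hcard.trans ?_
    have h1 := threshold_rpow hq0 ht hc hK
    have h2 : (∑ k, |θ k| ^ q) / (c * t * K ^ (-1 / q)) ^ q ≤
      t ^ q / (c * t * K ^ (-1 / q)) ^ q := by gcongr
    rw [h1, hcq] at h2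
    linarith
  · refine abs_le_of_sq_le_sq' ?_ (by positivity) |>.2
    have h2 : (c * t * K ^ (-1 / q)) ^ (2 - q) * ∑ k, |θ k| ^ q ≤
      (c * t * K ^ (-1 / q)) ^ (2 - q) * t ^ q := by gcongr
    rw [threshold_rpow_mul hq0 hq1 ht hε hc hKdef] at h2
    nlinarith [sq_nonneg ε]

theorem exists_lattice_near (hq0 : 0 < q) (hq1 : q ≤ 1) (ht : 0 < t) (hε : 0 < ε)
    (hKdef : K = (t * ε⁻¹) ^ (2 * q / (2 - q))) (hf : ∀ j, ‖f j‖ ≤ 1) {x : H}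
    (hx : x ∈ lqHull f q t) : ∃ n : ι → ℤ, ∑ j, |(n j : ℝ)| ^ q ≤ 256 * K ∧
      ‖x - ∑ j, (1 / 128 * t * K ^ (-1 / q) * n j) • f j‖ ≤ 1 / 8 * ε := by
  obtain ⟨θ, hθ, rfl⟩ := hx
  have hK : 0 < K := hKdef ▸ Real.rpow_pos_of_pos (by positivity) _
  have hc : (0 : ℝ) < 1 / 128 := by norm_num
  have hcq : (1 / 128 : ℝ) ≤ (1 / 128) ^ q := Real.self_le_rpow_of_le_one hc.le (by norm_num) hq1
  have hc2 : (1 / 128 : ℝ) ^ (2 - q) ≤ 1 / 128 :=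
    Real.rpow_le_self_of_le_one hc.le (by norm_num) (by linarith)
  have hτ : 0 < 1 / 128 * t * K ^ (-1 / q) := by positivity
  obtain ⟨n, hn, herr⟩ := exists_lattice_approx hq0 hq1 hτ f hf θ
  refine ⟨n, hn.trans ?_, ?_⟩
  · have h2 : (∑ k, |θ k| ^ q) / (1 / 128 * t * K ^ (-1 / q)) ^ q ≤
      t ^ q / (1 / 128 * t * K ^ (-1 / q)) ^ q := by gcongr
    rw [threshold_rpow hq0 ht hc hK] at h2
    have h3 : K / (1 / 128 : ℝ) ^ q ≤ K / (1 / 128) := by gcongr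
    rw [mul_div_assoc]
    linarith
  · refine abs_le_of_sq_le_sq' ?_ (by positivity) |>.2
    have h2 : (1 / 128 * t * K ^ (-1 / q)) ^ (2 - q) * ∑ k, |θ k| ^ q ≤
      (1 / 128 * t * K ^ (-1 / q)) ^ (2 - q) * t ^ q := by gcongr
    rw [threshold_rpow_mul hq0 hq1 ht hε hc hKdef] at h2
    nlinarith [sq_nonneg ε]

theorem exists_sparse_net (hq0 : 0 < q) (hq1 : q ≤ 1) (ht : 0 < t) (hε : 0 < ε)
    (hKdef : K = (t * ε⁻¹) ^ (2 * q / (2 - q))) (hf : ∀ j, ‖f j‖ ≤ 1) {l : ℝ} (hl : 1 ≤ l) :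
    ∃ (N : ℕ) (e : Fin N → H), (∀ i, e i ∈ sparseLqHull f q t (5 * K + 1)) ∧
      (∀ x ∈ lqHull f q t, ∃ i, ‖x - e i‖ ≤ ε) ∧
      (N : ℝ) ≤ Real.exp (l * (256 * K) + (∑' k : ℤ, Real.exp (-|(k : ℝ)| ^ q)) *
        (Fintype.card ι * Real.exp (-(l - 1)))) := by
  have hfin := finite_intPoints (ι := ι) hq0 (256 * K)
  obtain ⟨N, e, hN, heA, he⟩ := exists_internal_net (lqHull f q t)
    (sparseLqHull f q t (5 * K + 1)) hfin.toFinset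
    (fun n => ∑ j, (1 / 128 * t * K ^ (-1 / q) * n j) • f j) (r := 3 / 4 * ε) (r' := 1 / 8 * ε)
    (fun x ⟨θ, hθ, _, hx⟩ => ⟨θ, hθ, hx⟩)
    (fun x hx => exists_mem_sparseLqHull hq0 hq1 ht hε hKdef hf hx)
    (fun x hx => by
      obtain ⟨n, hn, h⟩ := exists_lattice_near hq0 hq1 ht hε hKdef hf hx
      exact ⟨n, hfin.mem_toFinset.2 hn, h⟩)
  refine ⟨N, e, heA, fun x hx => ?_, ?_⟩
  · obtain ⟨i, hi⟩ := he x hx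
    exact ⟨i, hi.trans (by linarith)⟩
  · exact (Nat.cast_le.2 hN).trans
      (card_intPoints_le hq0 hl _ fun k hk => hfin.mem_toFinset.1 hk)

end Hull

theorem rpow_one_div_le_iff_le_rpow {q t s : ℝ} (hq0 : 0 < q) (ht : 0 < t) (hs : 0 ≤ s) :
    s ^ (1 / q) ≤ t ↔ s ≤ t ^ q := by
  rw [one_div, Real.rpow_inv_le_iff_of_pos hs ht.le hq0]

/-- **Metric entropy of ℓ_q-hulls, sparse-net form, large ε regime**
(Theorem 1(i) of Wang, Paterlini, Gao, Yang, case `ε > t M^{1/2-1/q}`).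
For every `0 < q ≤ 1` there is a constant `c_q > 0` depending only on `q` such that for
every dictionary bounded by 1 in `L²(ν)`, every `t > 0` and every
`t M^{1/2-1/q} < ε < t`, there is an `ε`-net `e 1, ..., e N` of the hull `F_q(t)` consisting
of elements of `F_q(t)` that are representable with at most `5 (t/ε)^{2q/(2-q)} + 1` nonzero
coefficients, with `log N ≤ c_q (t/ε)^{2q/(2-q)} log (1 + M^{1/q-1/2} ε / t)`. -/
theorem stmt_1 (q : ℝ) (hq0 : 0 < q) (hq1 : q ≤ 1) :
    ∃ c : ℝ, 0 < c ∧
      ∀ (α : Type) (_ : MeasurableSpace α) (ν : Measure α) (_ : SigmaFinite ν)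
        (M : ℕ) (_ : 1 ≤ M) (f : Fin M → Lp ℝ 2 ν) (_ : ∀ j, ‖f j‖ ≤ 1)
        (t ε : ℝ) (_ : 0 < t)
        (_ : t * (M : ℝ) ^ ((1 : ℝ) / 2 - 1 / q) < ε) (_ : ε < t),
        ∃ (N : ℕ) (e : Fin N → Lp ℝ 2 ν),
          (∀ i, (∃ ψ : Fin M → ℝ, (∑ j, |ψ j| ^ q) ^ (1 / q) ≤ t ∧ e i = ∑ j, ψ j • f j) ∧
            (∃ θ : Fin M → ℝ,
              ((Finset.univ.filter (fun j => θ j ≠ 0)).card : ℝ)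
                  ≤ 5 * (t * ε⁻¹) ^ (2 * q / (2 - q)) + 1 ∧
              e i = ∑ j, θ j • f j)) ∧
          (∀ θ : Fin M → ℝ, (∑ j, |θ j| ^ q) ^ (1 / q) ≤ t →
            ∃ i, ‖(∑ j, θ j • f j) - e i‖ ≤ ε) ∧
          Real.log N ≤ c * (t * ε⁻¹) ^ (2 * q / (2 - q))
              * Real.log (1 + (M : ℝ) ^ (1 / q - (1 : ℝ) / 2) * t⁻¹ * ε) := by
  set C := ∑' k : ℤ, Real.exp (-|(k : ℝ)| ^ q)
  have hC : 0 ≤ C := tsum_nonneg fun k => (Real.exp_pos _).le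
  refine ⟨256 * (2 * C + 4), by positivity, ?_⟩
  intro α _ ν _ M hM f hf t ε ht hε1 hε2
  have hM0 : (0 : ℝ) < M := by exact_mod_cast hM
  have hε : 0 < ε := lt_of_le_of_lt (by positivity) hε1
  have h2q : 0 < 2 - q := by linarith
  have hr : 0 < t * ε⁻¹ := by positivity
  set K := (t * ε⁻¹) ^ (2 * q / (2 - q)) with hKdef
  have hK : 0 < K := Real.rpow_pos_of_pos hr _
  have ha : (0 : ℝ) < 1 / q - 1 / 2 := by
    have : 1 / 2 < 1 / q := one_div_lt_one_div_of_lt hq0 (by linarith)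
    linarith
  have hKa : K ^ (1 / q - 1 / 2 : ℝ) = t * ε⁻¹ := by
    rw [hKdef, ← Real.rpow_mul hr.le,
      show 2 * q / (2 - q) * (1 / q - 1 / 2) = 1 by field_simp, Real.rpow_one]
  have hx : (M : ℝ) ^ (1 / q - 1 / 2 : ℝ) * t⁻¹ * ε = (M / K) ^ (1 / q - 1 / 2 : ℝ) := by
    rw [Real.div_rpow hM0.le hK.le, hKa]; field_simp
  have hKM : K ≤ M := by
    rw [← Real.rpow_le_rpow_iff hK.le hM0.le ha, hKa]
    have hneg : (M : ℝ) ^ ((1 : ℝ) / 2 - 1 / q) = ((M : ℝ) ^ (1 / q - 1 / 2 : ℝ))⁻¹ := by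
      rw [← Real.rpow_neg hM0.le]; congr 1; ring
    rw [hneg, ← div_eq_mul_inv, div_lt_iff₀ (by positivity)] at hε1
    rw [← div_eq_mul_inv, div_le_iff₀ hε]
    linarith
  have hxone : 1 ≤ M / K := (one_le_div hK).2 hKM
  have hahalf : (1 : ℝ) / 2 ≤ 1 / q - 1 / 2 := by
    have : 1 ≤ 1 / q := by rw [le_div_iff₀ hq0]; linarith
    linarith
  have hl : 1 ≤ 1 + Real.log (1 + M / (256 * K)) := by
    have : 0 ≤ Real.log (1 + M / (256 * K)) :=
      Real.log_nonneg (by linarith [div_pos hM0 (by positivity : 0 < 256 * K)])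
    linarith
  obtain ⟨N, e, heA, he, hN⟩ := exists_sparse_net hq0 hq1 ht hε hKdef hf hl
  have hbound := entropy_arith hC hK (by norm_num : (1 : ℝ) ≤ 256) (div_mul_cancel₀ _ hK.ne').symm
    hxone hahalf rfl
  rw [Fintype.card_fin] at hN
  have hnonneg : ∀ θ : Fin M → ℝ, 0 ≤ ∑ j, |θ j| ^ q := fun θ =>
    Finset.sum_nonneg fun j _ => Real.rpow_nonneg (abs_nonneg _) q
  refine ⟨N, e, fun i => ?_, fun θ hθ => ?_, ?_⟩
  · obtain ⟨θ, hθ, hcard, hei⟩ := heA i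
    exact ⟨⟨θ, (rpow_one_div_le_iff_le_rpow hq0 ht (hnonneg θ)).2 hθ, hei⟩, θ, hcard, hei⟩
  · exact he _ ⟨θ, (rpow_one_div_le_iff_le_rpow hq0 ht (hnonneg θ)).1 hθ, rfl⟩
  · rw [hx]
    rcases Nat.eq_zero_or_pos N with h0 | hpos
    · have : 0 ≤ Real.log (1 + (M / K) ^ (1 / q - 1 / 2 : ℝ)) :=
        Real.log_nonneg (by linarith [Real.rpow_nonneg (by linarith : 0 ≤ M / K) (1 / q - 1 / 2)])
      rw [h0, Nat.cast_zero, Real.log_zero]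
      positivity
    · exact ((Real.log_le_iff_le_exp (by exact_mod_cast hpos)).2 hN).trans hbound
end

section
/- For every 0 < q ≤ 1 there exists a constant c_q > 0 depending only on q such that for every dictionary as above, every t > 0, and every ε with 0 < ε ≤ t M^{1/2 − 1/q} (and ε < t), there exist functions e₁,...,e_N ∈ F_q(t) forming an ε-net of F_q(t) in the L²(ν) distance, such that each e_j can be written as e_j = f_θ for some θ with at most 5(t ε^{−1})^{2q/(2−q)} + 1 nonzero coordinates, and log N ≤ c_q M log(1 + M^{1/2 − 1/q} t ε^{−1}). -/
open MeasureTheory Finset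

/-- Each coordinate of `x` can be rounded to a neighbouring integer so that the rounding errors
combine as if the `f j` were orthogonal. -/
lemma exists_int_rounding {ι H : Type*} [NormedAddCommGroup H] [InnerProductSpace ℝ H]
    (f : ι → H) (hf : ∀ j, ‖f j‖ ≤ 1) (x : ι → ℝ) (s : Finset ι) :
    ∃ k : ι → ℤ, (∀ j, |x j - k j| ≤ 1) ∧
      ‖∑ j ∈ s, (x j - k j) • f j‖ ^ 2 ≤ (s.card : ℝ) := by
  classical
  induction s using Finset.induction_on with
  | empty =>
    refine ⟨fun j => ⌊x j⌋, fun j => ?_, by simp⟩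
    rw [abs_le]
    constructor <;> linarith [Int.floor_le (x j), Int.lt_floor_add_one (x j)]
  | insert i s his ih =>
    obtain ⟨k, hk, hs⟩ := ih
    set v := ∑ j ∈ s, (x j - k j) • f j
    obtain ⟨m, hm, hmv⟩ : ∃ m : ℤ, |x i - m| ≤ 1 ∧ (x i - m) * inner ℝ (f i) v ≤ 0 := by
      rcases le_total (inner ℝ (f i) v) 0 with h | h
      · refine ⟨⌊x i⌋, ?_, mul_nonpos_of_nonneg_of_nonpos (by linarith [Int.floor_le (x i)]) h⟩
        rw [abs_le]
        constructor <;> linarith [Int.floor_le (x i), Int.lt_floor_add_one (x i)]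
      · refine ⟨⌈x i⌉, ?_, mul_nonpos_of_nonpos_of_nonneg (by linarith [Int.le_ceil (x i)]) h⟩
        rw [abs_le]
        constructor <;> linarith [Int.le_ceil (x i), Int.ceil_lt_add_one (x i)]
    refine ⟨Function.update k i m, fun j => ?_, ?_⟩
    · by_cases h : j = i
      · subst h; simpa using hm
      · simpa [h] using hk j
    · rw [Finset.sum_insert his, Finset.card_insert_of_notMem his]
      have hv : ∑ j ∈ s, (x j - (Function.update k i m j : ℤ)) • f j = v :=
        Finset.sum_congr rfl fun j hj => by
          rw [Function.update_of_ne (ne_of_mem_of_not_mem hj his)]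
      rw [hv, Function.update_self, norm_add_sq_real, inner_smul_left, norm_smul, mul_pow,
        Real.norm_eq_abs]
      have h1 : |x i - m| ^ 2 * ‖f i‖ ^ 2 ≤ 1 := by
        have := pow_le_one₀ (n := 2) (abs_nonneg _) hm
        have := pow_le_one₀ (n := 2) (norm_nonneg _) (hf i)
        exact mul_le_one₀ ‹_› (by positivity) ‹_›
      push_cast
      simp only [conj_trivial]
      linarith

lemma rpow_le_mul_exp {p y : ℝ} (hp : 0 < p) (hy : 0 ≤ y) :
    y ^ p ≤ p ^ p * Real.exp y := by
  have h : y ≤ p * Real.exp (y / p) := by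
    have := Real.add_one_le_exp (y / p)
    calc y = p * (y / p) := by field_simp
      _ ≤ p * Real.exp (y / p) := by gcongr; linarith
  calc y ^ p ≤ (p * Real.exp (y / p)) ^ p := Real.rpow_le_rpow hy h hp.le
    _ = p ^ p * Real.exp y := by
      rw [Real.mul_rpow hp.le (Real.exp_pos _).le, ← Real.exp_mul, div_mul_cancel₀ _ hp.ne']

lemma sum_exp_neg_rpow_le {q B : ℝ} (hq : 0 < q) (hB : 0 < B) (s : Finset ℤ) :
    ∑ k ∈ s, Real.exp (-(|(k : ℝ)| ^ q / B ^ q)) ≤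
      1 + (2 / q) ^ (2 / q) * B ^ 2 * ∑' k : ℤ, 1 / (k : ℝ) ^ 2 := by
  have hS : Summable fun k : ℤ => 1 / (k : ℝ) ^ 2 :=
    Real.summable_one_div_int_pow.mpr one_lt_two
  set K := (2 / q) ^ (2 / q)
  have hK : 0 < K := by positivity
  have hterm : ∀ k : ℤ, Real.exp (-(|(k : ℝ)| ^ q / B ^ q)) ≤
      (if k = 0 then 1 else 0) + K * B ^ 2 * (1 / (k : ℝ) ^ 2) := by
    intro k
    by_cases hk : k = 0
    · subst hk; simp [Real.zero_rpow hq.ne']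
    · have hk' : (k : ℝ) ≠ 0 := by exact_mod_cast hk
      have hk2 : 0 < (k : ℝ) ^ 2 := by positivity
      have h := rpow_le_mul_exp (p := 2 / q) (y := (|(k : ℝ)| / B) ^ q) (by positivity)
        (by positivity)
      rw [← Real.rpow_mul (by positivity), mul_div_cancel₀ _ hq.ne', Real.rpow_two, div_pow,
        sq_abs, Real.div_rpow (abs_nonneg _) hB.le, div_le_iff₀ (by positivity)] at h
      rw [if_neg hk, zero_add, Real.exp_neg, inv_eq_one_div, mul_one_div,
        div_le_div_iff₀ (Real.exp_pos _) hk2]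
      linarith
  calc _ ≤ ∑ k ∈ s, ((if k = 0 then 1 else 0) + K * B ^ 2 * (1 / (k : ℝ) ^ 2)) :=
        Finset.sum_le_sum fun k _ => hterm k
    _ ≤ _ := by
        rw [Finset.sum_add_distrib, ← Finset.mul_sum]
        refine add_le_add ?_ ?_
        · rw [Finset.sum_ite_eq']
          split_ifs <;> norm_num
        · gcongr
          exact hS.sum_le_tsum s fun k _ => by positivity

/-- Exponential-moment bound for the number of lattice points in an `ℓ_q`-ball. -/
lemma card_lattice_points_le {ι : Type*} [Fintype ι] [DecidableEq ι] {q B R : ℝ} (hq : 0 < q)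
    (hB : 0 < B) (s : Finset ℤ) (S : Finset (ι → ℤ)) (hSs : S ⊆ Fintype.piFinset fun _ => s)
    (hS : ∀ k ∈ S, ∑ j, |(k j : ℝ)| ^ q / B ^ q ≤ R) :
    (S.card : ℝ) ≤ Real.exp R *
      (1 + (2 / q) ^ (2 / q) * B ^ 2 * ∑' k : ℤ, 1 / (k : ℝ) ^ 2) ^ Fintype.card ι := by
  have hw : ∀ k ∈ S, (1 : ℝ) ≤
      Real.exp R * ∏ j, Real.exp (-(|(k j : ℝ)| ^ q / B ^ q)) := by
    intro k hk
    rw [← Real.exp_sum, ← Real.exp_add, Finset.sum_neg_distrib]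
    exact Real.one_le_exp (by linarith [hS k hk])
  calc (S.card : ℝ) = ∑ k ∈ S, (1 : ℝ) := by simp
    _ ≤ ∑ k ∈ S, Real.exp R * ∏ j, Real.exp (-(|(k j : ℝ)| ^ q / B ^ q)) :=
        Finset.sum_le_sum hw
    _ ≤ ∑ k ∈ Fintype.piFinset fun _ : ι => s,
          Real.exp R * ∏ j, Real.exp (-(|(k j : ℝ)| ^ q / B ^ q)) :=
        Finset.sum_le_sum_of_subset_of_nonneg hSs fun _ _ _ => by positivity
    _ = Real.exp R * (∑ k ∈ s, Real.exp (-(|(k : ℝ)| ^ q / B ^ q))) ^ Fintype.card ι := by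
        rw [← Finset.mul_sum, ← Finset.prod_univ_sum (fun _ : ι => s)
          (fun _ (k : ℤ) => Real.exp (-(|(k : ℝ)| ^ q / B ^ q))), Finset.prod_const,
          Finset.card_univ]
    _ ≤ _ := by
        gcongr
        exact sum_exp_neg_rpow_le hq hB s

/-- A finite `η`-cover of `F` by arbitrary points yields a `2η`-net of points of `F`. -/
lemma exists_internal_net_s2 {H κ : Type*} [SeminormedAddCommGroup H] (F : Set H) (S : Finset κ)
    (g : κ → H) (η : ℝ) (hg : ∀ u ∈ F, ∃ k ∈ S, ‖u - g k‖ ≤ η) :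
    ∃ (N : ℕ) (e : Fin N → H), N ≤ S.card ∧ (∀ i, e i ∈ F) ∧
      ∀ u ∈ F, ∃ i, ‖u - e i‖ ≤ 2 * η := by
  classical
  set S' := S.filter fun k => ∃ u ∈ F, ‖u - g k‖ ≤ η
  have hS' : ∀ k : S', ∃ u ∈ F, ‖u - g k‖ ≤ η := fun k => (Finset.mem_filter.mp k.2).2
  choose p hpF hp using hS'
  refine ⟨S'.card, fun i => p (S'.equivFin.symm i), Finset.card_filter_le _ _,
    fun i => hpF _, fun u hu => ?_⟩
  obtain ⟨k, hk, huk⟩ := hg u hu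
  let k' : S' := ⟨k, Finset.mem_filter.mpr ⟨hk, u, hu, huk⟩⟩
  refine ⟨S'.equivFin k', ?_⟩
  simp only [Equiv.symm_apply_apply]
  calc ‖u - p k'‖ ≤ ‖u - g k‖ + ‖g k - p k'‖ := norm_sub_le_norm_sub_add_norm_sub _ _ _
    _ ≤ 2 * η := by
      have := hp k'
      rw [norm_sub_rev] at this
      linarith

/-- Finite lattice cover of an `ℓ_q`-hull at scale `√M δ`. -/
lemma exists_lattice_cover {ι H : Type*} [Fintype ι] [NormedAddCommGroup H]
    [InnerProductSpace ℝ H] (f : ι → H) (hf : ∀ j, ‖f j‖ ≤ 1)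
    {q t δ B : ℝ} (hq0 : 0 < q) (hq1 : q ≤ 1) (ht : 0 < t) (hδ : 0 < δ) (hB : 1 ≤ B)
    (htδ : (t / δ) ^ q = B ^ q * Fintype.card ι) :
    ∃ S : Finset (ι → ℤ),
      (∀ θ : ι → ℝ, ∑ j, |θ j| ^ q ≤ t ^ q →
        ∃ k ∈ S, ‖∑ j, θ j • f j - ∑ j, (δ * k j) • f j‖ ≤ δ * √(Fintype.card ι)) ∧
      (S.card : ℝ) ≤ Real.exp (2 * Fintype.card ι) *
        (1 + (2 / q) ^ (2 / q) * B ^ 2 * ∑' k : ℤ, 1 / (k : ℝ) ^ 2) ^ Fintype.card ι := by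
  classical
  have hB0 : 0 < B := by linarith
  have hBq : 1 ≤ B ^ q := Real.one_le_rpow hB hq0.le
  set L : ℤ := ⌈t / δ + 1⌉
  set S : Finset (ι → ℤ) := (Fintype.piFinset fun _ => Finset.Icc (-L) L).filter
    fun k => ∑ j, |(k j : ℝ)| ^ q / B ^ q ≤ 2 * Fintype.card ι
  refine ⟨S, fun θ hθ => ?_, card_lattice_points_le hq0 hB0 _ S (Finset.filter_subset _ _)
    fun k hk => (Finset.mem_filter.mp hk).2⟩
  obtain ⟨k, hk, hks⟩ := exists_int_rounding f hf (fun j => θ j / δ) Finset.univ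
  have habs : ∀ j, |(k j : ℝ)| ≤ |θ j| / δ + 1 := by
    intro j
    have h1 := abs_sub_abs_le_abs_sub (k j : ℝ) (θ j / δ)
    rw [abs_sub_comm, abs_div, abs_of_pos hδ] at h1
    linarith [hk j]
  have hθt : ∀ j, |θ j| ≤ t := by
    intro j
    refine (Real.rpow_le_rpow_iff (abs_nonneg _) ht.le hq0).mp (le_trans ?_ hθ)
    exact Finset.single_le_sum (f := fun j => |θ j| ^ q) (fun i _ => by positivity)
      (Finset.mem_univ j)
  refine ⟨k, Finset.mem_filter.mpr ⟨Fintype.mem_piFinset.mpr fun j => ?_, ?_⟩, ?_⟩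
  · have hL : |(k j : ℝ)| ≤ L := calc
      |(k j : ℝ)| ≤ |θ j| / δ + 1 := habs j
      _ ≤ t / δ + 1 := by gcongr; exact hθt j
      _ ≤ L := Int.le_ceil _
    rw [Finset.mem_Icc, ← abs_le]
    exact_mod_cast hL
  · have hj : ∀ j, |(k j : ℝ)| ^ q ≤ |θ j| ^ q / δ ^ q + 1 := by
      intro j
      calc |(k j : ℝ)| ^ q ≤ (|θ j| / δ + 1) ^ q :=
            Real.rpow_le_rpow (abs_nonneg _) (habs j) hq0.le
        _ ≤ (|θ j| / δ) ^ q + 1 ^ q :=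
            Real.rpow_add_le_add_rpow (by positivity) zero_le_one hq0.le hq1
        _ = _ := by rw [Real.div_rpow (abs_nonneg _) hδ.le, Real.one_rpow]
    have hsum : ∑ j, |(k j : ℝ)| ^ q ≤ B ^ q * Fintype.card ι + Fintype.card ι := by
      calc ∑ j, |(k j : ℝ)| ^ q ≤ ∑ j, (|θ j| ^ q / δ ^ q + 1) :=
            Finset.sum_le_sum fun j _ => hj j
        _ = (∑ j, |θ j| ^ q) / δ ^ q + Fintype.card ι := by
            rw [Finset.sum_add_distrib, Finset.sum_div]; simp
        _ ≤ t ^ q / δ ^ q + Fintype.card ι := by gcongr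
        _ = _ := by rw [← Real.div_rpow ht.le hδ.le, htδ]
    rw [← Finset.sum_div, div_le_iff₀ (by positivity)]
    have : (Fintype.card ι : ℝ) ≤ B ^ q * Fintype.card ι :=
      le_mul_of_one_le_left (by positivity) hBq
    linarith
  · have heq : ∑ j, θ j • f j - ∑ j, (δ * k j) • f j =
        δ • ∑ j, (θ j / δ - k j) • f j := by
      rw [← Finset.sum_sub_distrib, Finset.smul_sum]
      refine Finset.sum_congr rfl fun j _ => ?_
      rw [← sub_smul, smul_smul]
      congr 1
      field_simp
    rw [heq, norm_smul, Real.norm_eq_abs, abs_of_pos hδ]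
    gcongr
    exact Real.le_sqrt_of_sq_le hks

/-- **Metric entropy of ℓ_q-hulls, sparse-net form, small ε regime**
(Theorem 1(i) of Wang, Paterlini, Gao, Yang, case `ε ≤ t M^{1/2-1/q}`).
For every `0 < q ≤ 1` there is a constant `c_q > 0` depending only on `q` such that for
every dictionary bounded by 1 in `L²(ν)`, every `t > 0` and every
`t M^{1/2-1/q} < ε < t`, there is an `ε`-net `e 1, ..., e N` of the hull `F_q(t)` consisting
of elements of `F_q(t)` that are representable with at most `5 (t/ε)^{2q/(2-q)} + 1` nonzero
coefficients, with `log N ≤ c_q M log (1 + M^{1/2-1/q} t / ε)`. -/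
theorem stmt_2 (q : ℝ) (hq0 : 0 < q) (hq1 : q ≤ 1) :
    ∃ c : ℝ, 0 < c ∧
      ∀ (α : Type) (_ : MeasurableSpace α) (ν : Measure α) (_ : SigmaFinite ν)
        (M : ℕ) (_ : 1 ≤ M) (f : Fin M → Lp ℝ 2 ν) (_ : ∀ j, ‖f j‖ ≤ 1)
        (t ε : ℝ) (_ : 0 < t) (_ : 0 < ε)
        (_ : ε ≤ t * (M : ℝ) ^ ((1 : ℝ) / 2 - 1 / q)) (_ : ε < t),
        ∃ (N : ℕ) (e : Fin N → Lp ℝ 2 ν),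
          (∀ i, (∃ ψ : Fin M → ℝ, (∑ j, |ψ j| ^ q) ^ (1 / q) ≤ t ∧ e i = ∑ j, ψ j • f j) ∧
            (∃ θ : Fin M → ℝ,
              ((Finset.univ.filter (fun j => θ j ≠ 0)).card : ℝ)
                  ≤ 5 * (t * ε⁻¹) ^ (2 * q / (2 - q)) + 1 ∧
              e i = ∑ j, θ j • f j)) ∧
          (∀ θ : Fin M → ℝ, (∑ j, |θ j| ^ q) ^ (1 / q) ≤ t →
            ∃ i, ‖(∑ j, θ j • f j) - e i‖ ≤ ε) ∧
          Real.log N ≤ c * (M : ℝ)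
              * Real.log (1 + (M : ℝ) ^ ((1 : ℝ) / 2 - 1 / q) * t * ε⁻¹) := by
  set Z : ℝ := ∑' k : ℤ, 1 / (k : ℝ) ^ 2
  set K : ℝ := (2 / q) ^ (2 / q)
  have hZ : 0 ≤ Z := tsum_nonneg fun k => by positivity
  have hK : 0 < K := by positivity
  set D : ℝ := 1 + 4 * K * Z
  have hD1 : 1 ≤ D := by
    have : 0 ≤ 4 * K * Z := by positivity
    linarith
  have hlogD : 0 ≤ Real.log D := Real.log_nonneg hD1
  have hlog2 : 0 < Real.log 2 := Real.log_pos one_lt_two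
  refine ⟨(2 + Real.log D) / Real.log 2 + 2, by positivity, ?_⟩
  intro α _ ν _ M hM f hf t ε ht hε hεM _
  have hM0 : (0 : ℝ) < M := by exact_mod_cast hM
  set A : ℝ := (M : ℝ) ^ ((1 : ℝ) / 2 - 1 / q) * t * ε⁻¹
  have hA1 : 1 ≤ A := by
    simp only [A]
    rw [← div_eq_mul_inv, le_div_iff₀ hε]
    linarith
  have hsM : 0 < √(M : ℝ) := Real.sqrt_pos.mpr hM0
  set δ : ℝ := ε / (2 * √(M : ℝ))
  have hδ : 0 < δ := by positivity
  have htδ : (t / δ) ^ q = (2 * A) ^ q * Fintype.card (Fin M) := by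
    have h : t / δ = 2 * A * (M : ℝ) ^ (1 / q) := by
      have h1 : (M : ℝ) ^ ((1 : ℝ) / 2 - 1 / q) * (M : ℝ) ^ (1 / q) = √(M : ℝ) := by
        rw [← Real.rpow_add hM0, sub_add_cancel, Real.sqrt_eq_rpow]
      calc t / δ = 2 * t * √(M : ℝ) * ε⁻¹ := by
            simp only [δ]; field_simp
        _ = _ := by rw [← h1]; ring
    rw [h, Real.mul_rpow (by positivity) (by positivity), ← Real.rpow_mul hM0.le,
      one_div_mul_cancel hq0.ne', Real.rpow_one, Fintype.card_fin]
  obtain ⟨S, hcover, hcard⟩ :=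
    exists_lattice_cover f hf hq0 hq1 ht hδ (by linarith) htδ
  rw [Fintype.card_fin] at hcover hcard
  have hδM : δ * √(M : ℝ) = ε / 2 := by
    simp only [δ]; field_simp
  obtain ⟨N, e, hN, heF, hnet⟩ := exists_internal_net_s2
    {u : Lp ℝ 2 ν | ∃ ψ : Fin M → ℝ, (∑ j, |ψ j| ^ q) ^ (1 / q) ≤ t ∧ u = ∑ j, ψ j • f j}
    S (fun k => ∑ j, (δ * k j) • f j) (ε / 2) (by
      rintro u ⟨ψ, hψ, rfl⟩
      rw [← hδM]
      refine hcover ψ ?_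
      have h0 : 0 ≤ ∑ j, |ψ j| ^ q := Finset.sum_nonneg fun j _ => by positivity
      have h := Real.rpow_le_rpow (by positivity) hψ hq0.le
      rwa [← Real.rpow_mul h0, one_div_mul_cancel hq0.ne', Real.rpow_one] at h)
  refine ⟨N, e, fun i => ⟨heF i, ?_⟩, fun θ hθ => ?_, ?_⟩
  · obtain ⟨ψ, -, hψ⟩ := heF i
    refine ⟨ψ, ?_, hψ⟩
    have hcardM : ((Finset.univ.filter (fun j => ψ j ≠ 0)).card : ℝ) ≤ M := by
      exact_mod_cast (Finset.card_filter_le _ _).trans (by simp)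
    have h2q : 0 < 2 - q := by linarith
    have hbase : (M : ℝ) ^ (1 / q - (1 : ℝ) / 2) ≤ t * ε⁻¹ := by
      rw [← neg_sub, Real.rpow_neg hM0.le, ← div_eq_mul_inv, le_div_iff₀ hε,
        inv_mul_le_iff₀ (by positivity)]
      linarith
    have hMle : (M : ℝ) ≤ (t * ε⁻¹) ^ (2 * q / (2 - q)) := by
      have h := Real.rpow_le_rpow (by positivity) hbase
        (show 0 ≤ 2 * q / (2 - q) by positivity)
      rw [← Real.rpow_mul hM0.le] at h
      have h1 : (1 / q - (1 : ℝ) / 2) * (2 * q / (2 - q)) = 1 := by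
        have := h2q.ne'
        field_simp
      rwa [h1, Real.rpow_one] at h
    linarith
  · obtain ⟨i, hi⟩ := hnet _ ⟨θ, hθ, rfl⟩
    exact ⟨i, by linarith⟩
  · have hlogA : Real.log 2 ≤ Real.log (1 + A) := Real.log_le_log two_pos (by linarith)
    have hND : (N : ℝ) ≤ Real.exp (2 * M) * (D * (1 + A) ^ 2) ^ M := by
      refine (Nat.cast_le.mpr hN).trans (hcard.trans ?_)
      gcongr
      have h1 : 0 ≤ K * Z := by positivity
      have h2 : (1 : ℝ) ≤ (1 + A) ^ 2 := one_le_pow₀ (by linarith)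
      have h3 : A ^ 2 ≤ (1 + A) ^ 2 := by gcongr; linarith
      have h4 := mul_le_mul_of_nonneg_left h3 h1
      simp only [D]
      nlinarith
    have hD0 : 0 < D := by linarith
    have hA0 : 0 < 1 + A := by linarith
    have hlogN : Real.log N ≤ M * (2 + Real.log D + 2 * Real.log (1 + A)) := by
      rcases Nat.eq_zero_or_pos N with h | h
      · have : 0 ≤ Real.log (1 + A) := by linarith
        simp only [h, Nat.cast_zero, Real.log_zero]
        positivity
      · refine (Real.log_le_log (by exact_mod_cast h) hND).trans_eq ?_
        rw [Real.log_mul (Real.exp_ne_zero _) (by positivity), Real.log_exp, Real.log_pow,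
          Real.log_mul hD0.ne' (by positivity), Real.log_pow]
        push_cast
        ring
    have hconst : 2 + Real.log D ≤ (2 + Real.log D) / Real.log 2 * Real.log (1 + A) := by
      rw [div_mul_eq_mul_div, le_div_iff₀ hlog2]
      gcongr
    calc Real.log N ≤ M * (2 + Real.log D + 2 * Real.log (1 + A)) := hlogN
      _ ≤ M * ((2 + Real.log D) / Real.log 2 * Real.log (1 + A) + 2 * Real.log (1 + A)) := by
          gcongr
      _ = _ := by ring
end

section
/- Let D > 0 and let g = ∑_{j=1}^M c_j f_j with ∑_{j=1}^M |c_j| ≤ D. Then for every positive integer m there exist integers k₁,...,k_M with ∑_{j=1}^M |k_j| ≤ m such that ‖(D/m) ∑_{j=1}^M k_j f_j − g‖_{L²(ν)} ≤ D/√m; in particular the approximant (D/m)∑_j k_j f_j has at most m nonzero coefficients. -/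
open MeasureTheory Finset

/-- If `g` is a sub-convex combination of vectors `v i` in the ball of radius `D`, then one of the
vectors `0, v i` can be added to `u - g` so that the squared norm grows by at most `D ^ 2`. -/
lemma norm_sub_sq_le_or_exists_norm_add_sub_sq_le {E ι : Type*} [NormedAddCommGroup E]
    [InnerProductSpace ℝ E] [Fintype ι] {w : ι → ℝ} (hw : ∀ i, 0 ≤ w i) (hw1 : ∑ i, w i ≤ 1)
    {v : ι → E} {D : ℝ} (hv : ∀ i, ‖v i‖ ≤ D) {g : E} (hg : ∑ i, w i • v i = g) (u : E) :
    ‖u - g‖ ^ 2 ≤ ‖u‖ ^ 2 + D ^ 2 ∨ ∃ i, ‖u + v i - g‖ ^ 2 ≤ ‖u‖ ^ 2 + D ^ 2 := by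
  by_contra! ⟨h0, h1⟩
  have hsq : ∑ i, w i * ‖v i‖ ^ 2 ≤ (∑ i, w i) * D ^ 2 := by
    rw [sum_mul]
    gcongr with i
    · exact hw i
    · exact hv i
  have hinner : ∑ i, w i * inner ℝ (u - g) (v i) = inner ℝ (u - g) g := by
    nth_rw 3 [← hg]
    simp only [inner_sum, real_inner_smul_right]
  have hexp : ∑ i, w i * (‖u + v i - g‖ ^ 2 - (‖u‖ ^ 2 + D ^ 2)) =
      (∑ i, w i) * (‖u - g‖ ^ 2 - (‖u‖ ^ 2 + D ^ 2)) + 2 * inner ℝ (u - g) g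
        + ∑ i, w i * ‖v i‖ ^ 2 := by
    rw [← hinner, sum_mul, mul_sum, ← sum_add_distrib, ← sum_add_distrib]
    refine sum_congr rfl fun i _ ↦ ?_
    rw [add_sub_right_comm, norm_add_sq_real]
    ring
  have hu : ‖u‖ ^ 2 = ‖u - g‖ ^ 2 + 2 * inner ℝ (u - g) g + ‖g‖ ^ 2 := by
    rw [← norm_add_sq_real, sub_add_cancel]
  have hnonneg : ∀ i ∈ univ, 0 ≤ w i * (‖u + v i - g‖ ^ 2 - (‖u‖ ^ 2 + D ^ 2)) :=
    fun i _ ↦ mul_nonneg (hw i) (sub_nonneg.2 (h1 i).le)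
  have hle : ∑ i, w i * (‖u + v i - g‖ ^ 2 - (‖u‖ ^ 2 + D ^ 2)) +
      (1 - ∑ i, w i) * (‖u - g‖ ^ 2 - (‖u‖ ^ 2 + D ^ 2)) ≤ 0 := by
    nlinarith [sq_nonneg ‖g‖, sq_nonneg D]
  have hsum := sum_nonneg hnonneg
  have hrest := mul_nonneg (sub_nonneg.2 hw1) (sub_pos.2 h0).le
  have hw0 : ∑ i, w i = 0 := by
    refine sum_eq_zero fun i hi ↦ ?_
    have := (sum_eq_zero_iff_of_nonneg hnonneg).1 (by linarith) i hi
    exact (mul_eq_zero.1 this).resolve_right (sub_pos.2 (h1 i)).ne'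
  rw [hw0] at hle
  linarith

/-- Greedy form of Maurey's argument: unnormalized integer approximations of the multiples of
`∑ j, c j • f j`. -/
lemma exists_int_norm_smul_sum_sub_sq_le {E ι : Type*} [NormedAddCommGroup E]
    [InnerProductSpace ℝ E] [Fintype ι] {f : ι → E} (hf : ∀ j, ‖f j‖ ≤ 1) {D : ℝ} (hD : 0 < D)
    {c : ι → ℝ} (hc : ∑ j, |c j| ≤ D) (n : ℕ) :
    ∃ k : ι → ℤ, ∑ j, |k j| ≤ (n : ℤ) ∧
      ‖D • (∑ j, (k j : ℝ) • f j) - (n : ℝ) • ∑ j, c j • f j‖ ^ 2 ≤ n * D ^ 2 := by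
  classical
  induction n with
  | zero => exact ⟨0, by simp⟩
  | succ n ih =>
    obtain ⟨k, hk, hnorm⟩ := ih
    obtain ⟨s, hs, hs1⟩ : ∃ s : ι → ℤ, (∀ j, |c j| * (s j : ℝ) = c j) ∧ ∀ j, |s j| ≤ 1 := by
      refine ⟨fun j ↦ (SignType.sign (c j) : ℤ), fun j ↦ by simp, fun j ↦ ?_⟩
      have habs : ∀ t : SignType, |(t : ℤ)| ≤ 1 := by decide
      exact habs _
    have hs1' : ∀ j, |(s j : ℝ)| ≤ 1 := fun j ↦ by exact_mod_cast hs1 j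
    have hw : ∑ j, |c j| / D ≤ 1 := by
      rw [← sum_div]
      exact (div_le_one hD).2 hc
    have hv : ∀ j, ‖D • (s j : ℝ) • f j‖ ≤ D := by
      intro j
      rw [norm_smul, norm_smul, Real.norm_of_nonneg hD.le, Real.norm_eq_abs]
      exact mul_le_of_le_one_right hD.le
        (mul_le_one₀ (hs1' j) (norm_nonneg _) (hf j))
    have hg : ∑ j, (|c j| / D) • (D • (s j : ℝ) • f j) =
        ∑ j, c j • f j := by
      refine sum_congr rfl fun j _ ↦ ?_
      rw [smul_smul, smul_smul, div_mul_cancel₀ _ hD.ne']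
      rw [hs]
    rcases norm_sub_sq_le_or_exists_norm_add_sub_sq_le (fun j ↦ div_nonneg (abs_nonneg (c j)) hD.le)
      hw hv hg (D • (∑ j, (k j : ℝ) • f j) - (n : ℝ) • ∑ j, c j • f j) with h | ⟨i, h⟩
    · refine ⟨k, by push_cast; lia, ?_⟩
      push_cast
      rw [add_smul, one_smul, ← sub_sub]
      linarith
    · refine ⟨k + Pi.single i (s i), ?_, ?_⟩
      · have hsingle : ∑ j, |(Pi.single i (s i) : ι → ℤ) j| = |s i| := by
          rw [sum_eq_single i (fun j _ hj ↦ by simp [hj]) (by simp), Pi.single_eq_same]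
        have hadd : ∑ j, |k j + (Pi.single i (s i) : ι → ℤ) j| ≤
            ∑ j, |k j| + ∑ j, |(Pi.single i (s i) : ι → ℤ) j| := by
          rw [← sum_add_distrib]
          exact sum_le_sum fun j _ ↦ abs_add_le _ _
        have := hs1 i
        simp only [Pi.add_apply]
        push_cast
        linarith
      · have hsum : ∑ j, (((k + Pi.single i (s i) : ι → ℤ) j : ℤ) : ℝ) • f j =
            ∑ j, (k j : ℝ) • f j + (s i : ℝ) • f i := by
          simp only [Pi.add_apply, Int.cast_add, add_smul, sum_add_distrib]
          congr 1
          rw [sum_eq_single i (fun j _ hj ↦ by simp [hj]) (by simp)]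
          simp
        rw [hsum]
        push_cast at h ⊢
        have heq : ∀ a b g : E, D • (a + b) - ((n : ℝ) + 1) • g = D • a - (n : ℝ) • g + D • b - g :=
          fun a b g ↦ by module
        rw [heq]
        linarith

/-- **Maurey-type discretization with integer coefficients.**
If `g = ∑ c_j f_j` with `∑ |c_j| ≤ D`, then for every positive integer `m` there are
integers `k_1, ..., k_M` with `∑ |k_j| ≤ m` such that
`‖(D/m) ∑ k_j f_j − g‖_{L²(ν)} ≤ D/√m`; in particular the approximant has at most `m`
nonzero coefficients. -/
theorem stmt_3
    {α : Type*} [MeasurableSpace α] (ν : Measure α) [SigmaFinite ν]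
    (M : ℕ) (hM : 1 ≤ M) (f : Fin M → Lp ℝ 2 ν) (hf : ∀ j, ‖f j‖ ≤ 1)
    (D : ℝ) (hD : 0 < D) (c : Fin M → ℝ) (hc : (∑ j, |c j|) ≤ D)
    (m : ℕ) (hm : 1 ≤ m) :
    ∃ k : Fin M → ℤ,
      (∑ j, |k j|) ≤ (m : ℤ) ∧
      ‖(D / m) • (∑ j, (k j : ℝ) • f j) - (∑ j, c j • f j)‖ ≤ D / Real.sqrt m ∧
      (Finset.univ.filter (fun j => k j ≠ 0)).card ≤ m := by
  obtain ⟨k, hk, hnorm⟩ := exists_int_norm_smul_sum_sub_sq_le hf hD hc m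
  have hm0 : (0 : ℝ) < m := by exact_mod_cast hm
  refine ⟨k, hk, ?_, ?_⟩
  · have heq : (D / m) • (∑ j, (k j : ℝ) • f j) - (∑ j, c j • f j) =
        (m : ℝ)⁻¹ • (D • (∑ j, (k j : ℝ) • f j) - (m : ℝ) • ∑ j, c j • f j) := by
      rw [smul_sub, smul_smul, smul_smul, inv_mul_cancel₀ hm0.ne', one_smul, div_eq_inv_mul]
    rw [heq]
    refine (sq_le_sq₀ (norm_nonneg _) (by positivity)).1 ?_
    rw [norm_smul, mul_pow, Real.norm_of_nonneg (by positivity), div_pow, Real.sq_sqrt hm0.le]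
    calc ((m : ℝ)⁻¹) ^ 2 * ‖D • (∑ j, (k j : ℝ) • f j) - (m : ℝ) • ∑ j, c j • f j‖ ^ 2
        ≤ ((m : ℝ)⁻¹) ^ 2 * (m * D ^ 2) := by gcongr
      _ = D ^ 2 / m := by field_simp
  · have hcard : ((univ.filter (fun j ↦ k j ≠ 0)).card : ℤ) ≤ ∑ j, |k j| := by
      rw [card_filter]
      push_cast
      refine sum_le_sum fun j _ ↦ ?_
      split_ifs with h
      · exact Int.one_le_abs h
      · exact abs_nonneg _
    exact_mod_cast hcard.trans hk
end

section
/- Let 0 < q ≤ 1 and let c ∈ ℝ^M satisfy ∑_{j=1}^M |c_j|^q ≤ 1. For any 0 < ε < 1, set L = {j : |c_j| > ε^{2/(2−q)}}. Then |L| ≤ ε^{−2q/(2−q)} and ∑_{j ∉ L} |c_j| ≤ ε^{(2−2q)/(2−q)}. -/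
open Finset

/-- **Splitting an ℓ_q-ball vector into large and small coefficients (unit radius).**
If `0 < q ≤ 1` and `∑ |c_j|^q ≤ 1`, then for `0 < ε < 1` the set
`L = {j : |c_j| > ε^{2/(2-q)}}` satisfies `|L| ≤ ε^{-2q/(2-q)}` and
`∑_{j ∉ L} |c_j| ≤ ε^{(2-2q)/(2-q)}`. -/
theorem stmt_5 (M : ℕ) (q : ℝ) (hq0 : 0 < q) (hq1 : q ≤ 1)
    (c : Fin M → ℝ) (hc : (∑ j, |c j| ^ q) ≤ 1)
    (ε : ℝ) (hε0 : 0 < ε) (hε1 : ε < 1) :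
    ((Finset.univ.filter (fun j => ε ^ ((2 : ℝ) / (2 - q)) < |c j|)).card : ℝ)
        ≤ ε ^ (-(2 * q) / (2 - q)) ∧
    (∑ j ∈ Finset.univ.filter (fun j => ¬ ε ^ ((2 : ℝ) / (2 - q)) < |c j|), |c j|)
        ≤ ε ^ ((2 - 2 * q) / (2 - q)) := by
  set t : ℝ := ε ^ ((2 : ℝ) / (2 - q)) with ht
  have ht0 : 0 < t := Real.rpow_pos_of_pos hε0 _
  have hnonneg : ∀ j, 0 ≤ |c j| ^ q := fun j => Real.rpow_nonneg (abs_nonneg _) _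
  have hsub : ∀ s : Finset (Fin M), ∑ j ∈ s, |c j| ^ q ≤ 1 := fun s =>
    (Finset.sum_le_univ_sum_of_nonneg hnonneg).trans hc
  constructor
  · have hpow : ε ^ (-(2 * q) / (2 - q)) = (t ^ q)⁻¹ := by
      rw [ht, ← Real.rpow_mul hε0.le, ← Real.rpow_neg hε0.le]
      congr 1
      ring
    rw [hpow, ← one_div, le_div_iff₀ (Real.rpow_pos_of_pos ht0 q), ← nsmul_eq_mul]
    refine (Finset.card_nsmul_le_sum _ (fun j => |c j| ^ q) _ fun j hj => ?_).trans (hsub _)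
    exact Real.rpow_le_rpow ht0.le (Finset.mem_filter.mp hj).2.le hq0.le
  · have hpow : ε ^ ((2 - 2 * q) / (2 - q)) = t ^ (1 - q) := by
      rw [ht, ← Real.rpow_mul hε0.le]
      congr 1
      ring
    rw [hpow]
    calc _ ≤ ∑ j ∈ Finset.univ.filter (fun j => ¬ t < |c j|), |c j| ^ q * t ^ (1 - q) := by
          refine Finset.sum_le_sum fun j hj => ?_
          have hle : |c j| ≤ t := not_lt.mp (Finset.mem_filter.mp hj).2
          calc |c j| = |c j| ^ q * |c j| ^ (1 - q) := by
                rw [← Real.rpow_add' (abs_nonneg _) (by simp), add_sub_cancel, Real.rpow_one]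
            _ ≤ |c j| ^ q * t ^ (1 - q) := by
                have := hnonneg j
                have : 0 ≤ 1 - q := by linarith
                gcongr
      _ ≤ t ^ (1 - q) := by
          rw [← Finset.sum_mul]
          exact mul_le_of_le_one_left (Real.rpow_nonneg ht0.le _) (hsub _)
end

section
/- Let h ∈ L²(ν), D > 0, and g = ∑_{j=1}^M c_j f_j with ∑_{j=1}^M |c_j| ≤ D. Then for every positive integer m there exists θ′ ∈ ℝ^M with ‖θ′‖₀ ≤ m and ‖θ′‖₁ ≤ D such that ‖h − f_{θ′}‖²_{L²(ν)} ≤ ‖h − g‖²_{L²(ν)} + D²/m. -/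
open MeasureTheory Finset

section Sparsification

variable {ι E : Type*} [Fintype ι] [DecidableEq ι] [NormedAddCommGroup E] [InnerProductSpace ℝ E]

/-- One step of the greedy sparsification: some vector among `0` and `±D f_j` is, relative to
`x`, at least as good as `g = ∑ c_j f_j` up to an error `D ^ 2` in squared norm. -/
lemma exists_single_norm_sub_sq_le {f : ι → E} (hf : ∀ j, ‖f j‖ ≤ 1) {D : ℝ} (hD : 0 < D)
    {c : ι → ℝ} (hc : ∑ j, |c j| ≤ D) (x : E) :
    ∃ θ : ι → ℝ, #{j | θ j ≠ 0} ≤ 1 ∧ ∑ j, |θ j| ≤ D ∧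
      ‖x - ∑ j, θ j • f j‖ ^ 2 ≤ ‖x - ∑ j, c j • f j‖ ^ 2 + D ^ 2 := by
  by_contra! H
  have hx := H 0 (by simp) (by simpa using hD.le)
  set g := ∑ j, c j • f j with hg
  have hsingle (j : ι) (d : ℝ) (hd : |d| = D) :
      ‖x - g‖ ^ 2 + D ^ 2 < ‖x - d • f j‖ ^ 2 := by
    have hcard : #{k | (Pi.single j d : ι → ℝ) k ≠ 0} ≤ 1 := by
      refine Finset.card_le_one.2 fun a ha b hb => ?_
      simp only [Finset.mem_filter, Finset.mem_univ, true_and, Pi.single_apply, ne_eq,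
        ite_eq_right_iff, Classical.not_imp] at ha hb
      rw [ha.1, hb.1]
    have hsum : ∑ k, |(Pi.single j d : ι → ℝ) k| ≤ D := by
      simp [Pi.single_apply, apply_ite abs, hd]
    simpa [Pi.single_apply, ite_smul] using H (Pi.single j d) hcard hsum
  simp only [Pi.zero_apply, zero_smul, Finset.sum_const_zero, sub_zero] at hx
  rw [norm_sub_sq_real] at hx
  have hinner (j : ι) : |inner ℝ x (f j)| * D ≤ inner ℝ x g - ‖g‖ ^ 2 / 2 := by
    have hpos := hsingle j D (abs_of_pos hD)
    have hneg := hsingle j (-D) (by rw [abs_neg, abs_of_pos hD])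
    simp only [norm_sub_sq_real, inner_smul_right, norm_smul, Real.norm_eq_abs, abs_neg,
      abs_of_pos hD, mul_pow] at hpos hneg
    have hfj : ‖f j‖ ^ 2 ≤ 1 := pow_le_one₀ (norm_nonneg _) (hf j)
    have hDf : D ^ 2 * ‖f j‖ ^ 2 ≤ D ^ 2 := mul_le_of_le_one_right (sq_nonneg D) hfj
    rcases abs_cases (inner ℝ x (f j)) with ⟨h, -⟩ | ⟨h, -⟩ <;> rw [h] <;> linarith
  have hB : 0 < inner ℝ x g - ‖g‖ ^ 2 / 2 := by nlinarith
  have hle : inner ℝ x g * D ≤ D * (inner ℝ x g - ‖g‖ ^ 2 / 2) := by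
    calc inner ℝ x g * D = ∑ j, c j * inner ℝ x (f j) * D := by
          rw [hg, inner_sum, Finset.sum_mul]
          simp only [inner_smul_right]
      _ ≤ ∑ j, |c j| * (inner ℝ x g - ‖g‖ ^ 2 / 2) := by
          refine Finset.sum_le_sum fun j _ => ?_
          calc c j * inner ℝ x (f j) * D ≤ |c j| * |inner ℝ x (f j)| * D := by
                rw [← abs_mul]
                exact mul_le_mul_of_nonneg_right (le_abs_self _) hD.le
            _ ≤ |c j| * (inner ℝ x g - ‖g‖ ^ 2 / 2) := by
                rw [mul_assoc]
                exact mul_le_mul_of_nonneg_left (hinner j) (abs_nonneg _)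
      _ ≤ D * (inner ℝ x g - ‖g‖ ^ 2 / 2) := by
          rw [← Finset.sum_mul]
          exact mul_le_mul_of_nonneg_right hc hB.le
  have hg0 : g = 0 := by
    have : ‖g‖ ^ 2 ≤ 0 := by nlinarith
    simpa using le_antisymm this (sq_nonneg _)
  simp [hg0] at hB

/-- Iterating the greedy step `k` times approximates `a` almost as well as `k • ∑ c_j f_j`. -/
lemma exists_sparse_norm_sub_sq_le {f : ι → E} (hf : ∀ j, ‖f j‖ ≤ 1) {D : ℝ} (hD : 0 < D)
    {c : ι → ℝ} (hc : ∑ j, |c j| ≤ D) (k : ℕ) (a : E) :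
    ∃ θ : ι → ℝ, #{j | θ j ≠ 0} ≤ k ∧ ∑ j, |θ j| ≤ k * D ∧
      ‖a - ∑ j, θ j • f j‖ ^ 2 ≤ ‖a - (k : ℝ) • ∑ j, c j • f j‖ ^ 2 + k * D ^ 2 := by
  induction k generalizing a with
  | zero => exact ⟨0, by simp⟩
  | succ k ih =>
    set g := ∑ j, c j • f j with hg
    obtain ⟨θ₁, hcard₁, hsum₁, hnorm₁⟩ :=
      exists_single_norm_sub_sq_le hf hD hc (a - (k : ℝ) • g)
    obtain ⟨θ₂, hcard₂, hsum₂, hnorm₂⟩ := ih (a - ∑ j, θ₁ j • f j)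
    refine ⟨θ₁ + θ₂, ?_, ?_, ?_⟩
    · have hsub : ({j | (θ₁ + θ₂) j ≠ 0} : Finset ι) ⊆
          ({j | θ₁ j ≠ 0} : Finset ι) ∪ ({j | θ₂ j ≠ 0} : Finset ι) := by
        intro j
        simp only [Finset.mem_filter, Finset.mem_univ, true_and, Finset.mem_union, Pi.add_apply]
        contrapose!
        rintro ⟨h₁, h₂⟩
        rw [h₁, h₂, add_zero]
      have := (Finset.card_le_card hsub).trans (Finset.card_union_le _ _)
      omega
    · calc ∑ j, |(θ₁ + θ₂) j| ≤ ∑ j, (|θ₁ j| + |θ₂ j|) :=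
            Finset.sum_le_sum fun j _ => abs_add_le _ _
        _ ≤ (k + 1 : ℕ) * D := by
            rw [Finset.sum_add_distrib]
            push_cast
            linarith
    · have e₁ : a - ∑ j, (θ₁ + θ₂) j • f j = a - ∑ j, θ₁ j • f j - ∑ j, θ₂ j • f j := by
        simp only [Pi.add_apply, add_smul, Finset.sum_add_distrib]
        abel
      have e₂ : a - ((k + 1 : ℕ) : ℝ) • g = a - (k : ℝ) • g - g := by
        push_cast
        rw [add_smul, one_smul]
        abel
      rw [← hg, sub_right_comm a ((k : ℝ) • g) (∑ j, θ₁ j • f j)] at hnorm₁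
      rw [e₁, e₂]
      push_cast
      linarith

end Sparsification

/-- **Maurey-type sparsification relative to a target.**
If `g = ∑ c_j f_j` with `∑ |c_j| ≤ D`, then for every positive integer `m` there exists
`θ'` with at most `m` nonzero entries and `‖θ'‖₁ ≤ D` such that
`‖h − f_{θ'}‖² ≤ ‖h − g‖² + D²/m`. -/
theorem stmt_7
    {α : Type*} [MeasurableSpace α] (ν : Measure α) [SigmaFinite ν]
    (M : ℕ) (hM : 1 ≤ M) (f : Fin M → Lp ℝ 2 ν) (hf : ∀ j, ‖f j‖ ≤ 1)
    (h : Lp ℝ 2 ν) (D : ℝ) (hD : 0 < D)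
    (c : Fin M → ℝ) (hc : (∑ j, |c j|) ≤ D)
    (m : ℕ) (hm : 1 ≤ m) :
    ∃ θ' : Fin M → ℝ,
      (Finset.univ.filter (fun j => θ' j ≠ 0)).card ≤ m ∧
      (∑ j, |θ' j|) ≤ D ∧
      ‖h - (∑ j, θ' j • f j)‖ ^ 2 ≤ ‖h - (∑ j, c j • f j)‖ ^ 2 + D ^ 2 / m := by
  have hm0 : (0 : ℝ) < m := by exact_mod_cast hm
  obtain ⟨θ, hcard, hsum, hnorm⟩ := exists_sparse_norm_sub_sq_le hf hD hc m ((m : ℝ) • h)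
  refine ⟨fun j => (m : ℝ)⁻¹ * θ j, ?_, ?_, ?_⟩
  · simpa [hm0.ne'] using hcard
  · simp only [abs_mul, abs_inv, Nat.abs_cast, ← Finset.mul_sum]
    rwa [inv_mul_le_iff₀ hm0]
  · have e : (m : ℝ) • h - ∑ j, θ j • f j =
        (m : ℝ) • (h - ∑ j, ((m : ℝ)⁻¹ * θ j) • f j) := by
      simp only [smul_sub, mul_smul, ← Finset.smul_sum]
      rw [smul_inv_smul₀ hm0.ne']
    rw [e, ← smul_sub, norm_smul, norm_smul, mul_pow, mul_pow, Real.norm_of_nonneg hm0.le] at hnorm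
    refine le_of_mul_le_mul_left (hnorm.trans_eq ?_) (pow_pos hm0 2)
    field_simp
end

section
/- For integers k and M with 1 ≤ k ≤ M/2, there exists a subset A of {I ∈ {−1, 0, 1}^M : I has at most k nonzero coordinates} with cardinality at least exp((k/2) · log(2(M − k)/k)) such that any two distinct elements of A differ in more than k/2 coordinates (i.e., their Hamming distance exceeds k/2). -/
open Finset

/-! ### Binomial coefficient estimates -/

theorem choose_succ_add_mul_choose_le (n c m : ℕ) :
    n.choose (m + 1) + c * n.choose m ≤ (n + c).choose (m + 1) := by
  induction c with
  | zero => simp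
  | succ c ih =>
    have h : n.choose m ≤ (n + c).choose m := Nat.choose_le_choose m (Nat.le_add_right n c)
    rw [← add_assoc, Nat.choose_succ_succ' (n + c) m]
    linarith

/-- An elementary symmetric function of natural numbers is at most the binomial coefficient of
their sum. -/
theorem sum_powersetCard_prod_le_choose {α : Type*} [DecidableEq α] (c : α → ℕ) (T : Finset α)
    (m : ℕ) : ∑ S ∈ T.powersetCard m, ∏ j ∈ S, c j ≤ (∑ j ∈ T, c j).choose m := by
  induction T using Finset.induction_on generalizing m with
  | empty => cases m <;> simp
  | insert x T hx ih =>
    cases m with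
    | zero => simp
    | succ m =>
      have hinj : Set.InjOn (insert x) (T.powersetCard m : Set (Finset α)) := by
        intro S hS S' hS' h
        have hxS : x ∉ S := fun h => hx ((mem_powersetCard.1 hS).1 h)
        have hxS' : x ∉ S' := fun h => hx ((mem_powersetCard.1 hS').1 h)
        rw [← erase_insert hxS, ← erase_insert hxS', h]
      have hdisj : Disjoint (T.powersetCard (m + 1)) ((T.powersetCard m).image (insert x)) := by
        rw [disjoint_left]
        intro S hS hS'
        obtain ⟨S', -, rfl⟩ := mem_image.1 hS'
        exact hx ((mem_powersetCard.1 hS).1 (mem_insert_self x S'))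
      have hprod : ∑ S ∈ T.powersetCard m, ∏ j ∈ insert x S, c j
          = c x * ∑ S ∈ T.powersetCard m, ∏ j ∈ S, c j := by
        rw [mul_sum]
        refine sum_congr rfl fun S hS => prod_insert fun h => hx ((mem_powersetCard.1 hS).1 h)
      rw [powersetCard_succ_insert hx, sum_union hdisj, sum_image hinj, hprod, sum_insert hx,
        add_comm (c x)]
      exact (add_le_add (ih (m + 1)) (Nat.mul_le_mul_left _ (ih m))).trans
        (choose_succ_add_mul_choose_le _ _ _)

/-- Two products over `range m` are compared by comparing the products of opposite pairs of
factors. -/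
theorem prod_range_le_prod_range_of_reflect (f g : ℕ → ℕ) (m : ℕ)
    (h : ∀ u d, 2 * u + d + 1 = m → g u * g (u + d) ≤ f u * f (u + d)) :
    ∏ i ∈ range m, g i ≤ ∏ i ∈ range m, f i := by
  have hsq (a : ℕ → ℕ) :
      (∏ i ∈ range m, a i) ^ 2 = ∏ i ∈ range m, a i * a (m - 1 - i) := by
    rw [prod_mul_distrib, prod_range_reflect, sq]
  refine (Nat.pow_le_pow_iff_left two_ne_zero).1 ?_
  rw [hsq, hsq]
  refine prod_le_prod' fun i hi => ?_
  have hi := mem_range.1 hi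
  rcases le_total i (m - 1 - i) with hle | hle
  · obtain ⟨d, hd⟩ := Nat.exists_eq_add_of_le hle
    rw [hd]
    exact h i d (by omega)
  · obtain ⟨d, hd⟩ := Nat.exists_eq_add_of_le hle
    have := h (m - 1 - i) d (by omega)
    rw [← hd] at this
    linarith

theorem pair_le_even (u d N : ℕ) (hpos : 0 < u + d) (hN : 2 * (2 * u + d + 1) ≤ N) :
    (N * (N + 3 * (2 * u + d + 1) + 1 + u) * (2 * u + d + 1 + 1 + u)) *
      (N * (N + 3 * (2 * u + d + 1) + 1 + (u + d)) * (2 * u + d + 1 + 1 + (u + d))) ≤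
    (2 * (2 * u + d + 1) * (N + 1 + u) * (N + (2 * u + d + 1) + 1 + u)) *
      (2 * (2 * u + d + 1) * (N + 1 + (u + d)) * (N + (2 * u + d + 1) + 1 + (u + d))) := by
  obtain ⟨h, rfl⟩ := Nat.exists_eq_add_of_le hN
  zify
  rw [← sub_nonneg]
  rcases u with _ | u
  · obtain ⟨d, rfl⟩ : ∃ e, d = e + 1 := ⟨d - 1, by omega⟩
    rcases h with _ | h <;>
    · push_cast
      ring_nf
      positivity
  · push_cast
    ring_nf
    positivity

theorem pair_le_odd (u d N : ℕ) (hN : 2 * (2 * u + d + 1) + 1 ≤ N) :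
    (N * (N + 3 * (2 * u + d + 1) + 3 + u) * (2 * u + d + 1 + 1 + u)) *
      (N * (N + 3 * (2 * u + d + 1) + 3 + (u + d)) * (2 * u + d + 1 + 1 + (u + d))) ≤
    ((2 * (2 * u + d + 1) + 1) * (N + 1 + u) * (N + (2 * u + d + 1) + 2 + u)) *
      ((2 * (2 * u + d + 1) + 1) * (N + 1 + (u + d)) *
        (N + (2 * u + d + 1) + 2 + (u + d))) := by
  obtain ⟨h, rfl⟩ := Nat.exists_eq_add_of_le hN
  zify
  rw [← sub_nonneg]
  ring_nf
  positivity

theorem choose_mul_pow_le_of_prod_le (N k m r : ℕ) (hk : k = m + r)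
    (h : (∏ i ∈ range m, (N + 2 * k - m + 1 + i)) * (∏ i ∈ range r, (m + 1 + i)) * N ^ r ≤
      (∏ i ∈ range k, (N + 1 + i)) * k ^ r) :
    (N + 2 * k).choose m * N ^ r ≤ (N + k).choose k * k ^ r := by
  have h1 : ∏ i ∈ range k, (N + 1 + i) = k.factorial * (N + k).choose k := by
    rw [← Nat.ascFactorial_eq_prod_range, Nat.ascFactorial_eq_factorial_mul_choose]
  have h2 : ∏ i ∈ range m, (N + 2 * k - m + 1 + i) = m.factorial * (N + 2 * k).choose m := by
    rw [← Nat.ascFactorial_eq_prod_range, Nat.ascFactorial_eq_factorial_mul_choose]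
    congr 2
    omega
  have h3 : m.factorial * ∏ i ∈ range r, (m + 1 + i) = k.factorial := by
    rw [← Nat.ascFactorial_eq_prod_range, Nat.factorial_mul_ascFactorial, hk]
  rw [h1, h2] at h
  refine Nat.le_of_mul_le_mul_left ?_ (Nat.factorial_pos k)
  calc k.factorial * ((N + 2 * k).choose m * N ^ r)
      = m.factorial * (N + 2 * k).choose m * (∏ i ∈ range r, (m + 1 + i)) * N ^ r := by
        rw [← h3]; ring
    _ ≤ _ := h
    _ = _ := by ring

theorem choose_mul_pow_le_even (N m : ℕ) (hm : m ≠ 1) (hN : 2 * m ≤ N) :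
    (N + 2 * (2 * m)).choose m * N ^ m ≤ (N + 2 * m).choose (2 * m) * (2 * m) ^ m := by
  refine choose_mul_pow_le_of_prod_le N (2 * m) m m (by ring) ?_
  have key := prod_range_le_prod_range_of_reflect
    (fun i => 2 * m * (N + 1 + i) * (N + m + 1 + i))
    (fun i => N * (N + 3 * m + 1 + i) * (m + 1 + i)) m (by
      rintro u d rfl
      exact pair_le_even u d N (by omega) hN)
  simp only [prod_mul_distrib, prod_const, card_range, ← mul_pow] at key
  have e1 : ∏ i ∈ range (2 * m), (N + 1 + i)
      = (∏ i ∈ range m, (N + 1 + i)) * ∏ i ∈ range m, (N + m + 1 + i) := by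
    rw [two_mul, prod_range_add]
    congr 1
    exact prod_congr rfl fun i _ => by ring
  have e2 : N + 2 * (2 * m) - m = N + 3 * m := by omega
  rw [e1, e2]
  linarith

theorem choose_mul_pow_le_odd (N m : ℕ) (hN : 2 * m + 1 ≤ N) :
    (N + 2 * (2 * m + 1)).choose m * N ^ (m + 1) ≤
      (N + (2 * m + 1)).choose (2 * m + 1) * (2 * m + 1) ^ (m + 1) := by
  refine choose_mul_pow_le_of_prod_le N (2 * m + 1) m (m + 1) (by ring) ?_
  have key := prod_range_le_prod_range_of_reflect
    (fun i => (2 * m + 1) * (N + 1 + i) * (N + m + 2 + i))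
    (fun i => N * (N + 3 * m + 3 + i) * (m + 1 + i)) m (by
      rintro u d rfl
      exact pair_le_odd u d N hN)
  simp only [prod_mul_distrib, prod_const, card_range] at key
  have e1 : ∏ i ∈ range (2 * m + 1), (N + 1 + i)
      = (∏ i ∈ range m, (N + 1 + i)) * (N + 1 + m) * ∏ i ∈ range m, (N + m + 2 + i) := by
    rw [show 2 * m + 1 = (m + 1) + m by ring, prod_range_add, prod_range_succ]
    congr 1
    exact prod_congr rfl fun i _ => by ring
  have e2 : N + 2 * (2 * m + 1) - m + 1 = N + 3 * m + 3 := by omega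
  rw [e1, e2, prod_range_succ, pow_succ, pow_succ]
  have hlast : N * (m + 1 + m) ≤ (N + 1 + m) * (2 * m + 1) :=
    Nat.mul_le_mul (by omega) (by omega)
  calc _ = (N ^ m * (∏ i ∈ range m, (N + 3 * m + 3 + i)) * ∏ i ∈ range m, (m + 1 + i)) *
          (N * (m + 1 + m)) := by ring
    _ ≤ _ := Nat.mul_le_mul key hlast
    _ = _ := by ring

theorem choose_mul_pow_le (N k : ℕ) (hk2 : k ≠ 2) (hN : k ≤ N) :
    (N + 2 * k).choose (k / 2) * N ^ (k - k / 2) ≤ (N + k).choose k * k ^ (k - k / 2) := by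
  rcases Nat.even_or_odd' k with ⟨m, rfl | rfl⟩
  · rw [show 2 * m / 2 = m by omega, show 2 * m - m = m by omega]
    exact choose_mul_pow_le_even N m (by omega) hN
  · rw [show (2 * m + 1) / 2 = m by omega, show 2 * m + 1 - m = m + 1 by omega]
    exact choose_mul_pow_le_odd N m hN

/-! ### Sparse sign vectors -/

/-- The sign vectors in `{-1, 0, 1}^M` with exactly `k` nonzero coordinates. -/
def sparseSigns (M k : ℕ) : Finset (Fin M → ℤ) :=
  (Fintype.piFinset fun _ => {-1, 0, 1}).filter fun I => #{j | I j ≠ 0} = k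

theorem mem_sparseSigns {M k : ℕ} {I : Fin M → ℤ} :
    I ∈ sparseSigns M k ↔ (∀ j, I j = -1 ∨ I j = 0 ∨ I j = 1) ∧ #{j | I j ≠ 0} = k := by
  simp [sparseSigns]

theorem card_sparseSigns (M k : ℕ) : #(sparseSigns M k) = M.choose k * 2 ^ k := by
  have hmaps : ∀ I ∈ sparseSigns M k,
      ({j | I j ≠ 0} : Finset (Fin M)) ∈ (univ : Finset (Fin M)).powersetCard k := fun I hI =>
    mem_powersetCard.2 ⟨subset_univ _, (mem_sparseSigns.1 hI).2⟩
  rw [card_eq_sum_card_fiberwise hmaps]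
  have hfiber : ∀ S ∈ (univ : Finset (Fin M)).powersetCard k,
      #{I ∈ sparseSigns M k | ({j | I j ≠ 0} : Finset (Fin M)) = S} = 2 ^ k := by
    intro S hS
    have hSk := (mem_powersetCard.1 hS).2
    have : {I ∈ sparseSigns M k | ({j | I j ≠ 0} : Finset (Fin M)) = S}
        = Fintype.piFinset fun j => if j ∈ S then ({-1, 1} : Finset ℤ) else {0} := by
      ext I
      rw [mem_filter, mem_sparseSigns, Fintype.mem_piFinset]
      constructor
      · rintro ⟨⟨hI, -⟩, rfl⟩ j
        rcases hI j with h | h | h <;> simp [h]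
      · intro h
        have hsupp : ({j | I j ≠ 0} : Finset (Fin M)) = S := by
          ext j
          have := h j
          by_cases hj : j ∈ S
          · simp only [hj, if_true, mem_insert, mem_singleton] at this
            rcases this with h | h <;> simp [h, hj]
          · simpa [hj] using this
        refine ⟨⟨fun j => ?_, hsupp ▸ hSk⟩, hsupp⟩
        have := h j
        by_cases hj : j ∈ S
        · simp only [hj, if_true, mem_insert, mem_singleton] at this
          tauto
        · simp only [hj, if_false, mem_singleton] at this
          tauto
    rw [this, Fintype.card_piFinset]
    simp only [apply_ite card, card_singleton]
    rw [prod_ite_mem, univ_inter]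
    simp [hSk]
  rw [sum_congr rfl hfiber]
  simp

/-- A Hamming ball in the set of `k`-sparse sign vectors is bounded by a sum over the sets of
coordinates outside which its members agree with the centre; weighting a vector by
`(1 / 2) ^ ‖·‖₀` makes the inner sums into products. -/
theorem card_ball_sparseSigns_le {M k m : ℕ} (hm : m ≤ M) {I : Fin M → ℤ}
    (hI : I ∈ sparseSigns M k) :
    #{J ∈ sparseSigns M k | #{j | I j ≠ J j} ≤ m} ≤ 2 ^ m * (M + k).choose m := by
  obtain ⟨hI, hIk⟩ := mem_sparseSigns.1 hI
  let w : ℤ → ℚ := fun v => if v = 0 then 1 else 1 / 2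
  let c : Fin M → ℕ := fun j => if I j = 0 then 1 else 2
  have hw0 (v) : 0 ≤ w v := by dsimp only [w]; split_ifs <;> norm_num
  have hw {J : Fin M → ℤ} (hJ : #{j | J j ≠ 0} = k) : ∏ j, w (J j) = (1 / 2) ^ k := by
    have : ∏ j, w (J j) = ∏ j, if J j ≠ 0 then (1 / 2 : ℚ) else 1 :=
      prod_congr rfl fun j _ => by by_cases h : J j = 0 <;> simp [w, h]
    rw [this, ← prod_filter, prod_const, hJ]
  let F : Finset (Fin M) → Finset (Fin M → ℤ) := fun S =>
    Fintype.piFinset fun j => if j ∈ S then {-1, 0, 1} else {I j}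
  have hF (S : Finset (Fin M)) (hS : #S = m) :
      ∑ J ∈ F S, ∏ j, w (J j) = 2 ^ m * (1 / 2) ^ k * ∏ j ∈ S, (c j : ℚ) := by
    have hcoord (j) : ∑ v ∈ (if j ∈ S then ({-1, 0, 1} : Finset ℤ) else {I j}), w v
        = (if j ∈ S then 2 else 1) * w (I j) * (if j ∈ S then (c j : ℚ) else 1) := by
      by_cases hj : j ∈ S
      · by_cases h : I j = 0 <;> simp [hj, h, w, c] <;> norm_num
      · simp [hj]
    rw [← prod_univ_sum, prod_congr rfl fun j _ => hcoord j, prod_mul_distrib,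
      prod_mul_distrib, hw hIk, prod_ite_mem, prod_ite_mem, univ_inter, prod_const, hS]
  have hsub : {J ∈ sparseSigns M k | #{j | I j ≠ J j} ≤ m} ⊆
      (univ.powersetCard m).biUnion fun S => {J ∈ F S | #{j | J j ≠ 0} = k} := by
    intro J hJ
    obtain ⟨hJ, hd⟩ := mem_filter.1 hJ
    obtain ⟨hJ, hJk⟩ := mem_sparseSigns.1 hJ
    obtain ⟨S, hdS, hS⟩ := exists_superset_card_eq hd (by simpa using hm)
    refine mem_biUnion.2 ⟨S, mem_powersetCard.2 ⟨subset_univ _, hS⟩, mem_filter.2 ⟨?_, hJk⟩⟩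
    refine Fintype.mem_piFinset.2 fun j => ?_
    by_cases hj : j ∈ S
    · simpa [hj] using hJ j
    · have : I j = J j := by
        by_contra h
        exact hj (hdS (by simpa using h))
      simp [hj, this]
  have hcard (S : Finset (Fin M)) (hS : #S = m) :
      (#{J ∈ F S | #{j | J j ≠ 0} = k} : ℚ) ≤ 2 ^ m * ∏ j ∈ S, (c j : ℚ) := by
    have h1 : ∑ J ∈ F S with #{j | J j ≠ 0} = k, ∏ j, w (J j) ≤ ∑ J ∈ F S, ∏ j, w (J j) :=
      sum_le_sum_of_subset_of_nonneg (filter_subset _ _) fun J _ _ =>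
        prod_nonneg fun j _ => hw0 _
    rw [hF S hS, sum_congr rfl fun J hJ => hw (mem_filter.1 hJ).2, sum_const, nsmul_eq_mul] at h1
    refine le_of_mul_le_mul_right ?_ (show (0 : ℚ) < (1 / 2) ^ k by positivity)
    linarith
  have hsum : ∑ j, c j = M + k := by
    have : ∀ j, c j = 1 + if I j ≠ 0 then 1 else 0 := fun j => by
      by_cases h : I j = 0 <;> simp [c, h]
    simp only [this, sum_add_distrib, sum_boole, hIk]
    simp
  have hnat : ∀ S ∈ (univ : Finset (Fin M)).powersetCard m,
      #{J ∈ F S | #{j | J j ≠ 0} = k} ≤ 2 ^ m * ∏ j ∈ S, c j := fun S hS => by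
    exact_mod_cast hcard S (mem_powersetCard.1 hS).2
  calc _ ≤ _ := card_le_card hsub
    _ ≤ _ := card_biUnion_le
    _ ≤ ∑ S ∈ (univ : Finset (Fin M)).powersetCard m, 2 ^ m * ∏ j ∈ S, c j := sum_le_sum hnat
    _ = 2 ^ m * ∑ S ∈ (univ : Finset (Fin M)).powersetCard m, ∏ j ∈ S, c j := by rw [mul_sum]
    _ ≤ _ := Nat.mul_le_mul_left _ (hsum ▸ sum_powersetCard_prod_le_choose c univ m)

/-! ### Packing -/

/-- The Gilbert–Varshamov argument: a maximal family of pairwise unrelated elements is covering. -/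
theorem exists_pairwise_not_and_card_le {α : Type*} [DecidableEq α] (Ω : Finset α)
    (r : α → α → Prop) [DecidableRel r] (hrefl : ∀ a, r a a) (hsymm : ∀ a b, r a b → r b a)
    (B : ℕ) (hB : ∀ a ∈ Ω, #{b ∈ Ω | r a b} ≤ B) :
    ∃ A ⊆ Ω, (∀ a ∈ A, ∀ b ∈ A, a ≠ b → ¬ r a b) ∧ #Ω ≤ #A * B := by
  let P := Ω.powerset.filter fun A => ∀ a ∈ A, ∀ b ∈ A, a ≠ b → ¬ r a b
  obtain ⟨A, hAP, hmax⟩ := P.exists_max_image card ⟨∅, by simp [P]⟩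
  obtain ⟨hAΩ, hA⟩ := mem_filter.1 hAP
  have hAΩ := mem_powerset.1 hAΩ
  refine ⟨A, hAΩ, hA, ?_⟩
  have hcover : Ω ⊆ A.biUnion fun a => {b ∈ Ω | r a b} := by
    intro b hb
    by_contra hnot
    have hno : ∀ a ∈ A, ¬ r a b := fun a ha hr =>
      hnot (mem_biUnion.2 ⟨a, ha, mem_filter.2 ⟨hb, hr⟩⟩)
    have hbA : b ∉ A := fun h => hno b h (hrefl b)
    have hins : insert b A ∈ P := by
      refine mem_filter.2 ⟨mem_powerset.2 (insert_subset hb hAΩ), ?_⟩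
      intro x hx y hy hxy
      rcases mem_insert.1 hx with hx | hx <;> rcases mem_insert.1 hy with hy | hy
      · exact absurd (hx.trans hy.symm) hxy
      · exact fun h => hno y hy (hsymm _ _ (hx ▸ h))
      · exact hy ▸ hno x hx
      · exact hA x hx y hy hxy
    have := hmax _ hins
    rw [card_insert_of_notMem hbA] at this
    omega
  calc #Ω ≤ _ := card_le_card hcover
    _ ≤ _ := card_biUnion_le_card_mul _ _ _ fun a ha => hB a (hAΩ ha)

theorem exp_half_mul_log_le_pow {x : ℝ} (hx : 1 ≤ x) (k : ℕ) :
    Real.exp ((k / 2 : ℝ) * Real.log x) ≤ x ^ (k - k / 2) := by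
  have hr : (k / 2 : ℝ) ≤ ((k - k / 2 : ℕ) : ℝ) := by
    rw [div_le_iff₀ two_pos]
    exact_mod_cast (by omega : k ≤ (k - k / 2) * 2)
  calc Real.exp ((k / 2 : ℝ) * Real.log x)
      ≤ Real.exp (((k - k / 2 : ℕ) : ℝ) * Real.log x) :=
        Real.exp_le_exp.2 (mul_le_mul_of_nonneg_right hr (Real.log_nonneg hx))
    _ = x ^ (k - k / 2) := by rw [Real.exp_nat_mul, Real.exp_log (by linarith)]

theorem exists_sparseSigns_packing (M k : ℕ) (hk : 1 ≤ k) (hkM : 2 * k ≤ M) :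
    ∃ A : Finset (Fin M → ℤ),
      (∀ I ∈ A, (∀ j, I j = -1 ∨ I j = 0 ∨ I j = 1) ∧ #{j | I j ≠ 0} ≤ k) ∧
      (2 * ((M : ℝ) - k) / k) ^ (k - k / 2) ≤ (#A : ℝ) ∧
      (∀ I₁ ∈ A, ∀ I₂ ∈ A, I₁ ≠ I₂ → k / 2 < #{j | I₁ j ≠ I₂ j}) := by
  by_cases hk2 : k = 2
  · subst hk2
    have hinj : Function.Injective fun i : Fin M => (Pi.single i 1 : Fin M → ℤ) := fun i j h =>
      by simpa [Pi.single_apply] using congrFun h i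
    refine ⟨univ.image fun i => Pi.single i 1, ?_, ?_, ?_⟩
    · intro I hI
      obtain ⟨i, -, rfl⟩ := mem_image.1 hI
      refine ⟨fun j => ?_, ?_⟩
      · by_cases h : j = i <;> simp [h]
      · simp [Pi.single_apply, filter_eq']
    · rw [card_image_of_injective _ hinj]
      simp
    · intro I₁ h₁ I₂ h₂ hne
      obtain ⟨i, -, rfl⟩ := mem_image.1 h₁
      obtain ⟨j, -, rfl⟩ := mem_image.1 h₂
      have hij : i ≠ j := fun h => hne (by rw [h])
      rw [show 2 / 2 = 1 from rfl, one_lt_card]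
      exact ⟨i, by simp [hij], j, by simp [hij.symm], hij⟩
  · obtain ⟨N, rfl⟩ := Nat.exists_eq_add_of_le' (show k ≤ M by omega)
    obtain ⟨A, hAΩ, hA, hcard⟩ := exists_pairwise_not_and_card_le (sparseSigns (N + k) k)
      (fun I J => #{j | I j ≠ J j} ≤ k / 2) (by simp)
      (fun I J h => by simpa only [ne_comm] using h)
      (2 ^ (k / 2) * (N + k + k).choose (k / 2))
      (fun I hI => card_ball_sparseSigns_le (by omega) hI)
    refine ⟨A, fun I hI => ?_, ?_, fun I hI J hJ h => not_le.1 (hA I hI J hJ h)⟩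
    · obtain ⟨h, h'⟩ := mem_sparseSigns.1 (hAΩ hI)
      exact ⟨h, h'.le⟩
    · rw [card_sparseSigns, add_assoc, ← two_mul] at hcard
      have hnum := choose_mul_pow_le N k hk2 (by omega)
      have hC : 0 < 2 ^ (k / 2) * (N + 2 * k).choose (k / 2) :=
        Nat.mul_pos (by positivity) (Nat.choose_pos (by omega))
      have hpow : 2 ^ k = 2 ^ (k / 2) * 2 ^ (k - k / 2) := by
        rw [← pow_add]
        congr 1
        omega
      have hfin : (2 * N) ^ (k - k / 2) ≤ #A * k ^ (k - k / 2) := by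
        refine Nat.le_of_mul_le_mul_left ?_ hC
        calc _ = 2 ^ k * ((N + 2 * k).choose (k / 2) * N ^ (k - k / 2)) := by
              rw [hpow, mul_pow]; ring
          _ ≤ 2 ^ k * ((N + k).choose k * k ^ (k - k / 2)) := Nat.mul_le_mul_left _ hnum
          _ = (N + k).choose k * 2 ^ k * k ^ (k - k / 2) := by ring
          _ ≤ _ := Nat.mul_le_mul_right _ hcard
          _ = _ := by ring
      have hk0 : (0 : ℝ) < k := by exact_mod_cast hk
      rw [show ((N + k : ℕ) : ℝ) - k = N by push_cast; ring, div_pow,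
        div_le_iff₀ (by positivity)]
      exact_mod_cast hfin

/-- **Varshamov–Gilbert-type packing of sparse sign vectors.**
For integers `1 ≤ k ≤ M/2` there is a family `A` of vectors in `{-1,0,1}^M` with at most
`k` nonzero coordinates, of cardinality at least `exp((k/2) log(2(M-k)/k))`, such that any
two distinct members differ in more than `k/2` coordinates. -/
theorem stmt_9 (M k : ℕ) (hk : 1 ≤ k) (hkM : 2 * k ≤ M) :
    ∃ A : Finset (Fin M → ℤ),
      (∀ I ∈ A, (∀ j, I j = -1 ∨ I j = 0 ∨ I j = 1) ∧
        (Finset.univ.filter (fun j => I j ≠ 0)).card ≤ k) ∧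
      Real.exp ((k / 2 : ℝ) * Real.log (2 * ((M : ℝ) - k) / k)) ≤ (A.card : ℝ) ∧
      (∀ I₁ ∈ A, ∀ I₂ ∈ A, I₁ ≠ I₂ →
        (k : ℝ) / 2 < ((Finset.univ.filter (fun j => I₁ j ≠ I₂ j)).card : ℝ)) := by
  obtain ⟨A, hsparse, hcard, hdist⟩ := exists_sparseSigns_packing M k hk hkM
  have hk0 : (0 : ℝ) < k := by exact_mod_cast hk
  have hM : (2 * k : ℝ) ≤ M := by exact_mod_cast hkM
  have hx : 1 ≤ 2 * ((M : ℝ) - k) / k := by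
    rw [le_div_iff₀ hk0]
    linarith
  refine ⟨A, hsparse, (exp_half_mul_log_le_pow hx k).trans hcard, fun I₁ h₁ I₂ h₂ hne => ?_⟩
  have := hdist I₁ h₁ I₂ h₂ hne
  rw [div_lt_iff₀ two_pos]
  exact_mod_cast (by omega : k < #{j | I₁ j ≠ I₂ j} * 2)
end

section
/- Let n ≥ 2, M ≥ 2 be integers, 0 < q ≤ 1, and t > 0. Define m* = min(⌈(n t²)^{q/2}⌉, M, n) and, when m* < min(M, n), m_* = ⌈m* / (1 + log(M/m*))^{q/2}⌉. If 1 < m_* ≤ m* < min(M, n), then (n t²)^{q/2} (1 + log(M/(n t²)^{q/2}))^{−q/2} ≤ m_* ≤ 4 (n t²)^{q/2} (1 + log(M/(2 (n t²)^{q/2})))^{−q/2}. -/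
open Real

/-- On `(0, eM)` the map `y ↦ y (1 + log (M / y))^{-p}` is nondecreasing. -/
theorem mul_one_add_log_div_rpow_neg_le {M y z p : ℝ} (hM : 0 < M) (hp : 0 ≤ p) (hy : 0 < y)
    (hyz : y ≤ z) (hz : z < Real.exp 1 * M) :
    y * (1 + Real.log (M / y)) ^ (-p) ≤ z * (1 + Real.log (M / z)) ^ (-p) := by
  have hz0 : 0 < z := hy.trans_le hyz
  have hpos : 0 < 1 + Real.log (M / z) := by
    have h : Real.log z < Real.log (Real.exp 1 * M) := Real.log_lt_log hz0 hz
    rw [Real.log_mul (Real.exp_pos 1).ne' hM.ne', Real.log_exp] at h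
    rw [Real.log_div hM.ne' hz0.ne']
    linarith
  have hlog : Real.log (M / z) ≤ Real.log (M / y) :=
    Real.log_le_log (by positivity) (by gcongr)
  exact mul_le_mul hyz (Real.rpow_le_rpow_of_nonpos hpos (by linarith) (by linarith))
    (Real.rpow_nonneg (by linarith) _) hz0.le

/-- **Two-sided bound on the effective model size.**
With `m* = min(⌈(n t²)^{q/2}⌉, M, n)` and `m_* = ⌈m* / (1 + log(M/m*))^{q/2}⌉`
(defined when `m* < min(M,n)`), if `1 < m_* ≤ m* < min(M,n)` then
`(n t²)^{q/2} (1 + log(M/(n t²)^{q/2}))^{-q/2} ≤ m_* ≤ 4 (n t²)^{q/2}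
(1 + log(M/(2 (n t²)^{q/2})))^{-q/2}`. -/
theorem stmt_11 (n M : ℕ) (hn : 2 ≤ n) (hM : 2 ≤ M)
    (q t : ℝ) (hq0 : 0 < q) (hq1 : q ≤ 1) (ht : 0 < t)
    (mstar mlow : ℕ)
    (hmstar : mstar = min (min ⌈((n : ℝ) * t ^ 2) ^ (q / 2)⌉₊ M) n)
    (hmstarlt : mstar < min M n)
    (hmlow : mlow = ⌈(mstar : ℝ) / (1 + Real.log ((M : ℝ) / mstar)) ^ (q / 2)⌉₊)
    (h1 : 1 < mlow) (h2 : mlow ≤ mstar) :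
    ((n : ℝ) * t ^ 2) ^ (q / 2)
        * (1 + Real.log ((M : ℝ) / ((n : ℝ) * t ^ 2) ^ (q / 2))) ^ (-(q / 2))
      ≤ (mlow : ℝ) ∧
    (mlow : ℝ)
      ≤ 4 * ((n : ℝ) * t ^ 2) ^ (q / 2)
          * (1 + Real.log ((M : ℝ) / (2 * ((n : ℝ) * t ^ 2) ^ (q / 2)))) ^ (-(q / 2)) := by
  have hnt : 0 < (n : ℝ) * t ^ 2 := by positivity
  have hx0 : 0 < ((n : ℝ) * t ^ 2) ^ (q / 2) := Real.rpow_pos_of_pos hnt _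
  generalize ((n : ℝ) * t ^ 2) ^ (q / 2) = x at *
  have hceil : mstar = ⌈x⌉₊ := by omega
  have hMlt : (mstar : ℝ) < M := by exact_mod_cast (by omega : mstar < M)
  have hm2 : (2 : ℝ) ≤ mstar := by exact_mod_cast (by omega : 2 ≤ mstar)
  have hM0 : (0 : ℝ) < M := by linarith
  have hxm : x ≤ mstar := hceil ▸ Nat.le_ceil x
  have hmx : (mstar : ℝ) < x + 1 := hceil ▸ Nat.ceil_lt_add_one hx0.le
  have he : 2 < Real.exp 1 := by linarith [Real.exp_one_gt_d9]
  have h2M : 2 * (M : ℝ) < Real.exp 1 * M := by gcongr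
  have hlog : 0 < Real.log ((M : ℝ) / mstar) :=
    Real.log_pos ((one_lt_div (by linarith)).2 hMlt)
  rw [div_eq_mul_inv, ← Real.rpow_neg (by linarith)] at hmlow
  have hp : 0 ≤ q / 2 := by linarith
  have hlow := mul_one_add_log_div_rpow_neg_le hM0 hp hx0 hxm (by linarith)
  have hup := mul_one_add_log_div_rpow_neg_le hM0 hp (by linarith : (0 : ℝ) < mstar)
    (by linarith : (mstar : ℝ) ≤ 2 * x) (by linarith)
  generalize (mstar : ℝ) * (1 + Real.log ((M : ℝ) / mstar)) ^ (-(q / 2)) = z at *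
  have hz1 : 1 < z := by
    rw [hmlow, Nat.lt_ceil] at h1
    exact_mod_cast h1
  have hzle : z ≤ mlow := hmlow ▸ Nat.le_ceil z
  have hzlt : (mlow : ℝ) < z + 1 := hmlow ▸ Nat.ceil_lt_add_one (by linarith)
  exact ⟨hlow.trans hzle, by linarith⟩
end

section
/- Let n ≥ 2, M ≥ 2 be integers, 0 < q ≤ 1, and t > 0. Define m* = min(⌈(n t²)^{q/2}⌉, M, n) and, when m* < min(M, n), m_* = ⌈m* / (1 + log(M/m*))^{q/2}⌉. If 1 < m_* ≤ m* < min(M, n), then there exists a constant C_q > 0 depending only on q such that t² m_*^{1 − 2/q} + m_*(1 + log(M/m_*))/n ≤ C_q · m_*(1 + log(M/m_*))/n. -/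
open Real

/-- **The effective model size balances approximation and search prices.**
For every `0 < q ≤ 1` there is a constant `C_q > 0` depending only on `q` such that,
with `m* = min(⌈(n t²)^{q/2}⌉, M, n)` and `m_* = ⌈m* / (1 + log(M/m*))^{q/2}⌉`
(defined when `m* < min(M,n)`), whenever `1 < m_* ≤ m* < min(M,n)`,
`t² m_*^{1-2/q} + m_*(1 + log(M/m_*))/n ≤ C_q · m_*(1 + log(M/m_*))/n`. -/
theorem stmt_12 (q : ℝ) (hq0 : 0 < q) (hq1 : q ≤ 1) :
    ∃ C : ℝ, 0 < C ∧
      ∀ (n M : ℕ) (_ : 2 ≤ n) (_ : 2 ≤ M) (t : ℝ) (_ : 0 < t)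
        (mstar mlow : ℕ)
        (_ : mstar = min (min ⌈((n : ℝ) * t ^ 2) ^ (q / 2)⌉₊ M) n)
        (_ : mstar < min M n)
        (_ : mlow = ⌈(mstar : ℝ) / (1 + Real.log ((M : ℝ) / mstar)) ^ (q / 2)⌉₊)
        (_ : 1 < mlow) (_ : mlow ≤ mstar),
        t ^ 2 * (mlow : ℝ) ^ (1 - 2 / q)
            + (mlow : ℝ) * (1 + Real.log ((M : ℝ) / mlow)) / n
          ≤ C * ((mlow : ℝ) * (1 + Real.log ((M : ℝ) / mlow)) / n) := by
  refine ⟨2, two_pos, ?_⟩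
  intro n M hn _ t _ m k hm hlt hk hk1 hkm
  have hmceil : m = ⌈((n : ℝ) * t ^ 2) ^ (q / 2)⌉₊ := by omega
  have hmM : m < M := by omega
  have hn0 : (0 : ℝ) < n := by exact_mod_cast (by omega : 0 < n)
  have hm0 : (0 : ℝ) < m := by exact_mod_cast (by omega : 0 < m)
  have hk0 : (0 : ℝ) < k := by exact_mod_cast (by omega : 0 < k)
  have hM0 : (0 : ℝ) < M := by exact_mod_cast (by omega : 0 < M)
  set L : ℝ := 1 + Real.log ((M : ℝ) / m) with hL
  have hL1 : 1 ≤ L := by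
    have : 0 ≤ Real.log ((M : ℝ) / m) :=
      Real.log_nonneg ((one_le_div hm0).2 (by exact_mod_cast hmM.le))
    linarith
  have hL0 : 0 < L := by linarith
  have hLk : L ≤ 1 + Real.log ((M : ℝ) / k) := by
    have : Real.log ((M : ℝ) / m) ≤ Real.log ((M : ℝ) / k) := by
      gcongr
    linarith
  have hmkL : (m : ℝ) ≤ k * L ^ (q / 2) := by
    rw [← div_le_iff₀ (by positivity), hk]
    exact Nat.le_ceil _
  have hpow : ((n : ℝ) * t ^ 2) ^ (q / 2) ≤ k * L ^ (q / 2) :=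
    le_trans (by rw [hmceil]; exact Nat.le_ceil _) hmkL
  have hexp : q / 2 * (2 / q) = 1 := by field_simp
  have hnt : (n : ℝ) * t ^ 2 ≤ (k : ℝ) ^ (2 / q) * L := by
    have h := Real.rpow_le_rpow (by positivity) hpow (by positivity : 0 ≤ 2 / q)
    rwa [Real.mul_rpow hk0.le (by positivity), ← Real.rpow_mul (by positivity),
      ← Real.rpow_mul hL0.le, hexp, Real.rpow_one, Real.rpow_one] at h
  have happrox : t ^ 2 * (k : ℝ) ^ (1 - 2 / q)
      ≤ (k : ℝ) * (1 + Real.log ((M : ℝ) / k)) / n := by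
    rw [le_div_iff₀ hn0]
    calc t ^ 2 * (k : ℝ) ^ (1 - 2 / q) * n
        = (n * t ^ 2) * (k : ℝ) ^ (1 - 2 / q) := by ring
      _ ≤ ((k : ℝ) ^ (2 / q) * L) * (k : ℝ) ^ (1 - 2 / q) := by gcongr
      _ = k * L := by
        rw [mul_right_comm, ← Real.rpow_add hk0, add_sub_cancel, Real.rpow_one]
      _ ≤ k * (1 + Real.log ((M : ℝ) / k)) := by gcongr
  linarith
end

section
/- Suppose Assumption SRC′ holds with γ = k: there exist constants 0 < a ≤ ā, not depending on n, such that for every θ ∈ ℝ^M with at most min(2k, M) nonzero coordinates, a‖θ‖₂ ≤ (1/√n)‖Ξθ‖₂ ≤ ā‖θ‖₂. Then there exists a constant B′ > 0 depending only on a and ā such that inf_{f̂} sup_{f₀ⁿ ∈ F₀(k; M)} E(ASE(f̂(Y))) ≥ B′ · min( σ² k (1 + log(M/k)) / n , σ² r_M / n ), where the infimum is over all estimators f̂, i.e., over all measurable maps from ℝⁿ (the observation vector Y) to ℝⁿ. -/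
open MeasureTheory ProbabilityTheory Finset

theorem pi_withDensity_prod {ι : Type*} [Fintype ι] {α : ι → Type*}
    [∀ i, MeasurableSpace (α i)] (μ : ∀ i, Measure (α i)) [∀ i, IsProbabilityMeasure (μ i)]
    (f : ∀ i, α i → ENNReal) (hf : ∀ i, Measurable (f i))
    [∀ i, SigmaFinite ((μ i).withDensity (f i))] :
    Measure.pi (fun i => (μ i).withDensity (f i)) =
      (Measure.pi μ).withDensity (fun y => ∏ i, f i (y i)) := by
  refine Measure.pi_eq fun s hs => ?_
  rw [withDensity_apply _ (MeasurableSet.univ_pi hs), ← lintegral_indicator (MeasurableSet.univ_pi hs)]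
  have hind : iIndepFun (fun i (y : ∀ i, α i) => (s i).indicator (f i) (y i)) (Measure.pi μ) :=
    iIndepFun_pi (X := fun i => (s i).indicator (f i))
      fun i => ((hf i).indicator (hs i)).aemeasurable
  have hcongr : ∀ y : ∀ i, α i, (Set.univ.pi s).indicator (fun y => ∏ i, f i (y i)) y
      = ∏ i, (s i).indicator (f i) (y i) := by
    intro y
    by_cases hy : y ∈ Set.univ.pi s
    · rw [Set.indicator_of_mem hy]
      exact Finset.prod_congr rfl fun i _ => (Set.indicator_of_mem (hy i trivial) _).symm
    · rw [Set.indicator_of_notMem hy]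
      simp only [Set.mem_pi, Set.mem_univ, true_implies, not_forall] at hy
      obtain ⟨i, hi⟩ := hy
      exact (Finset.prod_eq_zero (Finset.mem_univ i) (Set.indicator_of_notMem hi _)).symm
  simp_rw [hcongr]
  rw [lintegral_prod_eq_prod_lintegral_of_indepFun Finset.univ _ hind
    fun i => ((hf i).indicator (hs i)).comp (measurable_pi_apply i)]
  refine Finset.prod_congr rfl fun i _ => ?_
  rw [withDensity_apply _ (hs i), ← lintegral_indicator (hs i)]
  exact (measurePreserving_eval μ i).lintegral_comp ((hf i).indicator (hs i))

theorem gaussianReal_eq_withDensity_gaussianReal (m₀ m₁ : ℝ) {v : NNReal} (hv : v ≠ 0) :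
    gaussianReal m₁ v = (gaussianReal m₀ v).withDensity
      (fun x => ENNReal.ofReal (Real.exp (((x - m₀) ^ 2 - (x - m₁) ^ 2) / (2 * v)))) := by
  rw [gaussianReal_of_var_ne_zero _ hv, gaussianReal_of_var_ne_zero _ hv,
    ← withDensity_mul _ (measurable_gaussianPDF _ _) (by fun_prop)]
  congr 1
  ext x
  have hv' : (v : ℝ) ≠ 0 := by exact_mod_cast hv
  rw [Pi.mul_apply, gaussianPDF, gaussianPDF, ← ENNReal.ofReal_mul (gaussianPDFReal_nonneg _ _ _),
    gaussianPDFReal, gaussianPDFReal, mul_assoc (√_)⁻¹, ← Real.exp_add]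
  congr 3
  ring

theorem pi_gaussianReal_eq_withDensity {n : ℕ} (μ₀ μ₁ : Fin n → ℝ) {v : NNReal} (hv : v ≠ 0) :
    Measure.pi (fun i => gaussianReal (μ₁ i) v) =
      (Measure.pi fun i => gaussianReal (μ₀ i) v).withDensity
        (fun y => ENNReal.ofReal
          (Real.exp ((∑ i, ((y i - μ₀ i) ^ 2 - (y i - μ₁ i) ^ 2)) / (2 * v)))) := by
  have h := fun i => gaussianReal_eq_withDensity_gaussianReal (μ₀ i) (μ₁ i) hv
  have : ∀ i, SigmaFinite ((gaussianReal (μ₀ i) v).withDensity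
      (fun x => ENNReal.ofReal (Real.exp (((x - μ₀ i) ^ 2 - (x - μ₁ i) ^ 2) / (2 * v))))) :=
    fun i => h i ▸ inferInstance
  simp_rw [fun i => h i]
  rw [pi_withDensity_prod _ _ fun i => by fun_prop]
  congr 1
  ext y
  rw [← ENNReal.ofReal_prod_of_nonneg fun i _ => (Real.exp_pos _).le, ← Real.exp_sum,
    Finset.sum_div]

/-- A chi-square type change of measure between Gaussian product measures. -/
theorem pi_gaussianReal_real_le {n : ℕ} (μ₀ μ₁ : Fin n → ℝ) {v : NNReal} (hv : v ≠ 0)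
    {ε : ℝ} (hε : 0 < ε) {A : Set (Fin n → ℝ)} (hA : MeasurableSet A) :
    (Measure.pi fun i => gaussianReal (μ₁ i) v).real A ≤
      ε / 2 * Real.exp ((∑ i, (μ₁ i - μ₀ i) ^ 2) / v) +
        1 / (2 * ε) * (Measure.pi fun i => gaussianReal (μ₀ i) v).real A := by
  set P₀ := Measure.pi fun i => gaussianReal (μ₀ i) v with hP₀
  set P₂ := Measure.pi fun i => gaussianReal (2 * μ₁ i - μ₀ i) v with hP₂
  set D := Real.exp ((∑ i, (μ₁ i - μ₀ i) ^ 2) / v) with hD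
  set L : (Fin n → ℝ) → ℝ := fun y =>
    Real.exp ((∑ i, ((y i - μ₀ i) ^ 2 - (y i - μ₁ i) ^ 2)) / (2 * v)) with hL
  set K : (Fin n → ℝ) → ℝ := fun y =>
    Real.exp ((∑ i, ((y i - μ₀ i) ^ 2 - (y i - (2 * μ₁ i - μ₀ i)) ^ 2)) / (2 * v)) with hK
  have hv' : (v : ℝ) ≠ 0 := by exact_mod_cast hv
  have hsq : ∀ y, L y ^ 2 = D * K y := by
    intro y
    rw [hL, hD, hK, ← Real.exp_nat_mul, ← Real.exp_add]
    congr 1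
    have : 2 * ∑ i, ((y i - μ₀ i) ^ 2 - (y i - μ₁ i) ^ 2) = 2 * ∑ i, (μ₁ i - μ₀ i) ^ 2 +
        ∑ i, ((y i - μ₀ i) ^ 2 - (y i - (2 * μ₁ i - μ₀ i)) ^ 2) := by
      rw [Finset.mul_sum, Finset.mul_sum, ← Finset.sum_add_distrib]
      exact Finset.sum_congr rfl fun i _ => by ring
    field_simp
    push_cast
    linarith
  have hpt : ∀ y, L y ≤ ε / 2 * D * K y + 1 / (2 * ε) := by
    intro y
    have h := hsq y
    have h1 : ε / 2 * D * K y + 1 / (2 * ε) - L y = (ε * L y - 1) ^ 2 / (2 * ε) := by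
      rw [mul_assoc, ← h]; field_simp; ring
    have h2 : 0 ≤ (ε * L y - 1) ^ 2 / (2 * ε) := by positivity
    linarith
  have hD0 : 0 < D := Real.exp_pos _
  have hmain : Measure.pi (fun i => gaussianReal (μ₁ i) v) A ≤
      ENNReal.ofReal (ε / 2 * D) * P₂ A + ENNReal.ofReal (1 / (2 * ε)) * P₀ A := by
    rw [pi_gaussianReal_eq_withDensity μ₀ μ₁ hv, hP₂,
      pi_gaussianReal_eq_withDensity μ₀ (fun i => 2 * μ₁ i - μ₀ i) hv, withDensity_apply _ hA,
      withDensity_apply _ hA, ← lintegral_const_mul _ (by fun_prop), ← setLIntegral_const,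
      ← lintegral_add_right _ measurable_const]
    refine lintegral_mono fun y => ?_
    rw [← ENNReal.ofReal_mul (by positivity), ← ENNReal.ofReal_add (by positivity) (by positivity)]
    exact ENNReal.ofReal_le_ofReal (hpt y)
  have hP₂1 : P₂ A ≤ 1 := prob_le_one
  have hreal : (Measure.pi fun i => gaussianReal (μ₁ i) v).real A ≤
      (ENNReal.ofReal (ε / 2 * D) * P₂ A + ENNReal.ofReal (1 / (2 * ε)) * P₀ A).toReal :=
    ENNReal.toReal_mono (by finiteness) hmain
  rw [ENNReal.toReal_add (by finiteness) (by finiteness), ENNReal.toReal_mul, ENNReal.toReal_mul,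
    ENNReal.toReal_ofReal (by positivity), ENNReal.toReal_ofReal (by positivity)] at hreal
  refine hreal.trans (add_le_add ?_ le_rfl)
  exact mul_le_of_le_one_right (by positivity) measureReal_le_one

theorem exists_measurable_argmin {T X : Type*} [MeasurableSpace X] [MeasurableSpace T] [Finite T]
    [Nonempty T] [MeasurableSingletonClass T] (g : T → X → ℝ) (hg : ∀ J, Measurable (g J)) :
    ∃ h : X → T, Measurable h ∧ ∀ x J, g (h x) x ≤ g J x := by
  classical
  have := Fintype.ofFinite T
  have key : ∀ s : Finset T, s.Nonempty → ∃ h : X → T, Measurable h ∧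
      ∀ x, ∀ J ∈ s, g (h x) x ≤ g J x := by
    intro s hs
    induction hs using Finset.Nonempty.cons_induction with
    | singleton a => exact ⟨fun _ => a, measurable_const, by simp⟩
    | cons a s _ _ ih =>
      obtain ⟨h, hm, hh⟩ := ih
      have hgh : Measurable fun x => g (h x) x :=
        (measurable_from_prod_countable_left (f := fun p : X × T => g p.2 p.1) hg).comp
          (measurable_id.prodMk hm)
      refine ⟨fun x => if g a x ≤ g (h x) x then a else h x,
        Measurable.ite (measurableSet_le (hg a) hgh) measurable_const hm, fun x J hJ => ?_⟩
      rcases Finset.mem_cons.1 hJ with rfl | hJ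
      · dsimp only; split_ifs with hc
        · exact le_rfl
        · exact (not_le.1 hc).le
      · dsimp only; split_ifs with hc
        · exact hc.trans (hh x J hJ)
        · exact hh x J hJ
  obtain ⟨h, hm, hh⟩ := key Finset.univ Finset.univ_nonempty
  exact ⟨h, hm, fun x J => hh x J (Finset.mem_univ J)⟩

theorem sum_sum_update {ι β : Type*} [Fintype ι] [DecidableEq ι] [Fintype β]
    (b : ι) (F : (ι → β) → β → ℝ) :
    ∑ J, ∑ c, F J c = ∑ J, ∑ c, F (Function.update J b c) (J b) := by
  classical
  rw [← Fintype.sum_prod_type', ← Fintype.sum_prod_type']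
  refine Finset.sum_nbij' (fun p => (Function.update p.1 b p.2, p.1 b))
    (fun p => (Function.update p.1 b p.2, p.1 b)) ?_ ?_ ?_ ?_ ?_ <;> simp

theorem sum_real_eq_coordinate_le {ι β : Type*} [Fintype ι] [DecidableEq ι] [Fintype β] {n : ℕ}
    (u : (ι → β) → Fin n → ℝ) {v : NNReal} (hv : v ≠ 0) (c₀ : β) (b : ι) {q : ℝ} (hq : 0 < q)
    (hqN : q ^ 4 * Fintype.card β = 1)
    (hu : ∀ J, Real.exp ((∑ i, (u J i - u (Function.update J b c₀) i) ^ 2) / v) ≤ 1 / q ^ 2)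
    (h : (Fin n → ℝ) → β) (hh : ∀ c, MeasurableSet (h ⁻¹' {c})) :
    ∑ J, (Measure.pi fun i => gaussianReal (u J i) v).real (h ⁻¹' {J b}) ≤
      q * Fintype.card (ι → β) := by
  set P : (ι → β) → Measure (Fin n → ℝ) := fun J => Measure.pi fun i => gaussianReal (u J i) v
    with hP
  have hbase : (Fintype.card β : ℝ) * ∑ J, (P (Function.update J b c₀)).real (h ⁻¹' {J b}) =
      (Fintype.card (ι → β) : ℝ) := by
    have h1 := sum_sum_update b
      (fun J _ => (P (Function.update J b c₀)).real (h ⁻¹' {J b}))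
    simp only [Finset.sum_const, Finset.card_univ, nsmul_eq_mul, Function.update_idem,
      Function.update_self] at h1
    rw [Finset.mul_sum, h1]
    have h2 : ∀ J, ∑ c, (P (Function.update J b c₀)).real (h ⁻¹' {c}) = 1 := by
      intro J
      rw [sum_measureReal_preimage_singleton _ fun c _ => hh c]
      simp [hP]
    simp [h2]
  have hε : 0 < q ^ 3 := by positivity
  have hstep : ∀ J, (P J).real (h ⁻¹' {J b}) ≤ q / 2 +
      1 / (2 * q ^ 3) * (P (Function.update J b c₀)).real (h ⁻¹' {J b}) := by
    intro J
    refine (pi_gaussianReal_real_le (u (Function.update J b c₀)) (u J) hv hε (hh _)).trans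
      (add_le_add ?_ le_rfl)
    calc q ^ 3 / 2 * _ ≤ q ^ 3 / 2 * (1 / q ^ 2) := by gcongr; exact hu J
      _ = q / 2 := by field_simp
  calc _ ≤ ∑ J, (q / 2 +
      1 / (2 * q ^ 3) * (P (Function.update J b c₀)).real (h ⁻¹' {J b})) :=
        Finset.sum_le_sum fun J _ => hstep J
    _ = q * Fintype.card (ι → β) := by
      rw [Finset.sum_add_distrib, ← Finset.mul_sum, Finset.sum_const, Finset.card_univ,
        nsmul_eq_mul, ← hbase]
      set S := ∑ J, (P (Function.update J b c₀)).real (h ⁻¹' {J b})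
      set N : ℝ := (Fintype.card β : ℝ)
      have : 1 / (2 * q ^ 3) * S = q ^ 4 * N * S / (2 * q ^ 3) := by rw [hqN]; ring
      rw [this]
      field_simp
      ring

/-- A minimax lower bound over a product-indexed family of Gaussian shifts. -/
theorem exists_le_lintegral_loss {ι β : Type*} [Fintype ι] [DecidableEq ι] [Fintype β]
    [DecidableEq β] {n : ℕ}
    (u : (ι → β) → Fin n → ℝ) {v : NNReal} (hv : v ≠ 0) (c₀ : β) {q : ℝ} (hq : 0 < q)
    (hqN : q ^ 4 * Fintype.card β = 1)
    (hu : ∀ b J, Real.exp ((∑ i, (u J i - u (Function.update J b c₀) i) ^ 2) / v) ≤ 1 / q ^ 2)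
    {s w : ℝ} (hs : 0 ≤ s) (hw : 0 ≤ w)
    (hsep : ∀ J J', s * ∑ b, (if J b = J' b then 0 else 1) ≤ w * ∑ i, (u J i - u J' i) ^ 2)
    (f : (Fin n → ℝ) → Fin n → ℝ) (hf : Measurable f) :
    ∃ J, ENNReal.ofReal (s * Fintype.card ι * (1 - q) / 4) ≤
      ∫⁻ y, ENNReal.ofReal (w * ∑ i, (f y i - u J i) ^ 2)
        ∂(Measure.pi fun i => gaussianReal (u J i) v) := by
  let _ : MeasurableSpace (ι → β) := ⊤
  have : MeasurableSingletonClass (ι → β) := ⟨fun _ => trivial⟩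
  have : Nonempty (ι → β) := ⟨fun _ => c₀⟩
  obtain ⟨h, hm, hh⟩ := exists_measurable_argmin
    (fun J y => ∑ i, (f y i - u J i) ^ 2) (fun J => by fun_prop)
  have hA : ∀ b c, MeasurableSet ((fun y => h y b) ⁻¹' {c}) := fun b c =>
    hm (show MeasurableSet {J : ι → β | J b = c} from trivial)
  set P : (ι → β) → Measure (Fin n → ℝ) := fun J => Measure.pi fun i => gaussianReal (u J i) v
    with hP
  set A : (ι → β) → ι → Set (Fin n → ℝ) := fun J b => (fun y => h y b) ⁻¹' {J b} with hAdef
  have hpt : ∀ J y, ∑ b, (A J b)ᶜ.indicator (fun _ => s / 4) y ≤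
      w * ∑ i, (f y i - u J i) ^ 2 := by
    intro J y
    have h1 := hsep (h y) J
    have h2 : ∑ i, (u (h y) i - u J i) ^ 2 ≤ 4 * ∑ i, (f y i - u J i) ^ 2 := by
      have h3 : ∑ i, (u (h y) i - u J i) ^ 2 ≤
          2 * ∑ i, (f y i - u (h y) i) ^ 2 + 2 * ∑ i, (f y i - u J i) ^ 2 := by
        rw [Finset.mul_sum, Finset.mul_sum, ← Finset.sum_add_distrib]
        refine Finset.sum_le_sum fun i _ => ?_
        nlinarith [sq_nonneg ((f y i - u (h y) i) + (f y i - u J i))]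
      linarith [hh y J]
    have h4 : ∑ b, (A J b)ᶜ.indicator (fun _ => s / 4) y =
        s / 4 * ∑ b, (if h y b = J b then 0 else 1) := by
      rw [Finset.mul_sum]
      refine Finset.sum_congr rfl fun b _ => ?_
      by_cases hb : h y b = J b <;> simp [hAdef, hb]
    have h5 := mul_le_mul_of_nonneg_left h2 hw
    rw [h4]
    linarith
  have hint : ∀ J, ENNReal.ofReal (∑ b, (1 - (P J).real (A J b)) * (s / 4)) ≤
      ∫⁻ y, ENNReal.ofReal (w * ∑ i, (f y i - u J i) ^ 2) ∂(P J) := by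
    intro J
    have hi : ∀ b ∈ (Finset.univ : Finset ι),
        Integrable ((A J b)ᶜ.indicator fun _ => s / 4) (P J) := fun b _ =>
      (integrable_const (s / 4)).indicator (hA b _).compl
    have : ∑ b, (1 - (P J).real (A J b)) * (s / 4) =
        ∫ y, ∑ b, (A J b)ᶜ.indicator (fun _ => s / 4) y ∂(P J) := by
      rw [integral_finsetSum _ hi]
      refine Finset.sum_congr rfl fun b _ => ?_
      rw [integral_indicator_const _ (hA b _).compl, probReal_compl_eq_one_sub (hA b _),
        smul_eq_mul]
    rw [this, ofReal_integral_eq_lintegral_ofReal (integrable_finsetSum _ hi)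
      (Filter.Eventually.of_forall fun y => Finset.sum_nonneg fun b _ =>
        Set.indicator_nonneg (fun _ _ => by positivity) _)]
    exact lintegral_mono fun y => ENNReal.ofReal_le_ofReal (hpt J y)
  have hsum : ∑ _J : ι → β, s * Fintype.card ι * (1 - q) / 4 ≤
      ∑ J, ∑ b, (1 - (P J).real (A J b)) * (s / 4) := by
    rw [Finset.sum_comm]
    have hb : ∀ b, Fintype.card (ι → β) * (1 - q) * (s / 4) ≤
        ∑ J, (1 - (P J).real (A J b)) * (s / 4) := by
      intro b
      rw [← Finset.sum_mul, Finset.sum_sub_distrib, Finset.sum_const, Finset.card_univ,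
        nsmul_eq_mul, mul_one]
      have := sum_real_eq_coordinate_le u hv c₀ b hq hqN (hu b) (fun y => h y b) (hA b)
      refine mul_le_mul_of_nonneg_right ?_ (by positivity)
      linarith
    refine le_trans (le_of_eq ?_) (Finset.sum_le_sum fun b _ => hb b)
    simp only [Finset.sum_const, Finset.card_univ, nsmul_eq_mul]
    ring
  obtain ⟨J, -, hJ⟩ := Finset.exists_le_of_sum_le Finset.univ_nonempty hsum
  exact ⟨J, (ENNReal.ofReal_le_ofReal hJ).trans (hint J)⟩

/-- The vector with entry `t` at the positions `φ (b, i)` selected by `J b = some i`. -/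
def blockVector {ι κ ν : Type*} [Fintype ι] [Fintype κ] [DecidableEq κ] [DecidableEq ν]
    (φ : ι × κ ↪ ν) (t : ℝ) (J : ι → Option κ) (j : ν) : ℝ :=
  if ∃ p : ι × κ, J p.1 = some p.2 ∧ φ p = j then t else 0

section blockVector

variable {ι κ ν : Type*} [Fintype ι] [Fintype κ] [DecidableEq κ] [DecidableEq ν]
  (φ : ι × κ ↪ ν) (t : ℝ) (J J' : ι → Option κ)

theorem blockVector_apply_embedding (p : ι × κ) :
    blockVector φ t J (φ p) = if J p.1 = some p.2 then t else 0 := by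
  simp [blockVector]

theorem card_support_blockVector_le [Fintype ν] :
    #{j | blockVector φ t J j ≠ 0} ≤ Fintype.card ι := by
  classical
  have hsub : ({j | blockVector φ t J j ≠ 0} : Finset ν) ⊆
      ({p | J p.1 = some p.2} : Finset (ι × κ)).map φ := by
    intro j hj
    simp only [Finset.mem_filter, Finset.mem_univ, true_and, Finset.mem_map] at hj ⊢
    by_contra hc
    exact hj (if_neg hc)
  refine (Finset.card_le_card hsub).trans ?_
  rw [Finset.card_map]
  refine Finset.card_le_card_of_injOn Prod.fst (fun _ _ => Finset.mem_univ _) ?_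
  intro p hp p' hp' hpp
  simp only [Finset.coe_filter, Finset.mem_univ, true_and, Set.mem_ofPred_eq] at hp hp'
  exact Prod.ext hpp (Option.some_injective _ (by rw [← hp, ← hp', hpp]))

theorem card_support_blockVector_sub_le [Fintype ν] :
    #{j | (blockVector φ t J - blockVector φ t J') j ≠ 0} ≤
      min (2 * Fintype.card ι) (Fintype.card ν) := by
  refine le_min ?_ (Finset.card_le_univ _)
  have hsub : ({j | (blockVector φ t J - blockVector φ t J') j ≠ 0} : Finset ν) ⊆
      ({j | blockVector φ t J j ≠ 0} : Finset ν) ∪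
        ({j | blockVector φ t J' j ≠ 0} : Finset ν) := by
    intro j
    simp only [Finset.mem_filter, Finset.mem_univ, true_and, Finset.mem_union, Pi.sub_apply]
    contrapose!
    rintro ⟨h1, h2⟩
    rw [h1, h2, sub_zero]
  have h1 := card_support_blockVector_le φ t J
  have h2 := card_support_blockVector_le φ t J'
  have h3 := (Finset.card_le_card hsub).trans (Finset.card_union_le _ _)
  omega

theorem hamming_le_sum_sq_blockVector_sub [Fintype ν] :
    t ^ 2 * ∑ b, (if J b = J' b then 0 else 1) ≤
      ∑ j, ((blockVector φ t J - blockVector φ t J') j) ^ 2 := by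
  calc t ^ 2 * ∑ b, (if J b = J' b then 0 else 1)
      ≤ ∑ b, ∑ i, ((blockVector φ t J - blockVector φ t J') (φ (b, i))) ^ 2 := by
        rw [Finset.mul_sum]
        refine Finset.sum_le_sum fun b _ => ?_
        have hnn : ∀ i ∈ (Finset.univ : Finset κ),
            0 ≤ ((blockVector φ t J - blockVector φ t J') (φ (b, i))) ^ 2 :=
          fun i _ => sq_nonneg _
        split_ifs with hb
        · rw [mul_zero]; exact Finset.sum_nonneg hnn
        · obtain ⟨i, hi⟩ : ∃ i, ((blockVector φ t J - blockVector φ t J') (φ (b, i))) ^ 2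
              = t ^ 2 := by
            simp only [Pi.sub_apply, blockVector_apply_embedding]
            obtain hJ | ⟨i, hJ⟩ : J b = none ∨ ∃ i, J b = some i := by cases J b <;> simp
            · obtain ⟨i, hJ'⟩ : ∃ i, J' b = some i :=
                Option.ne_none_iff_exists'.1 fun h => hb (hJ.trans h.symm)
              exact ⟨i, by simp [hJ, hJ']⟩
            · exact ⟨i, by rw [if_pos hJ, if_neg (fun h => hb (hJ.trans h.symm)), sub_zero]⟩
          rw [mul_one, ← hi]
          exact Finset.single_le_sum hnn (Finset.mem_univ i)
    _ = ∑ j ∈ Finset.univ.map φ, ((blockVector φ t J - blockVector φ t J') j) ^ 2 := by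
        rw [Finset.sum_map, Fintype.sum_prod_type]
    _ ≤ _ := Finset.sum_le_sum_of_subset_of_nonneg (Finset.subset_univ _)
        fun _ _ _ => sq_nonneg _

theorem sum_sq_blockVector_sub_update_le [Fintype ν] [DecidableEq ι] (b : ι) :
    ∑ j, ((blockVector φ t J - blockVector φ t (Function.update J b none)) j) ^ 2 ≤ t ^ 2 := by
  rcases hJ : J b with _ | i
  · rw [← hJ, Function.update_eq_self]
    simpa using sq_nonneg t
  · have hoff : ∀ j, j ≠ φ (b, i) →
        (blockVector φ t J - blockVector φ t (Function.update J b none)) j = 0 := by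
      intro j hj
      rw [Pi.sub_apply, sub_eq_zero, blockVector, blockVector]
      refine if_congr (exists_congr fun p => and_congr_left fun hp => ?_) rfl rfl
      by_cases hpb : p.1 = b
      · have : p.2 ≠ i := fun h => hj (by rw [← hp, ← hpb, ← h])
        rw [hpb, hJ, Function.update_self]
        simp [this.symm]
      · rw [Function.update_of_ne hpb]
    rw [Finset.sum_eq_single (φ (b, i)) (fun j _ hj => by rw [hoff j hj]; simp) (by simp),
      Pi.sub_apply, blockVector_apply_embedding, blockVector_apply_embedding]
    simp [hJ]

end blockVector

theorem sparse_riesz_sq {n M : ℕ} (Ξ : Matrix (Fin n) (Fin M) ℝ) {a abar : ℝ}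
    (ha : 0 < a) (θ : Fin M → ℝ)
    (h : a * √(∑ j, (θ j) ^ 2) ≤ (1 / √n) * √(∑ i, (Ξ.mulVec θ i) ^ 2) ∧
      (1 / √n) * √(∑ i, (Ξ.mulVec θ i) ^ 2) ≤ abar * √(∑ j, (θ j) ^ 2)) :
    a ^ 2 * ∑ j, (θ j) ^ 2 ≤ 1 / n * ∑ i, (Ξ.mulVec θ i) ^ 2 ∧
      1 / n * ∑ i, (Ξ.mulVec θ i) ^ 2 ≤ abar ^ 2 * ∑ j, (θ j) ^ 2 := by
  have h1 : √(∑ j, (θ j) ^ 2) ^ 2 = ∑ j, (θ j) ^ 2 :=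
    Real.sq_sqrt (Finset.sum_nonneg fun _ _ => sq_nonneg _)
  have h2 : √(∑ i, (Ξ.mulVec θ i) ^ 2) ^ 2 = ∑ i, (Ξ.mulVec θ i) ^ 2 :=
    Real.sq_sqrt (Finset.sum_nonneg fun _ _ => sq_nonneg _)
  have h3 : (1 / √n) ^ 2 = 1 / (n : ℝ) := by
    rw [div_pow, one_pow, Real.sq_sqrt (Nat.cast_nonneg n)]
  rw [← h1, ← h2, ← h3, ← mul_pow, ← mul_pow, ← mul_pow]
  have h4 : 0 ≤ a * √(∑ j, (θ j) ^ 2) := by positivity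
  exact ⟨pow_le_pow_left₀ h4 h.1 2, pow_le_pow_left₀ (h4.trans h.1) h.2 2⟩

theorem one_add_log_div_le {M k : ℕ} (hk : 1 ≤ k) (hkM : k ≤ M) :
    1 + Real.log ((M : ℝ) / k) ≤ 3 * Real.log ((M / k : ℕ) + 1 : ℝ) := by
  have hk0 : (0 : ℝ) < k := by exact_mod_cast hk
  have hM0 : (0 : ℝ) < M := by exact_mod_cast hk.trans hkM
  have hm : 1 ≤ M / k := (Nat.one_le_div_iff hk).2 hkM
  have hm' : (1 : ℝ) ≤ (M / k : ℕ) := by exact_mod_cast hm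
  have h1 : Real.log ((M : ℝ) / k) ≤ Real.log ((M / k : ℕ) + 1 : ℝ) := by
    refine Real.log_le_log (by positivity) ?_
    rw [div_le_iff₀ hk0]
    have := Nat.lt_mul_div_succ M hk
    have h : (M : ℝ) ≤ k * ((M / k : ℕ) + 1) := by exact_mod_cast this.le
    linarith
  have h2 : Real.log 2 ≤ Real.log ((M / k : ℕ) + 1 : ℝ) :=
    Real.log_le_log (by norm_num) (by linarith)
  linarith [Real.log_two_gt_d9]

/-- **Minimax lower bound over ℓ₀-balls under the sparse Riesz condition** (fixed design;
Theorem 7, case `F = F₀(k;M)`, of Wang, Paterlini, Gao, Yang). For constants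
`0 < a ≤ ā` there is `B' > 0` depending only on `a` and `ā` such that if every `θ` with at
most `min(2k, M)` nonzero entries satisfies `a‖θ‖₂ ≤ (1/√n)‖Ξθ‖₂ ≤ ā‖θ‖₂`, then
`inf_{f̂} sup_{f₀ ∈ F₀(k;M)} E ASE(f̂) ≥ B' min(σ² k (1 + log(M/k))/n, σ² r_M/n)`,
the infimum being over all measurable estimators `f̂ : ℝⁿ → ℝⁿ`. -/
theorem stmt_16 (a abar : ℝ) (ha : 0 < a) (haa : a ≤ abar) :
    ∃ B' : ℝ, 0 < B' ∧
      ∀ (n M : ℕ) (_ : 2 ≤ n) (_ : 2 ≤ M)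
        (Ξ : Matrix (Fin n) (Fin M) ℝ) (σ : ℝ) (_ : 0 < σ)
        (_ : 1 ≤ Ξ.rank)
        (k : ℕ) (_ : 1 ≤ k) (_ : k ≤ M)
        (_ : ∀ θ : Fin M → ℝ,
          (Finset.univ.filter fun j => θ j ≠ 0).card ≤ min (2 * k) M →
            a * Real.sqrt (∑ j, (θ j) ^ 2)
                ≤ (1 / Real.sqrt n) * Real.sqrt (∑ i, (Ξ.mulVec θ i) ^ 2) ∧
            (1 / Real.sqrt n) * Real.sqrt (∑ i, (Ξ.mulVec θ i) ^ 2)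
                ≤ abar * Real.sqrt (∑ j, (θ j) ^ 2)),
        ENNReal.ofReal (B' * min (σ ^ 2 * k * (1 + Real.log ((M : ℝ) / k)) / n)
              (σ ^ 2 * (Ξ.rank : ℝ) / n))
          ≤ ⨅ fhat : {g : (Fin n → ℝ) → (Fin n → ℝ) // Measurable g},
              ⨆ θ : {θ : Fin M → ℝ //
                  (Finset.univ.filter fun j => θ j ≠ 0).card ≤ k},
                ∫⁻ y, ENNReal.ofReal
                    ((1 / (n : ℝ)) * ∑ i, (fhat.1 y i - Ξ.mulVec θ.1 i) ^ 2)
                  ∂(Measure.pi fun i =>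
                      gaussianReal (Ξ.mulVec θ.1 i) (Real.toNNReal (σ ^ 2))) := by
  have hab : 0 < abar := ha.trans_le haa
  refine ⟨a ^ 2 / abar ^ 2 / 160, by positivity, ?_⟩
  intro n M hn _ Ξ σ hσ _ k hk hkM hΞ
  have hn0 : (0 : ℝ) < n := by exact_mod_cast (by omega : 0 < n)
  have hm : 1 ≤ M / k := (Nat.one_le_div_iff hk).2 hkM
  obtain ⟨φ⟩ : Nonempty (Fin k × Fin (M / k) ↪ Fin M) :=
    Function.Embedding.nonempty_of_card_le (by simpa using Nat.mul_div_le M k)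
  have hlog := one_add_log_div_le hk hkM
  set N : ℝ := (M / k : ℕ) + 1 with hN
  have hN2 : 2 ≤ N := by
    have : (1 : ℝ) ≤ (M / k : ℕ) := by exact_mod_cast hm
    linarith
  have hlogN : 0 < Real.log N := Real.log_pos (by linarith)
  set t : ℝ := √(σ ^ 2 * Real.log N / (2 * n * abar ^ 2)) with ht
  have ht2 : t ^ 2 = σ ^ 2 * Real.log N / (2 * n * abar ^ 2) := Real.sq_sqrt (by positivity)
  set q : ℝ := Real.exp (-(Real.log N / 4)) with hq
  have hq0 : 0 < q := Real.exp_pos _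
  have hq4 : q ^ 4 * N = 1 := by
    rw [hq, ← Real.exp_nat_mul]
    nth_rewrite 2 [← Real.exp_log (by linarith : 0 < N)]
    rw [← Real.exp_add]
    simp
    ring
  have hq1 : q ≤ 17 / 20 := by
    by_contra! hc
    have : (17 / 20 : ℝ) ^ 4 < q ^ 4 := pow_lt_pow_left₀ hc (by norm_num) (by norm_num)
    have h5 : q ^ 4 * 2 ≤ q ^ 4 * N := by gcongr
    norm_num at this
    linarith
  have hv : Real.toNNReal (σ ^ 2) ≠ 0 := by
    rw [Ne, Real.toNNReal_eq_zero, not_le]; positivity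
  have hriesz : ∀ J J' : Fin k → Option (Fin (M / k)), _ := fun J J' =>
    sparse_riesz_sq Ξ ha (blockVector φ t J - blockVector φ t J')
      (hΞ _ (by simpa using card_support_blockVector_sub_le φ t J J'))
  simp only [Matrix.mulVec_sub] at hriesz
  refine le_iInf fun fhat => ?_
  obtain ⟨J, hJ⟩ := exists_le_lintegral_loss (β := Option (Fin (M / k)))
    (fun J => Ξ.mulVec (blockVector φ t J)) hv none hq0
    (by simpa [hN] using hq4)
    (by
      intro b J
      have h1 := (hriesz J (Function.update J b none)).2
      have h2 := sum_sq_blockVector_sub_update_le φ t J b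
      have h3 : 1 / q ^ 2 = Real.exp (Real.log N / 2) := by
        rw [hq, ← Real.exp_nat_mul, one_div, ← Real.exp_neg]
        congr 1
        push_cast
        ring
      rw [h3, Real.exp_le_exp, Real.coe_toNNReal _ (by positivity), div_le_iff₀ (by positivity)]
      have h4 := h1.trans (mul_le_mul_of_nonneg_left h2 (by positivity))
      rw [ht2, one_div, inv_mul_le_iff₀ hn0] at h4
      refine h4.trans (le_of_eq ?_)
      field_simp)
    (s := a ^ 2 * t ^ 2) (w := 1 / n) (by positivity) (by positivity)
    (by
      intro J J'
      have h1 := hamming_le_sum_sq_blockVector_sub φ t J J'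
      have h2 := (hriesz J J').1
      rw [mul_assoc]
      exact (mul_le_mul_of_nonneg_left h1 (by positivity)).trans h2)
    fhat.1 fhat.2
  refine le_trans (ENNReal.ofReal_le_ofReal ?_) (hJ.trans (le_iSup_of_le
    ⟨blockVector φ t J, by simpa using card_support_blockVector_le φ t J⟩ le_rfl))
  calc a ^ 2 / abar ^ 2 / 160 * min _ _
      ≤ a ^ 2 / abar ^ 2 / 160 * (σ ^ 2 * k * (1 + Real.log ((M : ℝ) / k)) / n) := by
        gcongr; exact min_le_left _ _
    _ ≤ a ^ 2 / abar ^ 2 / 160 * (σ ^ 2 * k * (3 * Real.log N) / n) := by gcongr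
    _ = a ^ 2 * t ^ 2 * k * (1 - 17 / 20) / 4 := by
        rw [ht2]; field_simp; norm_num
    _ ≤ a ^ 2 * t ^ 2 * Fintype.card (Fin k) * (1 - q) / 4 := by
        rw [Fintype.card_fin]; gcongr
end
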